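/- Glassey–Strauss theorem: Let τ > 0, let f ∈ C¹([0,τ)×ℝ³×ℝ³) and (E,B) ∈ C¹([0,τ)×ℝ³; ℝ³×ℝ³) be a solution of the relativistic Vlasov–Maxwell system with initial data f(0,·,·) = f^in, where f^in ∈ C¹(ℝ³×ℝ³) is nonnegative with compact support, and (E,B)(0,·) = (E^in, B^in) with E^in, B^in ∈ C²(ℝ³;ℝ³) compactly supported and satisfying the compatibility conditions div_x E^in = ∫_{ℝ³} f^in dξ and div_x B^in = 0. If limsup_{t→τ⁻} ( ‖f(t)‖_{W^{1,∞}_{x,ξ}} + ‖E(t)‖_{W^{1,∞}_x} + ‖B(t)‖_{W^{1,∞}_x} ) = +∞, then limsup_{t→τ⁻} R_f(t) = +∞. -/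

import Mathlib

open MeasureTheory Real Set Filter Metric RealInnerProductSpace
open scoped ENNReal NNReal Topology

noncomputable section

/-- Physical space `ℝ³` with its Euclidean structure. -/
abbrev E3 : Type := EuclideanSpace ℝ (Fin 3)

/-- The `i`-th standard basis vector of `ℝ³`. -/
def e3 (i : Fin 3) : E3 := EuclideanSpace.single i 1

/-- The relativistic velocity `v(ξ) = ξ/√(1+|ξ|²)`. -/
def vrel (ξ : E3) : E3 := (Real.sqrt (1 + ‖ξ‖ ^ 2))⁻¹ • ξ

/-- Cross product on `ℝ³`. -/
def cross3 (a b : E3) : E3 :=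
  (WithLp.equiv 2 (Fin 3 → ℝ)).symm
    ![a 1 * b 2 - a 2 * b 1, a 2 * b 0 - a 0 * b 2, a 0 * b 1 - a 1 * b 0]

/-- Partial derivative in the `i`-th coordinate direction. -/
def pd3 (u : E3 → ℝ) (i : Fin 3) (x : E3) : ℝ := fderiv ℝ u x (e3 i)

/-- Divergence of a vector field on `ℝ³`. -/
def divg (F : E3 → E3) (x : E3) : ℝ := ∑ i : Fin 3, pd3 (fun y => F y i) i x

/-- Curl of a vector field on `ℝ³`. -/
def curl3 (F : E3 → E3) (x : E3) : E3 :=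
  (WithLp.equiv 2 (Fin 3 → ℝ)).symm
    ![pd3 (fun y => F y 2) 1 x - pd3 (fun y => F y 1) 2 x,
      pd3 (fun y => F y 0) 2 x - pd3 (fun y => F y 2) 0 x,
      pd3 (fun y => F y 1) 0 x - pd3 (fun y => F y 0) 1 x]

/-- `W^{1,∞}_{x,ξ}` norm (as an extended real) of `f(t,·,·)`. -/
def WfNorm (f : ℝ → E3 → E3 → ℝ) (t : ℝ) : ℝ≥0∞ :=
  ⨆ p : E3 × E3,
    ((‖f t p.1 p.2‖₊ : ℝ≥0∞) + (‖fderiv ℝ (fun q : E3 × E3 => f t q.1 q.2) p‖₊ : ℝ≥0∞))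

/-- `W^{1,∞}_x` norm (as an extended real) of a field `F(t,·)`. -/
def WFieldNorm (F : ℝ → E3 → E3) (t : ℝ) : ℝ≥0∞ :=
  ⨆ x : E3, ((‖F t x‖₊ : ℝ≥0∞) + (‖fderiv ℝ (F t) x‖₊ : ℝ≥0∞))

/-- The momentum support radius
`R_f(t) = inf { r > 0 | f(t,x,ξ) = 0 for all x and all |ξ| > r }` (with value `∞` if no
such radius exists). -/
def Rsupp (f : ℝ → E3 → E3 → ℝ) (t : ℝ) : ℝ≥0∞ :=
  sInf {r : ℝ≥0∞ | 0 < r ∧ ∀ x ξ : E3, r < (‖ξ‖₊ : ℝ≥0∞) → f t x ξ = 0}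

abbrev SM {U V : Type*} [NormedAddCommGroup U] [NormedSpace ℝ U] [NormedAddCommGroup V] [NormedSpace ℝ V] (g : U → V) : Prop := ContDiff ℝ (⊤ : ℕ∞) g

section Slab
set_option linter.unusedSectionVars false

variable {V : Type*} [NormedAddCommGroup V] [NormedSpace ℝ V]

def Sl (V : Type*) (τ : ℝ) : Set (ℝ × V) := Ico 0 τ ×ˢ univ

def dd (τ : ℝ) (g : ℝ × V → ℝ) (w p : ℝ × V) : ℝ := fderivWithin ℝ g (Sl V τ) p w

def CS (τ : ℝ) (g : ℝ × V → ℝ) : Prop :=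
  ∃ Kc : Set V, IsCompact Kc ∧ ∀ s ∈ Ico 0 τ, ∀ z ∉ Kc, g (s, z) = 0

lemma udSl {τ : ℝ} : UniqueDiffOn ℝ (Sl V τ) :=
  (uniqueDiffOn_Ico 0 τ).prod uniqueDiffOn_univ

lemma dd_mul {τ : ℝ} {g h : ℝ × V → ℝ} (hg : ContDiffOn ℝ 1 g (Sl V τ))
    (hh : ContDiffOn ℝ 1 h (Sl V τ)) {p : ℝ × V} (hp : p ∈ Sl V τ) (w : ℝ × V) :
    dd τ (fun q => g q * h q) w p = dd τ g w p * h p + g p * dd τ h w p := by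
  unfold dd
  rw [fderivWithin_fun_mul (udSl p hp) ((hg.differentiableOn one_ne_zero) p hp)
    ((hh.differentiableOn one_ne_zero) p hp)]
  simp [smul_eq_mul]
  ring

lemma dd_add {τ : ℝ} {g h : ℝ × V → ℝ} (hg : ContDiffOn ℝ 1 g (Sl V τ))
    (hh : ContDiffOn ℝ 1 h (Sl V τ)) {p : ℝ × V} (hp : p ∈ Sl V τ) (w : ℝ × V) :
    dd τ (fun q => g q + h q) w p = dd τ g w p + dd τ h w p := by
  unfold dd
  rw [fderivWithin_fun_add (udSl p hp) ((hg.differentiableOn one_ne_zero) p hp)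
    ((hh.differentiableOn one_ne_zero) p hp)]
  simp

lemma dd_eq_fderiv {τ : ℝ} {g : ℝ × V → ℝ} {p : ℝ × V} (hg : DifferentiableAt ℝ g p)
    (hp : p ∈ Sl V τ) (w : ℝ × V) :
    dd τ g w p = fderiv ℝ g p w := by
  unfold dd
  rw [fderivWithin_eq_fderiv (udSl p hp) hg]

lemma dd_hasD {τ : ℝ} {g : ℝ × V → ℝ} (hg : ContDiffOn ℝ 1 g (Sl V τ)) {s : ℝ}
    (hs : s ∈ Ioo 0 τ) (z : V) :
    HasFDerivAt g (fderivWithin ℝ g (Sl V τ) (s, z)) (s, z) := by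
  have hp : (s, z) ∈ Sl V τ := ⟨Ioo_subset_Ico_self hs, mem_univ _⟩
  have := ((hg.differentiableOn one_ne_zero) _ hp).hasFDerivWithinAt
  apply this.hasFDerivAt
  exact prod_mem_nhds (Ico_mem_nhds hs.1 hs.2) univ_mem

lemma dd_hasD_s {τ : ℝ} {g : ℝ × V → ℝ} (hg : ContDiffOn ℝ 1 g (Sl V τ)) {s : ℝ}
    (hs : s ∈ Ioo 0 τ) (z : V) :
    HasDerivAt (fun s => g (s, z)) (dd τ g (1, 0) (s, z)) s := by
  have h1 := dd_hasD hg hs z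
  have h2 : HasDerivAt (fun s : ℝ => (s, z)) ((1 : ℝ), (0 : V)) s :=
    (hasDerivAt_id s).prodMk (hasDerivAt_const s z)
  exact h1.comp_hasDerivAt s h2

lemma dd_hasD_z {τ : ℝ} {g : ℝ × V → ℝ} (hg : ContDiffOn ℝ 1 g (Sl V τ)) {s : ℝ}
    (hs : s ∈ Ico 0 τ) (z : V) :
    HasFDerivAt (fun z => g (s, z))
      ((fderivWithin ℝ g (Sl V τ) (s, z)).comp (ContinuousLinearMap.inr ℝ ℝ V)) z := by
  have hp : (s, z) ∈ Sl V τ := ⟨hs, mem_univ _⟩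
  have h1 := ((hg.differentiableOn one_ne_zero) _ hp).hasFDerivWithinAt
  have h2 : HasFDerivWithinAt (fun z : V => (s, z)) (ContinuousLinearMap.inr ℝ ℝ V) univ z :=
    (hasFDerivAt_prodMk_right s z).hasFDerivWithinAt
  have := h1.comp z h2 (fun z _ => ⟨hs, mem_univ _⟩)
  rwa [hasFDerivWithinAt_univ] at this

lemma dd_z {τ : ℝ} {g : ℝ × V → ℝ} (hg : ContDiffOn ℝ 1 g (Sl V τ)) {s : ℝ}
    (hs : s ∈ Ico 0 τ) (z w : V) :
    dd τ g (0, w) (s, z) = fderiv ℝ (fun z => g (s, z)) z w := by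
  rw [(dd_hasD_z hg hs z).fderiv]; rfl

lemma dd_cont {τ : ℝ} {g : ℝ × V → ℝ} (hg : ContDiffOn ℝ 1 g (Sl V τ)) (w : ℝ × V) :
    ContinuousOn (dd τ g w) (Sl V τ) :=
  (hg.continuousOn_fderivWithin udSl le_rfl).clm_apply continuousOn_const

lemma CS.mul_right {τ : ℝ} {g : ℝ × V → ℝ} (h : CS τ g) (k : ℝ × V → ℝ) :
    CS τ (fun p => g p * k p) := by
  obtain ⟨K, hK, h⟩ := h
  exact ⟨K, hK, fun s hs z hz => by simp [h s hs z hz]⟩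

lemma CS.mul_left {τ : ℝ} {g : ℝ × V → ℝ} (h : CS τ g) (k : ℝ × V → ℝ) :
    CS τ (fun p => k p * g p) := by
  obtain ⟨K, hK, h⟩ := h
  exact ⟨K, hK, fun s hs z hz => by simp [h s hs z hz]⟩

lemma CS.add {τ : ℝ} {g k : ℝ × V → ℝ} (h : CS τ g) (h' : CS τ k) :
    CS τ (fun p => g p + k p) := by
  obtain ⟨K, hK, h⟩ := h
  obtain ⟨K', hK', h'⟩ := h'
  refine ⟨K ∪ K', hK.union hK', fun s hs z hz => ?_⟩
  rw [mem_union, not_or] at hz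
  simp [h s hs z hz.1, h' s hs z hz.2]

lemma CS.sum {τ : ℝ} {g : Fin 3 → ℝ × V → ℝ} (h : ∀ i, CS τ (g i)) :
    CS τ (fun p => ∑ i, g i p) := by
  simp only [Fin.sum_univ_three]
  exact ((h 0).add (h 1)).add (h 2)

lemma CS.dd {τ : ℝ} {g : ℝ × V → ℝ} (h : CS τ g) (w : ℝ × V) : CS τ (dd τ g w) := by
  obtain ⟨K, hK, h⟩ := h
  refine ⟨K, hK, fun s hs z hz => ?_⟩
  have hp : (s, z) ∈ Sl V τ := ⟨hs, mem_univ _⟩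
  have : g =ᶠ[𝓝[Sl V τ] (s, z)] fun _ => 0 := by
    have h1 : (univ : Set ℝ) ×ˢ Kᶜ ∈ 𝓝 (s, z) :=
      prod_mem_nhds univ_mem (hK.isClosed.isOpen_compl.mem_nhds hz)
    filter_upwards [mem_nhdsWithin_of_mem_nhds h1, self_mem_nhdsWithin] with q hq1 hq2
    exact h q.1 hq2.1 q.2 hq1.2
  unfold _root_.dd
  rw [this.fderivWithin_eq (h s hs z hz)]
  simp

variable [MeasureSpace V] [BorelSpace V] [FiniteDimensional ℝ V]
  [Measure.IsAddHaarMeasure (volume : Measure V)]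

lemma intOn {τ t : ℝ} (htτ : t < τ) {g : ℝ × V → ℝ} (hg : ContinuousOn g (Sl V τ))
    (h : CS τ g) : IntegrableOn g (Ioo 0 t ×ˢ univ) := by
  obtain ⟨K, hK, h⟩ := h
  have h1 : IntegrableOn g (Icc 0 t ×ˢ K) :=
    (hg.mono (fun p hp => ⟨⟨hp.1.1, hp.1.2.trans_lt htτ⟩, mem_univ _⟩)).integrableOn_compact
      (isCompact_Icc.prod hK)
  have h2 : IntegrableOn g (Ioo 0 t ×ˢ K) :=
    h1.mono_set (prod_mono Ioo_subset_Icc_self le_rfl)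
  refine h2.of_forall_sdiff_eq_zero (measurableSet_Ioo.prod MeasurableSet.univ) ?_
  rintro ⟨s, z⟩ ⟨hp, hq⟩
  exact h s ⟨hp.1.1.le, hp.1.2.trans htτ⟩ z (fun hz => hq ⟨hp.1, hz⟩)

lemma T1s {u : V → ℝ} (hu : ContDiff ℝ 1 u) (hc : HasCompactSupport u) (w : V) :
    ∫ z, fderiv ℝ u z w = 0 := by
  have hcont : Continuous (fun z => fderiv ℝ u z w) :=
    (hu.continuous_fderiv one_ne_zero).clm_apply continuous_const
  have := integral_mul_fderiv_eq_neg_fderiv_mul_of_integrable (μ := (volume : Measure V))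
    (f := fun _ => (1 : ℝ)) (g := u) (v := w) (by simp)
    (by simpa using hcont.integrable_of_hasCompactSupport (hc.fderiv_apply (𝕜 := ℝ) w))
    (by simpa using hu.continuous.integrable_of_hasCompactSupport hc)
    (by simp) (fun x _ => hu.differentiable one_ne_zero x)
  simpa using this

lemma slice_contDiff {τ : ℝ} {u : ℝ × V → ℝ} (hu : ContDiffOn ℝ 1 u (Sl V τ)) {s : ℝ}
    (hs : s ∈ Ico 0 τ) : ContDiff ℝ 1 (fun z => u (s, z)) := by
  have : ContDiffOn ℝ 1 (fun z => u (s, z)) univ :=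
    hu.comp (contDiff_prodMk_right s).contDiffOn (fun z _ => ⟨hs, mem_univ _⟩)
  exact contDiffOn_univ.1 this

lemma slice_cs {τ : ℝ} {u : ℝ × V → ℝ} (hc : CS τ u) {s : ℝ}
    (hs : s ∈ Ico 0 τ) : HasCompactSupport (fun z => u (s, z)) := by
  obtain ⟨K, hK, h⟩ := hc
  exact HasCompactSupport.intro hK (fun z hz => h s hs z hz)

lemma T1 {τ t : ℝ} (htτ : t < τ) {u : ℝ × V → ℝ} (hu : ContDiffOn ℝ 1 u (Sl V τ))
    (hc : CS τ u) (w : V) : ∫ p in Ioo 0 t ×ˢ univ, dd τ u (0, w) p = 0 := by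
  have hi := intOn htτ (dd_cont hu (0, w)) (hc.dd _)
  rw [Measure.volume_eq_prod, setIntegral_prod _ hi, setIntegral_eq_zero_of_forall_eq_zero]
  intro s hs
  have hs' : s ∈ Ico 0 τ := ⟨hs.1.le, hs.2.trans htτ⟩
  rw [setIntegral_univ]
  simp only [dd_z hu hs']
  exact T1s (slice_contDiff hu hs') (slice_cs hc hs') w

lemma T0 {τ t : ℝ} (ht0 : 0 < t) (htτ : t < τ) {u : ℝ × V → ℝ} (hu : ContDiffOn ℝ 1 u (Sl V τ))
    (hc : CS τ u) (hz : ∀ z, u (t, z) = 0) :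
    ∫ p in Ioo 0 t ×ˢ univ, dd τ u (1, 0) p = - ∫ z, u (0, z) := by
  have hi := intOn htτ (dd_cont hu (1, 0)) (hc.dd _)
  rw [Measure.volume_eq_prod, setIntegral_prod _ hi]
  simp only [setIntegral_univ]
  have hi' : Integrable (Function.uncurry fun s z => dd τ u (1, 0) (s, z))
      ((volume.restrict (Ioo 0 t)).prod (volume : Measure V)) := by
    have : (volume.restrict (Ioo 0 t)).prod (volume : Measure V)
        = (volume : Measure (ℝ × V)).restrict (Ioo 0 t ×ˢ univ) := by
      rw [Measure.volume_eq_prod, ← Measure.prod_restrict, Measure.restrict_univ]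
    rw [this]; exact hi
  rw [integral_integral_swap hi', ← integral_neg]
  congr 1; ext z
  have hmem : ∀ s ∈ Icc 0 t, (s, z) ∈ Sl V τ := fun s hs => ⟨⟨hs.1, hs.2.trans_lt htτ⟩, mem_univ _⟩
  have hcz : Continuous (fun s : ℝ => (s, z)) := by fun_prop
  have key := intervalIntegral.integral_eq_sub_of_hasDerivAt_of_le ht0.le
    (f := fun s => u (s, z)) (f' := fun s => dd τ u (1, 0) (s, z))
    (hu.continuousOn.comp hcz.continuousOn hmem)
    (fun s hs => dd_hasD_s hu ⟨hs.1, hs.2.trans htτ⟩ z)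
    (ContinuousOn.intervalIntegrable (by
      rw [uIcc_of_le ht0.le]
      exact (dd_cont hu (1, 0)).comp hcz.continuousOn hmem))
  rw [intervalIntegral.integral_of_le ht0.le, integral_Ioc_eq_integral_Ioo] at key
  rw [key, hz]; ring

end Slab

def HI {α : Type*} [MeasurableSpace α] (μ : Measure α) (g : α → ℝ) (c : ℝ) : Prop :=
  Integrable g μ ∧ ∫ x, g x ∂μ = c

lemma HI.add {α : Type*} [MeasurableSpace α] {μ : Measure α} {g h : α → ℝ} {c d : ℝ}
    (hg : HI μ g c) (hh : HI μ h d) : HI μ (fun x => g x + h x) (c + d) :=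
  ⟨hg.1.add hh.1, by rw [integral_add hg.1 hh.1, hg.2, hh.2]⟩

lemma HI.sub {α : Type*} [MeasurableSpace α] {μ : Measure α} {g h : α → ℝ} {c d : ℝ}
    (hg : HI μ g c) (hh : HI μ h d) : HI μ (fun x => g x - h x) (c - d) :=
  ⟨hg.1.sub hh.1, by rw [integral_sub hg.1 hh.1, hg.2, hh.2]⟩

section Pdd
variable {V : Type*} [NormedAddCommGroup V] [NormedSpace ℝ V]

def pdd {W : Type*} [NormedAddCommGroup W] [NormedSpace ℝ W] (w : W) (g : W → ℝ) (p : W) : ℝ :=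
  fderiv ℝ g p w

lemma pdd_smooth {g : V → ℝ} (hg : SM g) (w : V) :
    SM (pdd w g) := by
  unfold pdd
  exact (hg.fderiv_right (m := (⊤ : ℕ∞)) (by simp)).clm_apply contDiff_const

lemma sm1 {g : V → ℝ} (hg : SM g) : ContDiff ℝ 1 g :=
  hg.of_le (by exact_mod_cast le_top)

lemma sm_diff {g : V → ℝ} (hg : SM g) : Differentiable ℝ g :=
  (sm1 hg).differentiable one_ne_zero

lemma pdd_comm {g : V → ℝ} (hg : SM g) (w w' : V) :
    pdd w (pdd w' g) = pdd w' (pdd w g) := by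
  have hd : Differentiable ℝ (fderiv ℝ g) :=
    (hg.fderiv_right (m := (⊤ : ℕ∞)) (by simp)).differentiable (by simp)
  have key : ∀ a b : V, ∀ p, pdd a (pdd b g) p = fderiv ℝ (fderiv ℝ g) p a b := by
    intro a b p
    unfold pdd
    rw [fderiv_clm_apply (hd p) (differentiableAt_const _)]
    simp
  ext p
  rw [key, key]
  have := (hg.contDiffAt (x := p)).isSymmSndFDerivAt (by
    rw [minSmoothness_of_isRCLikeNormedField]; exact WithTop.coe_le_coe.2 (le_top : (2 : ℕ∞) ≤ ⊤))
  exact this w w'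

lemma dd_eq_pdd {τ : ℝ} {g : ℝ × V → ℝ} (hg : SM g) {p : ℝ × V}
    (hp : p ∈ Sl V τ) (w : ℝ × V) : dd τ g w p = pdd w g p :=
  dd_eq_fderiv (sm_diff hg p) hp w

def ZT (t : ℝ) (g : ℝ × V → ℝ) : Prop := ∃ ε > 0, ∀ s > t - ε, ∀ z, g (s, z) = 0

lemma ZT.pdd {t : ℝ} {g : ℝ × V → ℝ} (h : ZT t g) (w : ℝ × V) : ZT t (pdd w g) := by
  obtain ⟨ε, he, h⟩ := h
  refine ⟨ε, he, fun s hs z => ?_⟩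
  have : g =ᶠ[𝓝 (s, z)] fun _ => 0 := by
    have h1 : (Ioi (t - ε)) ×ˢ (univ : Set V) ∈ 𝓝 (s, z) :=
      prod_mem_nhds (Ioi_mem_nhds hs) univ_mem
    filter_upwards [h1] with q hq
    exact h q.1 hq.1 q.2
  unfold _root_.pdd
  rw [this.fderiv_eq]; simp

lemma ZT.at {t : ℝ} {g : ℝ × V → ℝ} (h : ZT t g) (z : V) : g (t, z) = 0 := by
  obtain ⟨ε, he, h⟩ := h
  exact h t (by linarith) z

lemma CS.congr {τ : ℝ} {g k : ℝ × V → ℝ} (h : CS τ g) (hk : ∀ p ∈ Sl V τ, k p = g p) :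
    CS τ k := by
  obtain ⟨K, hK, h⟩ := h
  exact ⟨K, hK, fun s hs z hz => by rw [hk _ ⟨hs, mem_univ _⟩, h s hs z hz]⟩

lemma CS.pdd {τ : ℝ} {g : ℝ × V → ℝ} (hg : SM g) (h : CS τ g) (w : ℝ × V) :
    CS τ (pdd w g) :=
  (h.dd w).congr (fun p hp => (dd_eq_pdd hg hp w).symm)

end Pdd

def box (k : ℝ × E3 → ℝ) (p : ℝ × E3) : ℝ :=
  pdd (1, 0) (pdd (1, 0) k) p - ∑ m : Fin 3, pdd (0, e3 m) (pdd (0, e3 m) k) p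

lemma fin3_sum (i : Fin 3) (g : Fin 3 → ℝ) : ∑ m, g m = g i + g (i + 1) + g (i + 2) := by
  rw [Fin.sum_univ_three]
  fin_cases i <;> simp <;> ring

set_option maxHeartbeats 1000000 in
lemma MW {τ t : ℝ} (ht0 : 0 < t) (htτ : t < τ) (i : Fin 3)
    {pi pj pl qj ql J1 J2j J2l σ : ℝ × E3 → ℝ}
    (hpi : ContDiffOn ℝ 1 pi (Sl E3 τ)) (hpj : ContDiffOn ℝ 1 pj (Sl E3 τ))
    (hpl : ContDiffOn ℝ 1 pl (Sl E3 τ)) (hqj : ContDiffOn ℝ 1 qj (Sl E3 τ))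
    (hql : ContDiffOn ℝ 1 ql (Sl E3 τ))
    (e1 : ∀ p ∈ Ioo 0 τ ×ˢ (univ : Set E3),
      dd τ pi (1, 0) p = dd τ ql (0, e3 (i + 1)) p - dd τ qj (0, e3 (i + 2)) p - J1 p)
    (e2 : ∀ p ∈ Ioo 0 τ ×ˢ (univ : Set E3),
      dd τ ql (1, 0) p = - (dd τ pj (0, e3 i) p - dd τ pi (0, e3 (i + 1)) p) - J2l p)
    (e3' : ∀ p ∈ Ioo 0 τ ×ˢ (univ : Set E3),
      dd τ qj (1, 0) p = - (dd τ pi (0, e3 (i + 2)) p - dd τ pl (0, e3 i) p) - J2j p)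
    (e4 : ∀ p ∈ Ioo 0 τ ×ˢ (univ : Set E3),
      dd τ pi (0, e3 i) p + dd τ pj (0, e3 (i + 1)) p + dd τ pl (0, e3 (i + 2)) p = σ p)
    {k : ℝ × E3 → ℝ} (hk : SM k) (hcs : CS τ k) (hzt : ZT t k) :
    ∫ p in Ioo 0 t ×ˢ univ, box k p * pi p =
      - (∫ z, pdd (1, 0) k (0, z) * pi (0, z))
      + (∫ z, k (0, z) * (dd τ ql (0, e3 (i + 1)) (0, z) - dd τ qj (0, e3 (i + 2)) (0, z)))
      + ∫ p in Ioo 0 t ×ˢ univ, (pdd (1, 0) k p * J1 p + pdd (0, e3 i) k p * σ p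
          + pdd (0, e3 (i + 1)) k p * J2l p - pdd (0, e3 (i + 2)) k p * J2j p) := by
  set ks := pdd (1, 0) k with hks
  set ki := pdd (0, e3 i) k with hki
  set kj := pdd (0, e3 (i + 1)) k with hkj
  set kl := pdd (0, e3 (i + 2)) k with hkl
  have S : ∀ w, SM (pdd w k) := fun w => pdd_smooth hk w
  have S1 : ∀ w, ContDiffOn ℝ 1 (pdd w k) (Sl E3 τ) := fun w => (sm1 (S w)).contDiffOn
  have C : ∀ w, CS τ (pdd w k) := fun w => CS.pdd hk hcs w
  have N : ContDiffOn ℝ 1 (fun _ : ℝ × E3 => (-1 : ℝ)) (Sl E3 τ) := contDiffOn_const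
  have P : ∀ w, ∀ g : ℝ × E3 → ℝ, ContDiffOn ℝ 1 g (Sl E3 τ) →
      ContDiffOn ℝ 1 (fun p => pdd w k p * g p) (Sl E3 τ) := fun w g hg => (S1 w).mul hg
  have D : ∀ w w' : ℝ × E3, ∀ g : ℝ × E3 → ℝ, ContDiffOn ℝ 1 g (Sl E3 τ) → ∀ p ∈ Sl E3 τ,
      dd τ (fun p => pdd w k p * g p) w' p = pdd w' (pdd w k) p * g p + pdd w k p * dd τ g w' p := by
    intro w w' g hg p hp
    rw [dd_mul (S1 w) hg hp, dd_eq_pdd (S w) hp]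
  have I0 : ∀ w, ∀ g : ℝ × E3 → ℝ, ContDiffOn ℝ 1 g (Sl E3 τ) → ∀ w',
      IntegrableOn (dd τ (fun p => pdd w k p * g p) w') (Ioo 0 t ×ˢ univ) := fun w g hg w' =>
    intOn htτ (dd_cont (P w g hg) w') (((C w).mul_right g).dd w')
  have Z1 : ∀ w, ∀ g : ℝ × E3 → ℝ, ContDiffOn ℝ 1 g (Sl E3 τ) → ∀ w' : E3,
      ∫ p in Ioo 0 t ×ˢ univ, dd τ (fun p => pdd w k p * g p) (0, w') p = 0 := fun w g hg w' =>
    T1 htτ (P w g hg) ((C w).mul_right g) w'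
  have Z0 : ∀ w, ∀ g : ℝ × E3 → ℝ, ContDiffOn ℝ 1 g (Sl E3 τ) →
      ∫ p in Ioo 0 t ×ˢ univ, dd τ (fun p => pdd w k p * g p) (1, 0) p
        = - ∫ z, pdd w k (0, z) * g (0, z) := fun w g hg =>
    T0 ht0 htτ (P w g hg) ((C w).mul_right g) (fun z => by rw [(hzt.pdd w).at z, zero_mul])
  have hbox : IntegrableOn (fun p => box k p * pi p) (Ioo 0 t ×ˢ univ) := by
    have hb : CS τ (box k) := by
      have h1 : CS τ (fun p => ∑ m : Fin 3, (-1) * pdd (0, e3 m) (pdd (0, e3 m) k) p) :=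
        CS.sum (fun m => (CS.pdd (S _) (C _) _).mul_left _)
      refine ((CS.pdd (S (1,0)) (C (1,0)) (1, 0)).add h1).congr (fun p _ => ?_)
      simp [box, Finset.sum_neg_distrib, sub_eq_add_neg]
    refine intOn htτ ?_ (hb.mul_right _)
    refine ContinuousOn.mul (Continuous.continuousOn ?_) hpi.continuousOn
    unfold box
    refine ((pdd_smooth (S _) _).continuous).sub (continuous_finsetSum _ fun m _ => ?_)
    exact (pdd_smooth (S _) _).continuous
  have key : ∀ p ∈ Ioo 0 t ×ˢ (univ : Set E3),
      (ks p * J1 p + ki p * σ p + kj p * J2l p - kl p * J2j p) =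
      box k p * pi p - (dd τ (fun p => ks p * pi p) (1, 0) p + dd τ (fun p => kj p * ql p) (1, 0) p
        - dd τ (fun p => kl p * qj p) (1, 0) p
        - dd τ (fun p => ks p * ql p) (0, e3 (i + 1)) p + dd τ (fun p => ks p * qj p) (0, e3 (i + 2)) p
        - dd τ (fun p => ki p * pi p) (0, e3 i) p - dd τ (fun p => kj p * pi p) (0, e3 (i + 1)) p
        - dd τ (fun p => kl p * pi p) (0, e3 (i + 2)) p
        + dd τ (fun p => kj p * pj p) (0, e3 i) p - dd τ (fun p => ki p * pj p) (0, e3 (i + 1)) p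
        + dd τ (fun p => kl p * pl p) (0, e3 i) p - dd τ (fun p => ki p * pl p) (0, e3 (i + 2)) p) := by
    intro p hp
    have hp1 : p ∈ Ioo 0 τ ×ˢ (univ : Set E3) := ⟨⟨hp.1.1, hp.1.2.trans htτ⟩, hp.2⟩
    have hp2 : p ∈ Sl E3 τ := ⟨Ioo_subset_Ico_self hp1.1, hp.2⟩
    rw [hks, hki, hkj, hkl, D _ _ _ hpi p hp2, D _ _ _ hql p hp2, D _ _ _ hqj p hp2,
      D _ _ _ hql p hp2, D _ _ _ hqj p hp2,
      D _ _ _ hpi p hp2, D _ _ _ hpi p hp2, D _ _ _ hpi p hp2, D _ _ _ hpj p hp2,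
      D _ _ _ hpj p hp2, D _ _ _ hpl p hp2, D _ _ _ hpl p hp2, ← hks, ← hki, ← hkj, ← hkl]
    have c1 : pdd (1, 0) kj = pdd (0, e3 (i + 1)) ks := pdd_comm hk _ _
    have c2 : pdd (1, 0) kl = pdd (0, e3 (i + 2)) ks := pdd_comm hk _ _
    have c3 : pdd (0, e3 i) kj = pdd (0, e3 (i + 1)) ki := pdd_comm hk _ _
    have c4 : pdd (0, e3 i) kl = pdd (0, e3 (i + 2)) ki := pdd_comm hk _ _
    rw [c1, c2, c3, c4, e1 p hp1, e2 p hp1, e3' p hp1, ← e4 p hp1]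
    unfold box
    rw [fin3_sum i, ← hks, ← hki, ← hkj, ← hkl]
    ring
  rw [setIntegral_congr_fun (measurableSet_Ioo.prod MeasurableSet.univ) key]
  set μ : Measure (ℝ × E3) := volume.restrict (Ioo 0 t ×ˢ univ) with hμ
  have i0 : HI μ (fun p => box k p * pi p) _ := ⟨hbox, rfl⟩
  have i1 : HI μ (dd τ (fun p => ks p * pi p) (1, 0)) _ := ⟨I0 _ _ hpi _, Z0 _ _ hpi⟩
  have i2 : HI μ (dd τ (fun p => kj p * ql p) (1, 0)) _ := ⟨I0 _ _ hql _, Z0 _ _ hql⟩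
  have i3 : HI μ (dd τ (fun p => kl p * qj p) (1, 0)) _ := ⟨I0 _ _ hqj _, Z0 _ _ hqj⟩
  have i4 : HI μ (dd τ (fun p => ks p * ql p) (0, e3 (i + 1))) 0 := ⟨I0 _ _ hql _, Z1 _ _ hql _⟩
  have i5 : HI μ (dd τ (fun p => ks p * qj p) (0, e3 (i + 2))) 0 := ⟨I0 _ _ hqj _, Z1 _ _ hqj _⟩
  have i6 : HI μ (dd τ (fun p => ki p * pi p) (0, e3 i)) 0 := ⟨I0 _ _ hpi _, Z1 _ _ hpi _⟩
  have i7 : HI μ (dd τ (fun p => kj p * pi p) (0, e3 (i + 1))) 0 := ⟨I0 _ _ hpi _, Z1 _ _ hpi _⟩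
  have i8 : HI μ (dd τ (fun p => kl p * pi p) (0, e3 (i + 2))) 0 := ⟨I0 _ _ hpi _, Z1 _ _ hpi _⟩
  have i9 : HI μ (dd τ (fun p => kj p * pj p) (0, e3 i)) 0 := ⟨I0 _ _ hpj _, Z1 _ _ hpj _⟩
  have i10 : HI μ (dd τ (fun p => ki p * pj p) (0, e3 (i + 1))) 0 := ⟨I0 _ _ hpj _, Z1 _ _ hpj _⟩
  have i11 : HI μ (dd τ (fun p => kl p * pl p) (0, e3 i)) 0 := ⟨I0 _ _ hpl _, Z1 _ _ hpl _⟩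
  have i12 : HI μ (dd τ (fun p => ki p * pl p) (0, e3 (i + 2))) 0 := ⟨I0 _ _ hpl _, Z1 _ _ hpl _⟩
  have tot := (i0.sub (((((((((((i1.add i2).sub i3).sub i4).add i5).sub i6).sub i7).sub i8).add
      i9).sub i10).add i11).sub i12)).2
  rw [tot]
  have h0 : (0 : ℝ) ∈ Ico 0 τ := ⟨le_rfl, ht0.trans htτ⟩
  have data : ∀ w : E3, ∀ g : ℝ × E3 → ℝ, ContDiffOn ℝ 1 g (Sl E3 τ) →
      Integrable (fun z => k (0, z) * dd τ g (0, w) (0, z)) ∧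
      ∫ z, k (0, z) * dd τ g (0, w) (0, z) = - ∫ z, pdd (0, w) k (0, z) * g (0, z) := by
    intro w g hg
    have hk1 : ContDiffOn ℝ 1 k (Sl E3 τ) := (sm1 hk).contDiffOn
    have hm : ∀ z : E3, ((0:ℝ), z) ∈ Sl E3 τ := fun z => ⟨h0, mem_univ _⟩
    have hcont : Continuous fun z : E3 => ((0:ℝ), z) := by fun_prop
    have ig : Integrable (fun z => k (0, z) * dd τ g (0, w) (0, z)) := by
      refine Continuous.integrable_of_hasCompactSupport ?_ (slice_cs hcs h0).mul_right
      refine (hk.continuous.comp hcont).mul ?_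
      rw [← continuousOn_univ]
      exact (dd_cont hg (0, w)).comp hcont.continuousOn (fun z _ => hm z)
    have ig2 : Integrable (fun z => pdd (0, w) k (0, z) * g (0, z)) := by
      refine Continuous.integrable_of_hasCompactSupport ?_ (slice_cs (C (0, w)) h0).mul_right
      refine ((S _).continuous.comp hcont).mul ?_
      rw [← continuousOn_univ]
      exact hg.continuousOn.comp hcont.continuousOn (fun z _ => hm z)
    refine ⟨ig, ?_⟩
    have := T1s (slice_contDiff (hk1.mul hg) h0) (slice_cs (hcs.mul_right g) h0) w
    rw [← integral_neg]
    have e : ∀ z, fderiv ℝ (fun z => k (0, z) * g (0, z)) z w =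
        pdd (0, w) k (0, z) * g (0, z) + k (0, z) * dd τ g (0, w) (0, z) := by
      intro z
      rw [← dd_z (hk1.mul hg) h0 z w, dd_mul hk1 hg (hm z), dd_eq_pdd hk (hm z)]
    simp only [Pi.mul_apply, e] at this
    rw [integral_add ig2 ig] at this
    rw [integral_neg]; linarith
  obtain ⟨d1, d2⟩ := data (e3 (i + 1)) ql hql
  obtain ⟨d3, d4⟩ := data (e3 (i + 2)) qj hqj
  simp only [mul_sub]
  rw [integral_sub d1 d3, d2, d4]
  ring

def vv (i : Fin 3) (ξ : E3) : ℝ := vrel ξ i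

lemma sq_pos1 (ξ : E3) : 0 < 1 + ‖ξ‖ ^ 2 := by positivity

lemma vv_eq (i : Fin 3) (ξ : E3) : vv i ξ = (Real.sqrt (1 + ‖ξ‖ ^ 2))⁻¹ * ξ i := by
  simp [vv, vrel]

lemma vrel_smooth : SM vrel := by
  unfold vrel
  have h1 : SM (fun ξ : E3 => Real.sqrt (1 + ‖ξ‖ ^ 2)) :=
    ContDiff.sqrt (contDiff_const.add (contDiff_norm_sq ℝ)) (fun x => (sq_pos1 x).ne')
  exact (h1.inv fun x => (Real.sqrt_pos.2 (sq_pos1 x)).ne').smul contDiff_id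

lemma coord_smooth (i : Fin 3) : SM (fun x : E3 => x i) :=
  (EuclideanSpace.proj (𝕜 := ℝ) i).contDiff

lemma vv_smooth (i : Fin 3) : SM (vv i) :=
  (coord_smooth i).comp vrel_smooth

lemma vrel_norm (ξ : E3) : ‖vrel ξ‖ < 1 := by
  unfold vrel
  have h := Real.sqrt_pos.2 (sq_pos1 ξ)
  rw [norm_smul, norm_inv, Real.norm_of_nonneg h.le, inv_mul_lt_iff₀ h, mul_one]
  rw [Real.lt_sqrt (norm_nonneg _)]; linarith

lemma vv_abs (i : Fin 3) (ξ : E3) : |vv i ξ| ≤ 1 := by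
  have h1 : ‖vrel ξ i‖ ≤ ‖vrel ξ‖ := PiLp.norm_apply_le _ _
  exact h1.trans (vrel_norm ξ).le

lemma vv_deriv (i l : Fin 3) (ξ : E3) : pdd (e3 l) (vv i) ξ =
    (Real.sqrt (1 + ‖ξ‖ ^ 2))⁻¹ * (if i = l then 1 else 0) -
      (Real.sqrt (1 + ‖ξ‖ ^ 2))⁻¹ ^ 3 * (ξ i * ξ l) := by
  have hne := (Real.sqrt_pos.2 (sq_pos1 ξ)).ne'
  have h1 : HasFDerivAt (fun ξ : E3 => ‖ξ‖ ^ 2) (2 • (innerSL ℝ ξ)) ξ :=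
    (hasStrictFDerivAt_norm_sq ξ).hasFDerivAt
  have h2 := ((h1.const_add 1).sqrt (sq_pos1 ξ).ne')
  have h3 := (hasDerivAt_inv hne).comp_hasFDerivAt ξ h2
  have h4 : HasFDerivAt (fun x : E3 => x i) (EuclideanSpace.proj (𝕜 := ℝ) i) ξ :=
    (EuclideanSpace.proj (𝕜 := ℝ) i).hasFDerivAt
  have h5 := h3.mul h4
  have h6 : vv i = fun ξ => (Real.sqrt (1 + ‖ξ‖ ^ 2))⁻¹ * ξ i := by ext; exact vv_eq _ _
  unfold pdd
  rw [h6]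
  have h7 := h5.fderiv
  simp only [Function.comp_def] at h7
  change (fderiv ℝ ((fun ξ : E3 => (Real.sqrt (1 + ‖ξ‖ ^ 2))⁻¹) * fun ξ => ξ i) ξ) (e3 l) = _
  rw [h7]
  simp [e3, EuclideanSpace.inner_single_right, EuclideanSpace.single_apply]
  field_simp
  ring

lemma vv_symm (i l : Fin 3) (ξ : E3) : pdd (e3 l) (vv i) ξ = pdd (e3 i) (vv l) ξ := by
  rw [vv_deriv, vv_deriv, mul_comm (ξ i)]
  simp only [eq_comm]

abbrev PS : Type := E3 × E3

instance instHaarPS : Measure.IsAddHaarMeasure (volume : Measure PS) :=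
  Measure.prod.instIsAddHaarMeasure _ _

def pz (p : ℝ × PS) : ℝ × E3 := (p.1, p.2.1)

def Lf (E B : Fin 3 → ℝ × E3 → ℝ) (l : Fin 3) (p : ℝ × PS) : ℝ :=
  E l (pz p) + (vv (l + 1) p.2.2 * B (l + 2) (pz p) - vv (l + 2) p.2.2 * B (l + 1) (pz p))

structure Sol (τ R : ℝ) (f : ℝ × PS → ℝ) (E B : Fin 3 → ℝ × E3 → ℝ) : Prop where
  hf : ContDiffOn ℝ 1 f (Sl PS τ)
  hE : ∀ i, ContDiffOn ℝ 1 (E i) (Sl E3 τ)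
  hB : ∀ i, ContDiffOn ℝ 1 (B i) (Sl E3 τ)
  fR : ∀ s ∈ Ico 0 τ, ∀ z ξ : E3, R < ‖ξ‖ → f (s, (z, ξ)) = 0
  vl : ∀ p ∈ Ioo 0 τ ×ˢ (univ : Set PS), dd τ f (1, 0) p
    + ∑ j, vv j p.2.2 * dd τ f (0, (e3 j, 0)) p + ∑ l, Lf E B l p * dd τ f (0, (0, e3 l)) p = 0
  am : ∀ i, ∀ p ∈ Ioo 0 τ ×ˢ (univ : Set E3), dd τ (E i) (1, 0) p =
    dd τ (B (i + 2)) (0, e3 (i + 1)) p - dd τ (B (i + 1)) (0, e3 (i + 2)) p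
      - ∫ ξ, vv i ξ * f (p.1, (p.2, ξ))
  fa : ∀ i, ∀ p ∈ Ioo 0 τ ×ˢ (univ : Set E3), dd τ (B i) (1, 0) p =
    -(dd τ (E (i + 2)) (0, e3 (i + 1)) p - dd τ (E (i + 1)) (0, e3 (i + 2)) p)
  gE : ∀ p ∈ Ioo 0 τ ×ˢ (univ : Set E3), ∑ i, dd τ (E i) (0, e3 i) p = ∫ ξ, f (p.1, (p.2, ξ))
  gB : ∀ p ∈ Ioo 0 τ ×ˢ (univ : Set E3), ∑ i, dd τ (B i) (0, e3 i) p = 0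

def CZ (τ : ℝ) (K : ℝ × PS → ℝ) : Prop :=
  ∃ r : ℝ, ∀ s ∈ Ico 0 τ, ∀ z ξ : E3, r < ‖z‖ → K (s, (z, ξ)) = 0

lemma CZ.dd {τ : ℝ} {K : ℝ × PS → ℝ} (h : CZ τ K) (w : ℝ × PS) : CZ τ (dd τ K w) := by
  obtain ⟨r, h⟩ := h
  refine ⟨r, fun s hs z ξ hz => ?_⟩
  have : K =ᶠ[𝓝[Sl PS τ] (s, (z, ξ))] fun _ => 0 := by
    have h1 : (univ : Set ℝ) ×ˢ ({z : E3 | r < ‖z‖} ×ˢ (univ : Set E3)) ∈ 𝓝 (s, (z, ξ)) :=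
      prod_mem_nhds univ_mem (prod_mem_nhds
        ((isOpen_lt continuous_const continuous_norm).mem_nhds hz) univ_mem)
    filter_upwards [mem_nhdsWithin_of_mem_nhds h1, self_mem_nhdsWithin] with q hq1 hq2
    exact h q.1 hq2.1 q.2.1 q.2.2 hq1.2.1
  unfold _root_.dd
  rw [this.fderivWithin_eq (h s hs z ξ hz)]
  simp

lemma CZ.mul_left {τ : ℝ} {K : ℝ × PS → ℝ} (h : CZ τ K) (g : ℝ × PS → ℝ) :
    CZ τ (fun p => g p * K p) := by
  obtain ⟨r, h⟩ := h
  exact ⟨r, fun s hs z ξ hz => by simp [h s hs z ξ hz]⟩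

lemma CZ.mul_right {τ : ℝ} {K : ℝ × PS → ℝ} (h : CZ τ K) (g : ℝ × PS → ℝ) :
    CZ τ (fun p => K p * g p) := by
  obtain ⟨r, h⟩ := h
  exact ⟨r, fun s hs z ξ hz => by simp [h s hs z ξ hz]⟩

lemma CZ.add {τ : ℝ} {K g : ℝ × PS → ℝ} (h : CZ τ K) (h' : CZ τ g) :
    CZ τ (fun p => K p + g p) := by
  obtain ⟨r, h⟩ := h
  obtain ⟨r', h'⟩ := h'
  exact ⟨max r r', fun s hs z ξ hz => by
    simp [h s hs z ξ ((le_max_left _ _).trans_lt hz), h' s hs z ξ ((le_max_right _ _).trans_lt hz)]⟩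

lemma CZ.sum {τ : ℝ} {g : Fin 3 → ℝ × PS → ℝ} (h : ∀ i, CZ τ (g i)) :
    CZ τ (fun p => ∑ i, g i p) := by
  simp only [Fin.sum_univ_three]
  exact ((h 0).add (h 1)).add (h 2)

lemma CZ.mulf {τ R : ℝ} {K f : ℝ × PS → ℝ} (h : CZ τ K)
    (fR : ∀ s ∈ Ico 0 τ, ∀ z ξ : E3, R < ‖ξ‖ → f (s, (z, ξ)) = 0) :
    CS τ (fun p => K p * f p) := by
  obtain ⟨r, h⟩ := h
  refine ⟨closedBall 0 r ×ˢ closedBall 0 R, (isCompact_closedBall _ _).prod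
    (isCompact_closedBall _ _), ?_⟩
  rintro s hs ⟨z, ξ⟩ hz
  by_cases hzz : r < ‖z‖
  · simp [h s hs z ξ hzz]
  · by_cases hx : R < ‖ξ‖
    · simp [fR s hs z ξ hx]
    · exact absurd (show (z, ξ) ∈ closedBall (0 : E3) r ×ˢ closedBall (0 : E3) R by
        simp; constructor <;> linarith) hz

lemma pz_smooth : ContDiff ℝ (⊤ : ℕ∞) pz := by unfold pz; fun_prop

lemma pz_maps {τ : ℝ} : MapsTo pz (Sl PS τ) (Sl E3 τ) := fun p hp => ⟨hp.1, mem_univ _⟩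

lemma lift_cd {τ : ℝ} {g : ℝ × E3 → ℝ} (hg : ContDiffOn ℝ 1 g (Sl E3 τ)) :
    ContDiffOn ℝ 1 (fun p => g (pz p)) (Sl PS τ) :=
  hg.comp (pz_smooth.of_le (by exact_mod_cast le_top)).contDiffOn pz_maps

lemma dd_lift {τ : ℝ} {g : ℝ × E3 → ℝ} (hg : ContDiffOn ℝ 1 g (Sl E3 τ)) {p : ℝ × PS}
    (hp : p ∈ Sl PS τ) (a : ℝ) (w w' : E3) :
    dd τ (fun p => g (pz p)) (a, (w, w')) p = dd τ g (a, w) (pz p) := by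
  have h1 := ((hg.differentiableOn one_ne_zero) _ (pz_maps hp)).hasFDerivWithinAt
  have h2 : HasFDerivAt pz ((ContinuousLinearMap.fst ℝ ℝ PS).prod
      ((ContinuousLinearMap.fst ℝ E3 E3).comp (ContinuousLinearMap.snd ℝ ℝ PS))) p :=
    ((ContinuousLinearMap.fst ℝ ℝ PS).prod
      ((ContinuousLinearMap.fst ℝ E3 E3).comp (ContinuousLinearMap.snd ℝ ℝ PS))).hasFDerivAt
  have h3 := h1.comp p h2.hasFDerivWithinAt pz_maps
  unfold dd
  have h4 := h3.fderivWithin (udSl p hp)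
  simp only [Function.comp_def] at h4
  rw [h4]; rfl

lemma xi_smooth {g : E3 → ℝ} (hg : SM g) :
    SM (fun p : ℝ × PS => g p.2.2) := hg.comp (by fun_prop)

lemma dd_xi {τ : ℝ} {g : E3 → ℝ} (hg : SM g) {p : ℝ × PS}
    (hp : p ∈ Sl PS τ) (a : ℝ) (w w' : E3) :
    dd τ (fun p => g p.2.2) (a, (w, w')) p = pdd w' g p.2.2 := by
  rw [dd_eq_fderiv (sm_diff (xi_smooth hg) p) hp]
  have h2 : HasFDerivAt (fun p : ℝ × PS => p.2.2)
      ((ContinuousLinearMap.snd ℝ E3 E3).comp (ContinuousLinearMap.snd ℝ ℝ PS)) p :=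
    ((ContinuousLinearMap.snd ℝ E3 E3).comp (ContinuousLinearMap.snd ℝ ℝ PS)).hasFDerivAt
  have h3 := (sm_diff hg p.2.2).hasFDerivAt.comp p h2
  have h4 := h3.fderiv
  simp only [Function.comp_def] at h4
  rw [h4]; rfl

section
variable {τ R : ℝ} {f : ℝ × PS → ℝ} {E B : Fin 3 → ℝ × E3 → ℝ}

lemma Lf_cd (hE : ∀ i, ContDiffOn ℝ 1 (E i) (Sl E3 τ)) (hB : ∀ i, ContDiffOn ℝ 1 (B i) (Sl E3 τ))
    (l : Fin 3) : ContDiffOn ℝ 1 (Lf E B l) (Sl PS τ) := by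
  unfold Lf
  have h : ∀ i, ContDiffOn ℝ 1 (fun p : ℝ × PS => vv i p.2.2) (Sl PS τ) :=
    fun i => (sm1 (xi_smooth (vv_smooth i))).contDiffOn
  exact (lift_cd (hE l)).add (((h _).mul (lift_cd (hB _))).sub ((h _).mul (lift_cd (hB _))))

lemma dd_Lf (hE : ∀ i, ContDiffOn ℝ 1 (E i) (Sl E3 τ)) (hB : ∀ i, ContDiffOn ℝ 1 (B i) (Sl E3 τ))
    (l : Fin 3) {p : ℝ × PS} (hp : p ∈ Sl PS τ) (a : ℝ) (w w' : E3) :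
    dd τ (Lf E B l) (a, (w, w')) p = dd τ (E l) (a, w) (pz p)
      + (pdd w' (vv (l + 1)) p.2.2 * B (l + 2) (pz p) + vv (l + 1) p.2.2 * dd τ (B (l + 2)) (a, w) (pz p)
      - (pdd w' (vv (l + 2)) p.2.2 * B (l + 1) (pz p) + vv (l + 2) p.2.2 * dd τ (B (l + 1)) (a, w) (pz p))) := by
  have h : ∀ i, ContDiffOn ℝ 1 (fun p : ℝ × PS => vv i p.2.2) (Sl PS τ) :=
    fun i => (sm1 (xi_smooth (vv_smooth i))).contDiffOn
  have e : Lf E B l = fun p => E l (pz p) + (vv (l + 1) p.2.2 * B (l + 2) (pz p)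
      + (-1) * (vv (l + 2) p.2.2 * B (l + 1) (pz p))) := by
    ext p; simp [Lf]; ring
  have hc : ContDiffOn ℝ 1 (fun _ : ℝ × PS => (-1 : ℝ)) (Sl PS τ) := contDiffOn_const
  have m1 := (h (l + 1)).mul (lift_cd (hB (l + 2)))
  have m2 := (h (l + 2)).mul (lift_cd (hB (l + 1)))
  have c0 : dd τ (fun _ : ℝ × PS => (-1 : ℝ)) (a, (w, w')) p = 0 := by simp [dd]
  rw [e, dd_add (lift_cd (hE l)) (m1.add (hc.mul m2)) hp, dd_add m1 (hc.mul m2) hp,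
    dd_mul hc m2 hp, dd_mul (h _) (lift_cd (hB _)) hp, dd_mul (h _) (lift_cd (hB _)) hp,
    dd_lift (hE l) hp, dd_lift (hB _) hp, dd_lift (hB _) hp, dd_xi (vv_smooth _) hp,
    dd_xi (vv_smooth _) hp, c0]
  ring

lemma dd_zero {V : Type*} [NormedAddCommGroup V] [NormedSpace ℝ V] {τ : ℝ} {g : ℝ × V → ℝ} {p : ℝ × V} : dd τ g (0, 0) p = 0 := by
  unfold dd; exact map_zero _

lemma dvL (hE : ∀ i, ContDiffOn ℝ 1 (E i) (Sl E3 τ)) (hB : ∀ i, ContDiffOn ℝ 1 (B i) (Sl E3 τ))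
    {p : ℝ × PS} (hp : p ∈ Sl PS τ) : ∑ l, dd τ (Lf E B l) (0, (0, e3 l)) p = 0 := by
  simp only [dd_Lf hE hB _ hp, dd_zero]
  rw [Fin.sum_univ_three]
  have h1 := vv_symm 0 1 p.2.2
  have h2 := vv_symm 0 2 p.2.2
  have h3 := vv_symm 1 2 p.2.2
  simp only [show (0:Fin 3)+1=1 from rfl, show (0:Fin 3)+2=2 from rfl, show (1:Fin 3)+1=2 from rfl,
    show (1:Fin 3)+2=0 from rfl, show (2:Fin 3)+1=0 from rfl, show (2:Fin 3)+2=1 from rfl]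
  rw [h1, h2, h3]
  ring

def Tr (τ : ℝ) (K : ℝ × PS → ℝ) (p : ℝ × PS) : ℝ :=
  dd τ K (1, 0) p + ∑ j, vv j p.2.2 * dd τ K (0, (e3 j, 0)) p

def Fo (τ : ℝ) (E B : Fin 3 → ℝ × E3 → ℝ) (K : ℝ × PS → ℝ) (p : ℝ × PS) : ℝ :=
  ∑ l, Lf E B l p * dd τ K (0, (0, e3 l)) p

lemma vcont (j : Fin 3) {S : Set (ℝ × PS)} : ContinuousOn (fun p : ℝ × PS => vv j p.2.2) S :=
  (xi_smooth (vv_smooth j)).continuous.continuousOn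

lemma Tr_cont {K : ℝ × PS → ℝ} (hK : ContDiffOn ℝ 1 K (Sl PS τ)) :
    ContinuousOn (Tr τ K) (Sl PS τ) :=
  (dd_cont hK _).add (continuousOn_finsetSum _ fun j _ => (vcont j).mul (dd_cont hK _))

lemma Fo_cont (h : Sol τ R f E B) {K : ℝ × PS → ℝ} (hK : ContDiffOn ℝ 1 K (Sl PS τ)) :
    ContinuousOn (Fo τ E B K) (Sl PS τ) :=
  continuousOn_finsetSum _ fun l _ => (Lf_cd h.hE h.hB l).continuousOn.mul (dd_cont hK _)

lemma Tr_CZ {K : ℝ × PS → ℝ} (hK : CZ τ K) : CZ τ (Tr τ K) :=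
  (hK.dd _).add (CZ.sum fun j => (hK.dd _).mul_left _)

lemma Fo_CZ {K : ℝ × PS → ℝ} (hK : CZ τ K) : CZ τ (Fo τ E B K) :=
  CZ.sum fun l => (hK.dd _).mul_left _

lemma Sol.int (h : Sol τ R f E B) {t : ℝ} (htτ : t < τ) {G : ℝ × PS → ℝ}
    (hG : ContinuousOn G (Sl PS τ)) (hz : CZ τ G) :
    IntegrableOn (fun p => G p * f p) (Ioo 0 t ×ˢ univ) :=
  intOn htτ (hG.mul h.hf.continuousOn) (hz.mulf h.fR)

lemma WV (h : Sol τ R f E B) {t : ℝ} (ht0 : 0 < t) (htτ : t < τ) {K : ℝ × PS → ℝ}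
    (hK : ContDiffOn ℝ 1 K (Sl PS τ)) (hz : CZ τ K) (hKt : ∀ z, K (t, z) = 0) :
    ∫ p in Ioo 0 t ×ˢ univ, Tr τ K p * f p =
      - (∫ p in Ioo 0 t ×ˢ univ, Fo τ E B K p * f p) - ∫ z, K (0, z) * f (0, z) := by
  have hP : ContDiffOn ℝ 1 (fun p => K p * f p) (Sl PS τ) := hK.mul h.hf
  have hC : CS τ (fun p => K p * f p) := hz.mulf h.fR
  have hv : ∀ i, ContDiffOn ℝ 1 (fun p : ℝ × PS => vv i p.2.2) (Sl PS τ) :=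
    fun i => (sm1 (xi_smooth (vv_smooth i))).contDiffOn
  have hL := Lf_cd h.hE h.hB
  have hvP := fun i => (hv i).mul hP
  have hLP := fun i => (hL i).mul hP
  set μ : Measure (ℝ × PS) := volume.restrict (Ioo 0 t ×ˢ univ) with hμ
  have i0 : HI μ (dd τ (fun p => K p * f p) (1, 0)) (-∫ z, K (0, z) * f (0, z)) :=
    ⟨intOn htτ (dd_cont hP _) (hC.dd _), T0 ht0 htτ hP hC (fun z => by rw [hKt z, zero_mul])⟩
  have i1 : ∀ j, HI μ (dd τ (fun p => vv j p.2.2 * (K p * f p)) (0, (e3 j, 0))) 0 := fun j =>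
    ⟨intOn htτ (dd_cont (hvP j) _) ((hC.mul_left _).dd _), T1 htτ (hvP j) (hC.mul_left _) _⟩
  have i2 : ∀ j, HI μ (dd τ (fun p => Lf E B j p * (K p * f p)) (0, (0, e3 j))) 0 := fun j =>
    ⟨intOn htτ (dd_cont (hLP j) _) ((hC.mul_left _).dd _), T1 htτ (hLP j) (hC.mul_left _) _⟩
  have i3 : HI μ (fun p => Fo τ E B K p * f p) _ := ⟨h.int htτ (Fo_cont h hK) (Fo_CZ hz), rfl⟩
  have tot := ((((i0.add ((i1 0).add ((i1 1).add (i1 2)))).add ((i2 0).add ((i2 1).add (i2 2)))).sub i3)).2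
  rw [show (-(∫ p in Ioo 0 t ×ˢ univ, Fo τ E B K p * f p) - ∫ z, K (0, z) * f (0, z)) =
    -(∫ z, K (0, z) * f (0, z)) + (0 + (0 + 0)) + (0 + (0 + 0)) -
      (∫ p in Ioo 0 t ×ˢ univ, Fo τ E B K p * f p) by ring, ← tot]
  refine setIntegral_congr_fun (measurableSet_Ioo.prod MeasurableSet.univ) (fun p hp => ?_)
  have hp1 : p ∈ Ioo 0 τ ×ˢ (univ : Set PS) := ⟨⟨hp.1.1, hp.1.2.trans htτ⟩, hp.2⟩
  have hp2 : p ∈ Sl PS τ := ⟨Ioo_subset_Ico_self hp1.1, hp.2⟩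
  have hvl := h.vl p hp1
  have hdv := dvL h.hE h.hB hp2
  have hxi : ∀ j, dd τ (fun p : ℝ × PS => vv j p.2.2) (0, (e3 j, 0)) p = 0 := fun j => by
    rw [dd_xi (vv_smooth j) hp2]; simp [pdd]
  simp only [dd_mul (hv _) hP hp2, dd_mul (hL _) hP hp2, dd_mul hK h.hf hp2, hxi, Tr, Fo,
    Fin.sum_univ_three] at hvl hdv ⊢
  linear_combination (-(K p)) * hvl - K p * f p * hdv

end

section
variable {τ R : ℝ} {f : ℝ × PS → ℝ} {E B : Fin 3 → ℝ × E3 → ℝ}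

lemma FUB {t : ℝ} {G : ℝ × PS → ℝ} (hG : IntegrableOn G (Ioo 0 t ×ˢ univ)) :
    ∫ p in Ioo 0 t ×ˢ univ, G p = ∫ q in Ioo 0 t ×ˢ (univ : Set E3), ∫ ξ, G (q.1, (q.2, ξ)) := by
  have mp : MeasurePreserving (MeasurableEquiv.prodAssoc : (ℝ × E3) × E3 ≃ᵐ ℝ × E3 × E3)
      volume volume := volume_preserving_prodAssoc
  have pre : (MeasurableEquiv.prodAssoc : (ℝ × E3) × E3 ≃ᵐ ℝ × E3 × E3) ⁻¹'
      (Ioo 0 t ×ˢ (univ : Set PS)) = (Ioo 0 t ×ˢ (univ : Set E3)) ×ˢ (univ : Set E3) := by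
    ext ⟨⟨a, b⟩, c⟩; simp [MeasurableEquiv.prodAssoc]
  have h1 := mp.setIntegral_preimage_emb (MeasurableEquiv.measurableEmbedding _) G
    (Ioo 0 t ×ˢ (univ : Set PS))
  rw [← h1, pre]
  have h2 := (mp.integrableOn_comp_preimage (MeasurableEquiv.measurableEmbedding _)
    (f := G) (s := Ioo 0 t ×ˢ (univ : Set PS))).2 hG
  rw [pre, Measure.volume_eq_prod] at h2
  rw [Measure.volume_eq_prod]
  refine (setIntegral_prod _ h2).trans ?_
  simp [MeasurableEquiv.prodAssoc]

lemma Sol.xint (h : Sol τ R f E B) {s : ℝ} (hs : s ∈ Ico 0 τ) (z : E3) {a : E3 → ℝ}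
    (ha : Continuous a) : Integrable (fun ξ => a ξ * f (s, (z, ξ))) := by
  refine Continuous.integrable_of_hasCompactSupport ?_ ?_
  · refine ha.mul ?_
    rw [← continuousOn_univ]
    exact h.hf.continuousOn.comp (t := Sl PS τ) (by fun_prop) (fun ξ _ => ⟨hs, mem_univ _⟩)
  · refine HasCompactSupport.intro (isCompact_closedBall (0 : E3) R) (fun ξ hξ => ?_)
    rw [h.fR s hs z ξ (by simpa using hξ), mul_zero]

lemma CS_CZ {k : ℝ × E3 → ℝ} (h : CS τ k) : CZ τ (fun p => k (pz p)) := by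
  obtain ⟨K, hK, h⟩ := h
  obtain ⟨r, hr⟩ := hK.isBounded.subset_closedBall 0
  refine ⟨r, fun s hs z ξ hz => h s hs z (fun hzK => ?_)⟩
  have := hr hzK
  rw [mem_closedBall_zero_iff] at this
  linarith

lemma WW0 (h : Sol τ R f E B) {t : ℝ} (htτ : t < τ)
    {k1 k2 k3 k4 : ℝ × E3 → ℝ} (c1 : Continuous k1) (c2 : Continuous k2) (c3 : Continuous k3)
    (c4 : Continuous k4) (s1 : CS τ k1) (s2 : CS τ k2) (s3 : CS τ k3) (s4 : CS τ k4)
    {a1 a2 a3 a4 : E3 → ℝ} (d1 : Continuous a1) (d2 : Continuous a2) (d3 : Continuous a3)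
    (d4 : Continuous a4) :
    ∫ q in Ioo 0 t ×ˢ (univ : Set E3), (k1 q * (∫ ξ, a1 ξ * f (q.1, (q.2, ξ)))
      + k2 q * (∫ ξ, a2 ξ * f (q.1, (q.2, ξ))) + k3 q * (∫ ξ, a3 ξ * f (q.1, (q.2, ξ)))
      - k4 q * (∫ ξ, a4 ξ * f (q.1, (q.2, ξ)))) =
    ∫ p in Ioo 0 t ×ˢ (univ : Set PS), (a1 p.2.2 * k1 (pz p) + a2 p.2.2 * k2 (pz p)
      + a3 p.2.2 * k3 (pz p) - a4 p.2.2 * k4 (pz p)) * f p := by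
  have cc : ∀ a : E3 → ℝ, Continuous a → ∀ k : ℝ × E3 → ℝ, Continuous k →
      Continuous (fun p : ℝ × PS => a p.2.2 * k (pz p)) := fun a ha k hk =>
    (ha.comp (by fun_prop)).mul (hk.comp pz_smooth.continuous)
  have hc : Continuous (fun p : ℝ × PS => a1 p.2.2 * k1 (pz p) + a2 p.2.2 * k2 (pz p)
      + a3 p.2.2 * k3 (pz p) - a4 p.2.2 * k4 (pz p)) :=
    (((cc _ d1 _ c1).add (cc _ d2 _ c2)).add (cc _ d3 _ c3)).sub (cc _ d4 _ c4)
  have hz : CZ τ (fun p : ℝ × PS => a1 p.2.2 * k1 (pz p) + a2 p.2.2 * k2 (pz p)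
      + a3 p.2.2 * k3 (pz p) - a4 p.2.2 * k4 (pz p)) := by
    have := ((((CS_CZ s1).mul_left (fun p => a1 p.2.2)).add
      ((CS_CZ s2).mul_left (fun p => a2 p.2.2))).add
      ((CS_CZ s3).mul_left (fun p => a3 p.2.2))).add ((CS_CZ s4).mul_left (fun p => - a4 p.2.2))
    convert this using 2
    ring
  rw [FUB (h.int htτ hc.continuousOn hz)]
  refine setIntegral_congr_fun (measurableSet_Ioo.prod MeasurableSet.univ) (fun q hq => ?_)
  have hs : q.1 ∈ Ico 0 τ := ⟨hq.1.1.le, hq.1.2.trans htτ⟩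
  have I := fun (a : E3 → ℝ) (ha : Continuous a) => h.xint hs q.2 ha
  have j : ∀ (a : E3 → ℝ) (ha : Continuous a) (x : ℝ), HI volume
      (fun ξ => x * (a ξ * f (q.1, (q.2, ξ)))) (x * ∫ ξ, a ξ * f (q.1, (q.2, ξ))) :=
    fun a ha x => ⟨(I a ha).const_mul x, integral_const_mul _ _⟩
  have tot := ((((j _ d1 (k1 q)).add (j _ d2 (k2 q))).add (j _ d3 (k3 q))).sub (j _ d4 (k4 q))).2
  rw [← tot]
  refine integral_congr_ae (Eventually.of_forall fun ξ => ?_)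
  simp only [pz]
  ring

def DP (c0 : E3 → ℝ) (c : Fin 3 → E3 → ℝ) (K : ℝ × PS → ℝ) (p : ℝ × PS) : ℝ :=
  c0 p.2.2 * pdd (1, 0) K p + ∑ j, c j p.2.2 * pdd (0, (e3 j, 0)) K p

lemma pdd_lift {k : ℝ × E3 → ℝ} (hk : SM k) (a : ℝ) (w w' : E3) (p : ℝ × PS) :
    pdd (a, (w, w')) (fun p => k (pz p)) p = pdd (a, w) k (pz p) := by
  have h2 : HasFDerivAt pz ((ContinuousLinearMap.fst ℝ ℝ PS).prod
      ((ContinuousLinearMap.fst ℝ E3 E3).comp (ContinuousLinearMap.snd ℝ ℝ PS))) p :=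
    ((ContinuousLinearMap.fst ℝ ℝ PS).prod
      ((ContinuousLinearMap.fst ℝ E3 E3).comp (ContinuousLinearMap.snd ℝ ℝ PS))).hasFDerivAt
  have h3 := (sm_diff hk (pz p)).hasFDerivAt.comp p h2
  have h4 := h3.fderiv
  simp only [Function.comp_def] at h4
  unfold pdd
  rw [h4]; rfl

def cE (i j : Fin 3) (_ : E3) : ℝ := if j = i then 1 else 0
def cB (i j : Fin 3) (ξ : E3) : ℝ :=
  if j = i + 1 then - vv (i + 2) ξ else if j = i + 2 then vv (i + 1) ξ else 0

lemma f12 (i : Fin 3) : i + 1 + 1 = i + 2 ∧ i + 1 + 2 = i ∧ i + 2 + 1 = i ∧ i + 2 + 2 = i + 1 ∧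
    i ≠ i + 1 ∧ i ≠ i + 2 ∧ i + 1 ≠ i + 2 := by
  fin_cases i <;> decide

lemma WWE (h : Sol τ R f E B) {t : ℝ} (ht0 : 0 < t) (htτ : t < τ) (i : Fin 3)
    {k : ℝ × E3 → ℝ} (hk : SM k) (hcs : CS τ k) (hzt : ZT t k) :
    ∫ p in Ioo 0 t ×ˢ univ, box k p * E i p =
      - (∫ z, pdd (1, 0) k (0, z) * E i (0, z))
      + (∫ z, k (0, z) * (dd τ (B (i + 2)) (0, e3 (i + 1)) (0, z)
          - dd τ (B (i + 1)) (0, e3 (i + 2)) (0, z)))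
      + ∫ p in Ioo 0 t ×ˢ univ, DP (vv i) (cE i) (fun p => k (pz p)) p * f p := by
  obtain ⟨q1, q2, q3, q4, n1, n2, n3⟩ := f12 i
  rw [MW ht0 htτ i (h.hE i) (h.hE (i + 1)) (h.hE (i + 2)) (h.hB (i + 1)) (h.hB (i + 2))
    (J1 := fun q => ∫ ξ, vv i ξ * f (q.1, (q.2, ξ))) (σ := fun q => ∫ ξ, 1 * f (q.1, (q.2, ξ)))
    (J2l := fun q => ∫ ξ, 0 * f (q.1, (q.2, ξ))) (J2j := fun q => ∫ ξ, 0 * f (q.1, (q.2, ξ)))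
    (h.am i) (fun p hp => by rw [h.fa (i + 2) p hp, q3, q4]; simp)
    (fun p hp => by rw [h.fa (i + 1) p hp, q1, q2]; simp)
    (fun p hp => by simpa [fin3_sum i] using h.gE p hp) hk hcs hzt]
  have C : ∀ w, Continuous (pdd w k) := fun w => (pdd_smooth hk w).continuous
  have S : ∀ w, CS τ (pdd w k) := fun w => CS.pdd hk hcs w
  rw [WW0 h htτ (C _) (C _) (C _) (C _) (S _) (S _) (S _) (S _) (vv_smooth i).continuous
    (continuous_const (y := (1 : ℝ))) (continuous_const (y := (0 : ℝ)))
    (continuous_const (y := (0 : ℝ)))]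
  congr 2
  ext p
  unfold DP
  rw [fin3_sum i]
  simp only [show ((1 : ℝ), (0 : PS)) = (1, ((0 : E3), (0 : E3))) from rfl, pdd_lift hk, cE]
  simp [n1.symm, n2.symm]

lemma WWB (h : Sol τ R f E B) {t : ℝ} (ht0 : 0 < t) (htτ : t < τ) (i : Fin 3)
    {k : ℝ × E3 → ℝ} (hk : SM k) (hcs : CS τ k) (hzt : ZT t k) :
    ∫ p in Ioo 0 t ×ˢ univ, box k p * B i p =
      - (∫ z, pdd (1, 0) k (0, z) * B i (0, z))
      + (∫ z, k (0, z) * (- (dd τ (E (i + 2)) (0, e3 (i + 1)) (0, z)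
          - dd τ (E (i + 1)) (0, e3 (i + 2)) (0, z))))
      + ∫ p in Ioo 0 t ×ˢ univ, DP (fun _ => 0) (cB i) (fun p => k (pz p)) p * f p := by
  obtain ⟨q1, q2, q3, q4, n1, n2, n3⟩ := f12 i
  have hn : ∀ j, ContDiffOn ℝ 1 (fun p => - E j p) (Sl E3 τ) := fun j => (h.hE j).neg
  have dn : ∀ j w p, p ∈ Sl E3 τ → dd τ (fun p => - E j p) w p = - dd τ (E j) w p :=
    fun j w p hp => by
      unfold dd
      rw [fderivWithin_fun_neg (udSl p hp)]; rfl
  have sl : ∀ p ∈ Ioo 0 τ ×ˢ (univ : Set E3), p ∈ Sl E3 τ := fun p hp =>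
    ⟨Ioo_subset_Ico_self hp.1, hp.2⟩
  have vn : ∀ (j : Fin 3) (q : ℝ × E3), ∫ ξ, (fun ξ => - vv j ξ) ξ * f (q.1, (q.2, ξ)) =
      - ∫ ξ, vv j ξ * f (q.1, (q.2, ξ)) := fun j q => by
    rw [← integral_neg]; simp
  rw [MW ht0 htτ i (h.hB i) (h.hB (i + 1)) (h.hB (i + 2)) (hn (i + 1)) (hn (i + 2))
    (J1 := fun q => ∫ ξ, 0 * f (q.1, (q.2, ξ))) (σ := fun q => ∫ ξ, 0 * f (q.1, (q.2, ξ)))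
    (J2l := fun q => ∫ ξ, (fun ξ => - vv (i + 2) ξ) ξ * f (q.1, (q.2, ξ)))
    (J2j := fun q => ∫ ξ, (fun ξ => - vv (i + 1) ξ) ξ * f (q.1, (q.2, ξ)))
    (fun p hp => by rw [h.fa i p hp, dn _ _ _ (sl p hp), dn _ _ _ (sl p hp)]; simp; ring)
    (fun p hp => by rw [dn _ _ _ (sl p hp), h.am (i + 2) p hp, q3, q4, vn]; ring)
    (fun p hp => by rw [dn _ _ _ (sl p hp), h.am (i + 1) p hp, q1, q2, vn]; ring)
    (fun p hp => by simpa [fin3_sum i] using h.gB p hp) hk hcs hzt]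
  have C : ∀ w, Continuous (pdd w k) := fun w => (pdd_smooth hk w).continuous
  have S : ∀ w, CS τ (pdd w k) := fun w => CS.pdd hk hcs w
  rw [WW0 h htτ (C _) (C _) (C _) (C _) (S _) (S _) (S _) (S _)
    (continuous_const (y := (0 : ℝ))) (continuous_const (y := (0 : ℝ)))
    (a3 := fun ξ => - vv (i + 2) ξ) (a4 := fun ξ => - vv (i + 1) ξ)
    (vv_smooth (i + 2)).continuous.neg (vv_smooth (i + 1)).continuous.neg]
  congr 1
  · congr 2
    ext z
    have hz : ((0 : ℝ), z) ∈ Sl E3 τ := ⟨⟨le_rfl, ht0.trans htτ⟩, mem_univ _⟩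
    rw [dn _ _ _ hz, dn _ _ _ hz]; ring
  · congr 1
    ext p
    unfold DP
    rw [fin3_sum i]
    simp only [show ((1 : ℝ), (0 : PS)) = (1, ((0 : E3), (0 : E3))) from rfl, pdd_lift hk, cB]
    simp [n1, n2, n3.symm]

end

def om (j : Fin 3) (z : E3) : ℝ := z j / ‖z‖

lemma inner_sum3 (z w : E3) : ⟪z, w⟫ = ∑ j, z j * w j := by
  simp [PiLp.inner_apply, mul_comm]

lemma sum_vv_om (ξ z : E3) : ∑ j, vv j ξ * om j z = ⟪vrel ξ, z⟫ / ‖z‖ := by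
  rw [inner_sum3, Finset.sum_div]
  exact Finset.sum_congr rfl fun j _ => by simp [vv, om, mul_div_assoc]

lemma den_pos (ξ z : E3) : 0 < 1 + ∑ j, vv j ξ * om j z := by
  rw [sum_vv_om]
  have h1 := abs_real_inner_le_norm (vrel ξ) z
  have h2 := vrel_norm ξ
  rcases eq_or_ne z 0 with rfl | hz
  · simp
  · have hz' := norm_pos_iff.2 hz
    have : |⟪vrel ξ, z⟫ / ‖z‖| < 1 := by
      rw [abs_div, abs_norm, div_lt_one hz']
      nlinarith
    linarith [(abs_lt.1 this).1]

structure Van (δ : ℝ) (b : PS → ℝ) : Prop where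
  sm : SM b
  zr : ∀ z ξ : E3, ‖z‖ < δ → b (z, ξ) = 0

structure Ker (n : ℕ) (b : PS → ℝ) : Prop where
  van : Van 1 b
  hom : ∀ (z ξ : E3) (r : ℝ), 2 < ‖z‖ → 1 ≤ r → r ^ n * b (r • z, ξ) = b (z, ξ)

def scl (n : ℕ) (δ : ℝ) (b : PS → ℝ) (q : PS) : ℝ := (δ ^ n)⁻¹ * b (δ⁻¹ • q.1, q.2)

section PddAlg
variable {W : Type*} [NormedAddCommGroup W] [NormedSpace ℝ W] {g h : W → ℝ}

lemma pdd_add (hg : SM g) (hh : SM h) (w p : W) :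
    pdd w (fun q => g q + h q) p = pdd w g p + pdd w h p := by
  unfold pdd
  rw [fderiv_fun_add (sm_diff hg p) (sm_diff hh p)]
  simp

lemma pdd_cmul (hg : SM g) (c : ℝ) (w p : W) :
    pdd w (fun q => c * g q) p = c * pdd w g p := by
  unfold pdd
  rw [fderiv_const_mul (sm_diff hg p)]
  simp

lemma pdd_congr {w p : W} (h' : g =ᶠ[𝓝 p] h) : pdd w g p = pdd w h p := by
  unfold pdd; rw [h'.fderiv_eq]

lemma pdd_wsmul (c : ℝ) (w p : W) : pdd (c • w) g p = c * pdd w g p := by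
  unfold pdd; simp

end PddAlg

lemma nhds_z {P : E3 → Prop} (hP : IsOpen {z | P z}) {z ξ : E3} (hz : P z) :
    ∀ᶠ q : PS in 𝓝 (z, ξ), P q.1 :=
  (hP.preimage continuous_fst).mem_nhds hz

lemma Van.pdd {δ : ℝ} {b : PS → ℝ} (h : Van δ b) (w : PS) : Van δ (pdd w b) := by
  refine ⟨pdd_smooth h.sm w, fun z ξ hz => ?_⟩
  have : b =ᶠ[𝓝 (z, ξ)] fun _ => 0 := by
    filter_upwards [nhds_z (isOpen_lt continuous_norm continuous_const) hz] with q hq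
    exact h.zr q.1 q.2 hq
  rw [pdd_congr this]; simp [_root_.pdd]

lemma pdd_scale {b : PS → ℝ} (hb : SM b) (r : ℝ) (w w' : E3) (q : PS) :
    pdd (w, w') (fun q : PS => b (r • q.1, q.2)) q = pdd (r • w, w') b (r • q.1, q.2) := by
  have h2 : HasFDerivAt (fun q : PS => (r • q.1, q.2))
      ((r • ContinuousLinearMap.fst ℝ E3 E3).prod (ContinuousLinearMap.snd ℝ E3 E3)) q :=
    ((r • ContinuousLinearMap.fst ℝ E3 E3).prod (ContinuousLinearMap.snd ℝ E3 E3)).hasFDerivAt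
  have h3 := (sm_diff hb (r • q.1, q.2)).hasFDerivAt.comp q h2
  have h4 := h3.fderiv
  simp only [Function.comp_def] at h4
  unfold pdd
  rw [h4]; rfl

lemma scale_smooth {b : PS → ℝ} (hb : SM b) (r : ℝ) :
    SM (fun q : PS => b (r • q.1, q.2)) := hb.comp (by fun_prop)

lemma scl_pdd {n : ℕ} {δ : ℝ} {b : PS → ℝ} (hb : SM b)
    (w w' : E3) (q : PS) : pdd (w, w') (scl n δ b) q =
      (δ ^ n)⁻¹ * pdd (δ⁻¹ • w, w') b (δ⁻¹ • q.1, q.2) := by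
  unfold scl
  rw [pdd_cmul (scale_smooth hb _), pdd_scale hb]

lemma scl_pz {n : ℕ} {δ : ℝ} {b : PS → ℝ} (hb : SM b)
    (w : E3) : pdd (w, 0) (scl n δ b) = scl (n + 1) δ (pdd (w, 0) b) := by
  ext q
  rw [scl_pdd hb]
  have : ((δ⁻¹ • w, 0) : PS) = δ⁻¹ • (w, 0) := by simp
  rw [this, pdd_wsmul]
  unfold scl
  rw [pow_succ, mul_inv]; ring

lemma scl_px {n : ℕ} {δ : ℝ} {b : PS → ℝ} (hb : SM b)
    (w : E3) : pdd (0, w) (scl n δ b) = scl n δ (pdd (0, w) b) := by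
  ext q
  rw [scl_pdd hb, smul_zero]; rfl

lemma scl_van {n : ℕ} {δ : ℝ} (hδ : 0 < δ) {b : PS → ℝ} (hb : Van 1 b) : Van δ (scl n δ b) := by
  refine ⟨contDiff_const.mul (scale_smooth hb.sm _), fun z ξ hz => ?_⟩
  unfold scl
  rw [hb.zr, mul_zero]
  rw [norm_smul, norm_inv, Real.norm_of_nonneg hδ.le, inv_mul_lt_iff₀ hδ, mul_one]
  exact hz

lemma Ker.pz {n : ℕ} {b : PS → ℝ} (h : Ker n b) (w : E3) : Ker (n + 1) (pdd (w, 0) b) := by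
  refine ⟨h.van.pdd _, fun z ξ r hz hr => ?_⟩
  have e : (fun q : PS => r ^ n * b (r • q.1, q.2)) =ᶠ[𝓝 (z, ξ)] b := by
    filter_upwards [nhds_z (isOpen_lt continuous_const continuous_norm) hz] with q hq
    exact h.hom q.1 q.2 r hq hr
  rw [← pdd_congr e, pdd_cmul (scale_smooth h.van.sm _), pdd_scale h.van.sm]
  have : ((r • w, 0) : PS) = r • (w, 0) := by simp
  rw [this, pdd_wsmul, pow_succ]; ring

lemma Ker.px {n : ℕ} {b : PS → ℝ} (h : Ker n b) (w : E3) : Ker n (pdd (0, w) b) := by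
  refine ⟨h.van.pdd _, fun z ξ r hz hr => ?_⟩
  have e : (fun q : PS => r ^ n * b (r • q.1, q.2)) =ᶠ[𝓝 (z, ξ)] b := by
    filter_upwards [nhds_z (isOpen_lt continuous_const continuous_norm) hz] with q hq
    exact h.hom q.1 q.2 r hq hr
  rw [← pdd_congr e, pdd_cmul (scale_smooth h.van.sm _), pdd_scale h.van.sm, smul_zero]

lemma Ker.xmul {n : ℕ} {b : PS → ℝ} (h : Ker n b) {c : E3 → ℝ} (hc : SM c) :
    Ker n (fun q => c q.2 * b q) :=
  ⟨⟨(hc.comp contDiff_snd).mul h.van.sm, fun z ξ hz => by simp [h.van.zr z ξ hz]⟩,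
    fun z ξ r hz hr => by simp only; rw [← h.hom z ξ r hz hr]; ring⟩

lemma Ker.add {n : ℕ} {b b' : PS → ℝ} (h : Ker n b) (h' : Ker n b') :
    Ker n (fun q => b q + b' q) :=
  ⟨⟨h.van.sm.add h'.van.sm, fun z ξ hz => by simp [h.van.zr z ξ hz, h'.van.zr z ξ hz]⟩,
    fun z ξ r hz hr => by rw [← h.hom z ξ r hz hr, ← h'.hom z ξ r hz hr]; ring⟩

lemma Ker.sub {n : ℕ} {b b' : PS → ℝ} (h : Ker n b) (h' : Ker n b') :
    Ker n (fun q => b q - b' q) :=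
  ⟨⟨h.van.sm.sub h'.van.sm, fun z ξ hz => by simp [h.van.zr z ξ hz, h'.van.zr z ξ hz]⟩,
    fun z ξ r hz hr => by rw [← h.hom z ξ r hz hr, ← h'.hom z ξ r hz hr]; ring⟩

lemma Ker.sum {n : ℕ} {b : Fin 3 → PS → ℝ} (h : ∀ j, Ker n (b j)) :
    Ker n (fun q => ∑ j, b j q) := by
  simp only [Fin.sum_univ_three]
  exact ((h 0).add (h 1)).add (h 2)

lemma om_smul {r : ℝ} (hr : 0 < r) (j : Fin 3) (z : E3) : om j (r • z) = om j z := by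
  unfold om
  rw [norm_smul, Real.norm_of_nonneg hr.le, PiLp.smul_apply, smul_eq_mul,
    mul_div_mul_left _ _ hr.ne']

lemma om_cda (j : Fin 3) {z : E3} (hz : z ≠ 0) : ContDiffAt ℝ (⊤ : ℕ∞) (om j) z :=
  (coord_smooth j).contDiffAt.div (contDiffAt_norm ℝ hz) (norm_ne_zero_iff.2 hz)

lemma van_mul {δ : ℝ} (hδ : 0 < δ) {b w : PS → ℝ} (hb : Van δ b)
    (hw : ∀ q : PS, q.1 ≠ 0 → ContDiffAt ℝ (⊤ : ℕ∞) w q) : Van δ (fun q => b q * w q) := by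
  refine ⟨contDiff_iff_contDiffAt.2 fun q => ?_, fun z ξ hz => by simp [hb.zr z ξ hz]⟩
  by_cases hq : q.1 = 0
  · have : (fun q => b q * w q) =ᶠ[𝓝 q] fun _ => 0 := by
      have hq2 : ‖q.1‖ < δ := by simpa [hq] using hδ
      filter_upwards [nhds_z (ξ := q.2) (isOpen_lt continuous_norm continuous_const) hq2] with x hx
      simp [hb.zr x.1 x.2 hx]
    exact contDiffAt_const.congr_of_eventuallyEq this
  · exact hb.sm.contDiffAt.mul (hw q hq)

def tq (c0 : E3 → ℝ) (c : Fin 3 → E3 → ℝ) (q : PS) : ℝ :=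
  (c0 q.2 + ∑ j, c j q.2 * om j q.1) / (1 + ∑ j, vv j q.2 * om j q.1)

def TT (c0 : E3 → ℝ) (c : Fin 3 → E3 → ℝ) (b : PS → ℝ) (q : PS) : ℝ := b q * tq c0 c q

def NN (c0 : E3 → ℝ) (c : Fin 3 → E3 → ℝ) (b : PS → ℝ) (q : PS) : ℝ :=
  (∑ j, c j q.2 * pdd (e3 j, 0) b q) - ∑ j, vv j q.2 * pdd (e3 j, 0) (TT c0 c b) q

section
variable {c0 : E3 → ℝ} {c : Fin 3 → E3 → ℝ}

lemma tq_cda (h0 : SM c0) (hc : ∀ j, SM (c j)) (q : PS)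
    (hq : q.1 ≠ 0) : ContDiffAt ℝ (⊤ : ℕ∞) (tq c0 c) q := by
  have ho : ∀ j, ContDiffAt ℝ (⊤ : ℕ∞) (fun q : PS => om j q.1) q := fun j =>
    (om_cda j hq).comp q contDiffAt_fst
  have hx : ∀ {g : E3 → ℝ}, SM g → ContDiffAt ℝ (⊤ : ℕ∞) (fun q : PS => g q.2) q :=
    fun hg => (hg.comp contDiff_snd).contDiffAt
  refine ContDiffAt.div ?_ ?_ (den_pos q.2 q.1).ne'
  · exact (hx h0).add (ContDiffAt.sum fun j _ => (hx (hc j)).mul (ho j))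
  · exact contDiffAt_const.add (ContDiffAt.sum fun j _ => (hx (vv_smooth j)).mul (ho j))

lemma tq_smul {r : ℝ} (hr : 0 < r) (z ξ : E3) : tq c0 c (r • z, ξ) = tq c0 c (z, ξ) := by
  simp only [tq, om_smul hr]

lemma TT_van {δ : ℝ} (hδ : 0 < δ) (h0 : SM c0)
    (hc : ∀ j, SM (c j)) {b : PS → ℝ} (hb : Van δ b) : Van δ (TT c0 c b) :=
  van_mul hδ hb (tq_cda h0 hc)

lemma Ker.TT (h0 : SM c0) (hc : ∀ j, SM (c j)) {n : ℕ}
    {b : PS → ℝ} (hb : Ker n b) : Ker n (TT c0 c b) := by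
  refine ⟨TT_van one_pos h0 hc hb.van, fun z ξ r hz hr => ?_⟩
  unfold _root_.TT
  rw [tq_smul (by linarith), ← hb.hom z ξ r hz hr]; ring

lemma Ker.NN (h0 : SM c0) (hc : ∀ j, SM (c j)) {n : ℕ}
    {b : PS → ℝ} (hb : Ker n b) : Ker (n + 1) (NN c0 c b) :=
  (Ker.sum fun j => (hb.pz _).xmul (hc j)).sub
    (Ker.sum fun j => ((hb.TT h0 hc).pz _).xmul (vv_smooth j))

lemma scl_TT {n : ℕ} {δ : ℝ} (hδ : 0 < δ) (b : PS → ℝ) :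
    TT c0 c (scl n δ b) = scl n δ (TT c0 c b) := by
  ext q
  obtain ⟨z, ξ⟩ := q
  simp only [TT, scl]
  rw [tq_smul (inv_pos.2 hδ)]; ring

lemma scl_NN (h0 : SM c0) (hc : ∀ j, SM (c j)) {n : ℕ} {δ : ℝ}
    (hδ : 0 < δ) {b : PS → ℝ} (hb : Van 1 b) :
    NN c0 c (scl n δ b) = scl (n + 1) δ (NN c0 c b) := by
  ext q
  unfold NN
  simp only [scl_TT hδ, scl_pz hb.sm, scl_pz (TT_van one_pos h0 hc hb).sm]
  simp only [scl, Fin.sum_univ_three]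
  ring

end

def KE (b : PS → ℝ) (e : ℝ → ℝ) (t : ℝ) (p : ℝ × PS) : ℝ := b p.2 * e (t - p.1 - ‖p.2.1‖)

lemma KE_smooth {δ : ℝ} (hδ : 0 < δ) {b : PS → ℝ} (hb : Van δ b) {e : ℝ → ℝ}
    (he : SM e) (t : ℝ) : SM (KE b e t) := by
  refine contDiff_iff_contDiffAt.2 fun p => ?_
  by_cases hq : p.2.1 = 0
  · have : KE b e t =ᶠ[𝓝 p] fun _ => 0 := by
      have hq2 : ‖p.2.1‖ < δ := by simpa [hq] using hδ
      have : ∀ᶠ x : ℝ × PS in 𝓝 p, ‖x.2.1‖ < δ :=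
        ContinuousAt.eventually_lt (by fun_prop) continuousAt_const hq2
      filter_upwards [this] with x hx
      simp [KE, hb.zr x.2.1 x.2.2 hx]
    exact contDiffAt_const.congr_of_eventuallyEq this
  · unfold KE
    refine ((hb.sm.comp contDiff_snd).contDiffAt).mul ?_
    refine he.contDiffAt.comp p ?_
    refine (contDiff_const.sub contDiff_fst).contDiffAt.sub ?_
    exact (contDiffAt_norm ℝ hq).comp p (contDiff_fst.comp contDiff_snd).contDiffAt

lemma KE_pdd {δ : ℝ} (hδ : 0 < δ) {b : PS → ℝ} (hb : Van δ b) {e : ℝ → ℝ}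
    (he : SM e) (t a : ℝ) (w w' : E3) (p : ℝ × PS) :
    pdd (a, (w, w')) (KE b e t) p = KE (pdd (w, w') b) e t p
      - (a + ∑ j, w j * om j p.2.1) * KE b (deriv e) t p := by
  by_cases hq : p.2.1 = 0
  · have hq2 : ‖p.2.1‖ < δ := by simpa [hq] using hδ
    have : KE b e t =ᶠ[𝓝 p] fun _ => 0 := by
      have : ∀ᶠ x : ℝ × PS in 𝓝 p, ‖x.2.1‖ < δ :=
        ContinuousAt.eventually_lt (by fun_prop) continuousAt_const hq2
      filter_upwards [this] with x hx
      simp [KE, hb.zr x.2.1 x.2.2 hx]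
    rw [pdd_congr this]
    have h1 := hb.zr p.2.1 p.2.2 hq2
    have h2 := (hb.pdd (w, w')).zr p.2.1 p.2.2 hq2
    simp only [Prod.mk.eta] at h1 h2
    simp [KE, h1, h2]
    simp [pdd]
  · have hn : HasFDerivAt (fun p : ℝ × PS => ‖p.2.1‖)
        ((‖p.2.1‖⁻¹ • innerSL ℝ p.2.1).comp ((ContinuousLinearMap.fst ℝ E3 E3).comp
          (ContinuousLinearMap.snd ℝ ℝ PS))) p := by
      have h0 : HasFDerivAt (fun p : ℝ × PS => p.2.1) ((ContinuousLinearMap.fst ℝ E3 E3).comp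
          (ContinuousLinearMap.snd ℝ ℝ PS)) p :=
        ((ContinuousLinearMap.fst ℝ E3 E3).comp (ContinuousLinearMap.snd ℝ ℝ PS)).hasFDerivAt
      have h1 : HasFDerivAt (fun z : E3 => ‖z‖) (‖p.2.1‖⁻¹ • innerSL ℝ p.2.1) p.2.1 := by
        have h2 : HasFDerivAt (fun z : E3 => ‖z‖ ^ 2) (2 • (innerSL ℝ p.2.1)) p.2.1 :=
          (hasStrictFDerivAt_norm_sq p.2.1).hasFDerivAt
        have hne : ‖p.2.1‖ ^ 2 ≠ 0 := by simpa using hq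
        have h3 := h2.sqrt hne
        simp only [Real.sqrt_sq (norm_nonneg _)] at h3
        have e : ‖p.2.1‖⁻¹ • innerSL ℝ p.2.1 = (1 / (2 * ‖p.2.1‖)) • 2 • innerSL ℝ p.2.1 := by
          rw [← Nat.cast_smul_eq_nsmul ℝ, smul_smul]
          congr 1
          push_cast
          have := norm_ne_zero_iff.2 hq
          field_simp
        rw [e]
        exact h3
      exact h1.comp p h0
    have h3 : HasFDerivAt (fun p : ℝ × PS => t - p.1 - ‖p.2.1‖) _ p :=
      ((hasFDerivAt_const t p).sub hasFDerivAt_fst).sub hn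
    have h4 := ((sm_diff he (t - p.1 - ‖p.2.1‖)).hasDerivAt).comp_hasFDerivAt p h3
    have h5 : HasFDerivAt (fun p : ℝ × PS => b p.2) _ p :=
      (sm_diff hb.sm p.2).hasFDerivAt.comp p hasFDerivAt_snd
    have h6 := (h5.mul h4).fderiv
    unfold KE
    unfold pdd
    change fderiv ℝ ((fun p : ℝ × PS => b p.2) * (e ∘ fun p : ℝ × PS => t - p.1 - ‖p.2.1‖)) p _ = _
    rw [h6]
    have : ∑ j, w j * om j p.2.1 = ‖p.2.1‖⁻¹ * ⟪p.2.1, w⟫ := by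
      rw [inner_sum3, Finset.mul_sum]
      exact Finset.sum_congr rfl fun j _ => by simp [om]; ring
    rw [this]
    simp
    ring

lemma sum_e3 (j : Fin 3) (g : Fin 3 → ℝ) : ∑ i, e3 j i * g i = g j := by
  simp [e3]

lemma KE_s {δ : ℝ} (hδ : 0 < δ) {b : PS → ℝ} (hb : Van δ b) {e : ℝ → ℝ}
    (he : SM e) (t : ℝ) (p : ℝ × PS) :
    pdd (1, 0) (KE b e t) p = - KE b (deriv e) t p := by
  rw [show ((1 : ℝ), (0 : PS)) = (1, ((0 : E3), (0 : E3))) from rfl, KE_pdd hδ hb he]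
  have : pdd ((0 : E3), (0 : E3)) b = fun _ => 0 := by ext q; exact map_zero (fderiv ℝ b q)
  rw [this]; simp [KE]

lemma KE_z {δ : ℝ} (hδ : 0 < δ) {b : PS → ℝ} (hb : Van δ b) {e : ℝ → ℝ}
    (he : SM e) (t : ℝ) (j : Fin 3) (p : ℝ × PS) :
    pdd (0, (e3 j, 0)) (KE b e t) p = KE (pdd (e3 j, 0) b) e t p
      - om j p.2.1 * KE b (deriv e) t p := by
  rw [KE_pdd hδ hb he, sum_e3, zero_add]

lemma KE_x {δ : ℝ} (hδ : 0 < δ) {b : PS → ℝ} (hb : Van δ b) {e : ℝ → ℝ}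
    (he : SM e) (t : ℝ) (w : E3) :
    pdd (0, (0, w)) (KE b e t) = KE (pdd (0, w) b) e t := by
  ext p
  rw [KE_pdd hδ hb he]; simp

lemma DIV {c0 : E3 → ℝ} {c : Fin 3 → E3 → ℝ} (h0 : SM c0)
    (hc : ∀ j, SM (c j)) {δ : ℝ} (hδ : 0 < δ) {b : PS → ℝ} (hb : Van δ b)
    {e : ℝ → ℝ} (he : SM e) (t : ℝ) (p : ℝ × PS) :
    DP c0 c (KE b e t) p = DP (fun _ => 1) vv (KE (TT c0 c b) e t) p + KE (NN c0 c b) e t p := by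
  have hT := TT_van hδ h0 hc hb
  unfold DP
  simp only [KE_s hδ hb he, KE_s hδ hT he, KE_z hδ hb he, KE_z hδ hT he]
  have key : TT c0 c b p.2 * (1 + ∑ j, vv j p.2.2 * om j p.2.1) =
      b p.2 * (c0 p.2.2 + ∑ j, c j p.2.2 * om j p.2.1) := by
    unfold TT tq
    rw [mul_assoc, div_mul_cancel₀ _ (den_pos p.2.2 p.2.1).ne']
  simp only [KE, NN, Fin.sum_univ_three] at key ⊢
  linear_combination (deriv e (t - p.1 - ‖p.2.1‖)) * key

lemma Ker.bound {n : ℕ} {b : PS → ℝ} (h : Ker n b) (R : ℝ) : ∃ C : ℝ, 0 ≤ C ∧ ∀ δ > 0, ∀ z ξ : E3,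
    ‖ξ‖ ≤ R → |scl n δ b (z, ξ)| ≤ C * (‖z‖ ^ n)⁻¹ := by
  obtain ⟨C, hC⟩ := ((isCompact_closedBall (0 : E3) 3).prod
    (isCompact_closedBall (0 : E3) R)).exists_bound_of_continuousOn h.van.sm.continuous.continuousOn
  have main : ∀ y ξ : E3, ‖ξ‖ ≤ R → |b (y, ξ)| * ‖y‖ ^ n ≤ |C| * 3 ^ n := by
    intro y ξ hξ
    rcases le_or_gt ‖y‖ 3 with hy | hy
    · have := hC (y, ξ) ⟨by simpa using hy, by simpa using hξ⟩
      exact mul_le_mul (this.trans (le_abs_self _)) (by gcongr) (by positivity) (abs_nonneg _)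
    · have hy0 : 0 < ‖y‖ := by linarith
      have hn : ‖(3 / ‖y‖) • y‖ = 3 := by
        rw [norm_smul, Real.norm_of_nonneg (by positivity)]; field_simp
      have h1 := h.hom ((3 / ‖y‖) • y) ξ (‖y‖ / 3) (by rw [hn]; norm_num) (by linarith)
      rw [smul_smul, show ‖y‖ / 3 * (3 / ‖y‖) = 1 by field_simp, one_smul] at h1
      have h2 := hC ((3 / ‖y‖) • y, ξ) ⟨by simp only [mem_closedBall_zero_iff, hn]; exact le_rfl, by simpa using hξ⟩
      rw [← h1, norm_mul, norm_pow, Real.norm_of_nonneg (by positivity), div_pow,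
        div_mul_eq_mul_div, div_le_iff₀ (by positivity)] at h2
      calc |b (y, ξ)| * ‖y‖ ^ n = ‖y‖ ^ n * ‖b (y, ξ)‖ := by rw [mul_comm]; rfl
        _ ≤ C * 3 ^ n := h2
        _ ≤ _ := by gcongr; exact le_abs_self _
  refine ⟨|C| * 3 ^ n, by positivity, fun δ hδ z ξ hξ => ?_⟩
  rcases eq_or_ne z 0 with rfl | hz
  · rw [(scl_van hδ h.van).zr 0 ξ (by simpa using hδ)]
    simp only [abs_zero]; positivity
  · have hz' := norm_pos_iff.2 hz
    have := main (δ⁻¹ • z) ξ hξ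
    rw [norm_smul, norm_inv, Real.norm_of_nonneg hδ.le, mul_pow, inv_pow] at this
    rw [← div_eq_mul_inv, le_div_iff₀ (by positivity)]
    unfold scl
    rw [abs_mul, abs_of_pos (by positivity)]
    calc _ = |b (δ⁻¹ • z, ξ)| * ((δ ^ n)⁻¹ * ‖z‖ ^ n) := by ring
      _ ≤ _ := this

lemma Ker.scl_eq {n : ℕ} {b : PS → ℝ} (h : Ker n b) {δ ρ : ℝ} (hδ : 0 < δ) (hρ : δ ≤ ρ) {z : E3}
    (hz : 2 * ρ < ‖z‖) (ξ : E3) : scl n δ b (z, ξ) = scl n ρ b (z, ξ) := by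
  have hρ0 : 0 < ρ := by linarith
  have h1 := h.hom (ρ⁻¹ • z) ξ (ρ / δ) (by
    rw [norm_smul, norm_inv, Real.norm_of_nonneg hρ0.le, lt_inv_mul_iff₀ hρ0]; linarith)
    (by rwa [one_le_div hδ])
  rw [smul_smul, show ρ / δ * ρ⁻¹ = δ⁻¹ by field_simp] at h1
  unfold scl
  rw [← h1, div_pow]
  field_simp

def phi (r : ℝ) : ℝ := Real.smoothTransition (r - 1)

lemma phi_smooth : SM phi :=
  Real.smoothTransition.contDiff.comp (contDiff_id.sub contDiff_const)

lemma phi_zero {r : ℝ} (h : r ≤ 1) : phi r = 0 :=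
  Real.smoothTransition.zero_of_nonpos (by linarith)

lemma phi_one {r : ℝ} (h : 2 ≤ r) : phi r = 1 :=
  Real.smoothTransition.one_of_one_le (by linarith)

def bmp : ContDiffBump (1 / 2 : ℝ) := ⟨1 / 8, 1 / 4, by norm_num, by norm_num⟩
def eta : ℝ → ℝ := bmp.normed volume

lemma eta_smooth : SM eta := bmp.contDiff_normed
lemma eta_nonneg (x : ℝ) : 0 ≤ eta x := bmp.nonneg_normed x
lemma eta_int : ∫ x, eta x = 1 := bmp.integral_normed
lemma eta_zero {x : ℝ} (h : x ≤ 1 / 4 ∨ 3 / 4 ≤ x) : eta x = 0 := by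
  have : x ∉ Function.support eta := by
    unfold eta
    rw [bmp.support_normed_eq, mem_ball, Real.dist_eq, not_lt]
    change 1 / 4 ≤ _
    rw [le_abs]
    rcases h with h | h
    · right; linarith
    · left; linarith
  simpa using this

def etad (δ x : ℝ) : ℝ := δ⁻¹ * eta (δ⁻¹ * x)

section
variable {δ : ℝ}

lemma etad_smooth : SM (etad δ) :=
  contDiff_const.mul (eta_smooth.comp (contDiff_const.mul contDiff_id))

lemma etad_nonneg (hδ : 0 < δ) (x : ℝ) : 0 ≤ etad δ x :=
  mul_nonneg (inv_pos.2 hδ).le (eta_nonneg _)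

lemma etad_zero (hδ : 0 < δ) {x : ℝ} (h : x ≤ δ / 4 ∨ 3 * δ / 4 ≤ x) : etad δ x = 0 := by
  unfold etad
  rw [eta_zero, mul_zero]
  rcases h with h | h
  · left; rw [inv_mul_le_iff₀ hδ]; linarith
  · right; rw [le_inv_mul_iff₀ hδ]; linarith

lemma etad_int (hδ : 0 < δ) : ∫ x, etad δ x = 1 := by
  unfold etad
  rw [integral_const_mul, Measure.integral_comp_mul_left, eta_int, inv_inv, abs_of_pos hδ]
  simp [hδ.ne']

lemma etad_cs (hδ : 0 < δ) : HasCompactSupport (etad δ) :=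
  HasCompactSupport.intro (isCompact_Icc (a := 0) (b := δ)) (fun x hx => etad_zero hδ (by
    rw [mem_Icc, not_and_or, not_le, not_le] at hx
    rcases hx with h | h
    · left; linarith
    · right; linarith))

lemma etad_intg (hδ : 0 < δ) : Integrable (etad δ) :=
  etad_smooth.continuous.integrable_of_hasCompactSupport (etad_cs hδ)

lemma eta_bdd : ∃ C : ℝ, 0 ≤ C ∧ ∀ x, |eta x| ≤ C ∧ |deriv eta x| ≤ C := by
  have hc : HasCompactSupport eta :=
    HasCompactSupport.intro (isCompact_Icc (a := 0) (b := 1)) (fun x hx => eta_zero (by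
      rw [mem_Icc, not_and_or, not_le, not_le] at hx
      rcases hx with h | h
      · left; linarith
      · right; linarith))
  obtain ⟨C, hC⟩ := hc.exists_bound_of_continuous eta_smooth.continuous
  obtain ⟨C', hC'⟩ := hc.deriv.exists_bound_of_continuous
    ((sm1 eta_smooth).continuous_deriv_one)
  exact ⟨max C C', ((norm_nonneg _).trans (hC 0)).trans (le_max_left _ _), fun x =>
    ⟨(hC x).trans (le_max_left _ _), (hC' x).trans (le_max_right _ _)⟩⟩

lemma etad_deriv (x : ℝ) : deriv (etad δ) x = δ⁻¹ * (δ⁻¹ * deriv eta (δ⁻¹ * x)) := by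
  have h1 := (sm_diff eta_smooth (δ⁻¹ * x)).hasDerivAt
  have h2 : HasDerivAt (fun x => δ⁻¹ * x) δ⁻¹ x := by
    simpa using (hasDerivAt_id x).const_mul δ⁻¹
  have h3 := (h1.comp x h2).const_mul δ⁻¹
  have := h3.deriv
  simp only [Function.comp_def] at this
  unfold etad
  rw [this]; ring

lemma phi_bdd : ∃ C : ℝ, 0 ≤ C ∧ ∀ x ≤ 2, 1 ≤ x → |deriv phi x| ≤ C ∧ |deriv (deriv phi) x| ≤ C := by
  have h1 : SM (deriv phi) := by
    have := (contDiff_infty_iff_deriv.1 phi_smooth).2; exact this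
  have h2 : SM (deriv (deriv phi)) := (contDiff_infty_iff_deriv.1 h1).2
  obtain ⟨C, hC⟩ := (isCompact_Icc (a := (1 : ℝ)) (b := 2)).exists_bound_of_continuousOn
    h1.continuous.continuousOn
  obtain ⟨C', hC'⟩ := (isCompact_Icc (a := (1 : ℝ)) (b := 2)).exists_bound_of_continuousOn
    h2.continuous.continuousOn
  exact ⟨max C C', ((norm_nonneg _).trans (hC 1 (by simp))).trans (le_max_left _ _), fun x hx hx' =>
    ⟨(hC x ⟨hx', hx⟩).trans (le_max_left _ _), (hC' x ⟨hx', hx⟩).trans (le_max_right _ _)⟩⟩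

end

def kap (q : PS) : ℝ := phi ‖q.1‖ / ‖q.1‖

lemma kap_ker : Ker 1 kap := by
  have hz : ∀ z ξ : E3, ‖z‖ < 1 → kap (z, ξ) = 0 := fun z ξ h => by
    simp [kap, phi_zero h.le]
  refine ⟨⟨contDiff_iff_contDiffAt.2 fun q => ?_, hz⟩, fun z ξ r h hr => ?_⟩
  · by_cases hq : q.1 = 0
    · have : kap =ᶠ[𝓝 q] fun _ => 0 := by
        have hq2 : ‖q.1‖ < 1 := by simp [hq]
        filter_upwards [nhds_z (ξ := q.2) (isOpen_lt continuous_norm continuous_const) hq2] with x hx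
        exact hz x.1 x.2 hx
      exact contDiffAt_const.congr_of_eventuallyEq this
    · have hn : ContDiffAt ℝ (⊤ : ℕ∞) (fun q : PS => ‖q.1‖) q :=
        (contDiffAt_norm ℝ hq).comp q contDiffAt_fst
      exact (phi_smooth.contDiffAt.comp q hn).div hn (norm_ne_zero_iff.2 hq)
  · have hr0 : 0 < r := by linarith
    have h0 : 0 < ‖z‖ := by linarith
    simp only [kap, norm_smul, Real.norm_of_nonneg hr0.le]
    rw [phi_one h.le, phi_one (by nlinarith)]
    field_simp

lemma scl_kap {δ : ℝ} (hδ : 0 < δ) (z ξ : E3) : scl 1 δ kap (z, ξ) = phi (δ⁻¹ * ‖z‖) / ‖z‖ := by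
  simp only [scl, kap, norm_smul, norm_inv, Real.norm_of_nonneg hδ.le, pow_one]
  rcases eq_or_ne z 0 with rfl | h
  · simp
  · have := norm_ne_zero_iff.2 h
    field_simp

def KR (n : ℕ) (b : PS → ℝ) (ρ δ t : ℝ) : ℝ × PS → ℝ := KE (scl n ρ b) (etad δ) t

lemma KR_van {n : ℕ} {b : PS → ℝ} (hb : Ker n b) {ρ : ℝ} (hρ : 0 < ρ) :  Van ρ (scl n ρ b) :=
  scl_van hρ hb.van

lemma KR_smooth {n : ℕ} {b : PS → ℝ} (hb : Ker n b) {ρ δ : ℝ} (hρ : 0 < ρ) (t : ℝ) :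
    SM (KR n b ρ δ t) :=
  KE_smooth hρ (KR_van hb hρ) etad_smooth t

lemma KR_zero {n : ℕ} {b : PS → ℝ} {ρ δ t : ℝ} (hδ : 0 < δ) {s : ℝ} {z ξ : E3}
    (h : t - s - ‖z‖ ≤ δ / 4) : KR n b ρ δ t (s, (z, ξ)) = 0 := by
  simp [KR, KE, etad_zero hδ (Or.inl h)]

lemma KR_CZ {n : ℕ} {b : PS → ℝ} {ρ δ t τ : ℝ} (hδ : 0 < δ) : CZ τ (KR n b ρ δ t) :=
  ⟨t, fun s hs z ξ hz => KR_zero hδ (by linarith [hs.1])⟩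

lemma KR_t {n : ℕ} {b : PS → ℝ} {ρ δ t : ℝ} (hδ : 0 < δ) (q : PS) : KR n b ρ δ t (t, q) = 0 :=
  KR_zero hδ (by linarith [norm_nonneg q.1])

lemma KR_x {n : ℕ} {b : PS → ℝ} (hb : Ker n b) {ρ δ : ℝ} (hρ : 0 < ρ) (t : ℝ) (w : E3) :
    pdd (0, (0, w)) (KR n b ρ δ t) = KR n (pdd (0, w) b) ρ δ t := by
  unfold KR
  rw [KE_x hρ (KR_van hb hρ) etad_smooth, scl_px hb.van.sm]

lemma KR_DIV {c0 : E3 → ℝ} {c : Fin 3 → E3 → ℝ} (h0 : SM c0)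
    (hc : ∀ j, SM (c j)) {n : ℕ} {b : PS → ℝ} (hb : Ker n b) {ρ δ : ℝ}
    (hρ : 0 < ρ) (t : ℝ) (p : ℝ × PS) : DP c0 c (KR n b ρ δ t) p =
      DP (fun _ => 1) vv (KR n (TT c0 c b) ρ δ t) p + KR (n + 1) (NN c0 c b) ρ δ t p := by
  unfold KR
  rw [DIV h0 hc hρ (KR_van hb hρ) etad_smooth, scl_TT hρ, scl_NN h0 hc hρ hb.van]

def cj (j i : Fin 3) (_ : E3) : ℝ := if i = j then 1 else 0

lemma cj_smooth (j i : Fin 3) : SM (cj j i) := contDiff_const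
lemma c00_smooth : SM (fun _ : E3 => (0 : ℝ)) := contDiff_const

lemma DP_cj (j : Fin 3) (K : ℝ × PS → ℝ) (p : ℝ × PS) :
    DP (fun _ => 0) (cj j) K p = pdd (0, (e3 j, 0)) K p := by
  simp [DP, cj]

lemma KR_j (j : Fin 3) {n : ℕ} {b : PS → ℝ} (hb : Ker n b) {ρ δ : ℝ}
    (hρ : 0 < ρ) (t : ℝ) (p : ℝ × PS) : pdd (0, (e3 j, 0)) (KR n b ρ δ t) p =
      DP (fun _ => 1) vv (KR n (TT (fun _ => 0) (cj j) b) ρ δ t) p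
      + KR (n + 1) (NN (fun _ => 0) (cj j) b) ρ δ t p := by
  rw [← KR_DIV c00_smooth (cj_smooth j) hb hρ, DP_cj]

lemma Tr_DP {τ : ℝ} {K : ℝ × PS → ℝ} (hK : SM K) {p : ℝ × PS} (hp : p ∈ Sl PS τ) :
    Tr τ K p = DP (fun _ => 1) vv K p := by
  simp [Tr, DP, dd_eq_pdd hK hp]

def kd (δ t : ℝ) (p : ℝ × E3) : ℝ := KR 1 kap δ δ t (p.1, (p.2, 0))

lemma kd_pz (δ t : ℝ) : (fun p => kd δ t (pz p)) = KR 1 kap δ δ t := by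
  ext p
  simp only [kd, KR, KE, pz, scl, kap]

lemma kd_pdd {K : ℝ × PS → ℝ} (hK : SM K) (a : ℝ) (w : E3) (p : ℝ × E3) :
    pdd (a, w) (fun p : ℝ × E3 => K (p.1, (p.2, 0))) p = pdd (a, (w, 0)) K (p.1, (p.2, 0)) := by
  have h2 : HasFDerivAt (fun p : ℝ × E3 => ((p.1, (p.2, 0)) : ℝ × PS))
      ((ContinuousLinearMap.fst ℝ ℝ E3).prod ((ContinuousLinearMap.snd ℝ ℝ E3).prod 0)) p :=
    ((ContinuousLinearMap.fst ℝ ℝ E3).prod ((ContinuousLinearMap.snd ℝ ℝ E3).prod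
      (0 : ℝ × E3 →L[ℝ] E3))).hasFDerivAt
  have h3 := (sm_diff hK (p.1, (p.2, 0))).hasFDerivAt.comp p h2
  have h4 := h3.fderiv
  simp only [Function.comp_def] at h4
  unfold pdd
  rw [h4]; rfl

lemma kd_smooth {δ : ℝ} (hδ : 0 < δ) (t : ℝ) : SM (kd δ t) :=
  (KR_smooth kap_ker hδ t).comp (by fun_prop)

lemma kd_CS {δ : ℝ} (hδ : 0 < δ) (t τ : ℝ) : CS τ (kd δ t) :=
  ⟨closedBall 0 t, isCompact_closedBall _ _, fun s hs z hz => KR_zero hδ (by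
    rw [mem_closedBall_zero_iff, not_le] at hz
    linarith [hs.1])⟩

lemma kd_ZT {δ : ℝ} (hδ : 0 < δ) (t : ℝ) : ZT t (kd δ t) :=
  ⟨δ / 4, by linarith, fun s hs z => KR_zero hδ (by linarith [norm_nonneg z])⟩

lemma norm_hasF {z : E3} (hz : z ≠ 0) :
    HasFDerivAt (fun z : E3 => ‖z‖) (‖z‖⁻¹ • innerSL ℝ z) z := by
  have h2 : HasFDerivAt (fun z : E3 => ‖z‖ ^ 2) (2 • (innerSL ℝ z)) z :=
    (hasStrictFDerivAt_norm_sq z).hasFDerivAt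
  have hne : ‖z‖ ^ 2 ≠ 0 := by simpa using hz
  have h3 := h2.sqrt hne
  simp only [Real.sqrt_sq (norm_nonneg _)] at h3
  have e : ‖z‖⁻¹ • innerSL ℝ z = (1 / (2 * ‖z‖)) • 2 • innerSL ℝ z := by
    rw [← Nat.cast_smul_eq_nsmul ℝ, smul_smul]
    congr 1
    push_cast
    have := norm_ne_zero_iff.2 hz
    field_simp
  rw [e]
  exact h3

lemma rad_hasF {z : E3} (hz : z ≠ 0) {q : ℝ → ℝ} {q' : ℝ} (hq : HasDerivAt q q' ‖z‖) :
    HasFDerivAt (fun z : E3 => q ‖z‖) (q' • ‖z‖⁻¹ • innerSL ℝ z) z :=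
  hq.comp_hasFDerivAt z (norm_hasF hz)

lemma e3_inner (z : E3) (m : Fin 3) : ⟪z, e3 m⟫ = z m := by
  simp [e3, EuclideanSpace.inner_single_right]

lemma sum_sq3 (z : E3) : ∑ m, z m * z m = ‖z‖ ^ 2 := by
  rw [← real_inner_self_eq_norm_sq, PiLp.inner_apply]; simp [sq]

lemma Lap {g : ℝ → ℝ} (hg : SM g) {z : E3} (hz : z ≠ 0) :
    ∑ m : Fin 3, pdd (e3 m) (pdd (e3 m) (fun z : E3 => g ‖z‖ / ‖z‖)) z
      = deriv (deriv g) ‖z‖ / ‖z‖ := by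
  have hg1 : SM (deriv g) := (contDiff_infty_iff_deriv.1 hg).2
  have step1 : ∀ m : Fin 3, ∀ y : E3, y ≠ 0 → pdd (e3 m) (fun z : E3 => g ‖z‖ / ‖z‖) y =
      y m * ((deriv g ‖y‖ * ‖y‖ - g ‖y‖) / ‖y‖ ^ 3) := by
    intro m y hy
    have hn := norm_ne_zero_iff.2 hy
    have h1 := ((sm_diff hg ‖y‖).hasDerivAt).div (hasDerivAt_id ‖y‖) hn
    have h2 := (rad_hasF hy h1).fderiv
    unfold pdd
    change (fderiv ℝ (fun z : E3 => (g / (id : ℝ → ℝ)) ‖z‖) y) (e3 m) = _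
    rw [h2]
    simp only [ContinuousLinearMap.smul_apply, innerSL_apply_apply, e3_inner, smul_eq_mul, id]
    field_simp
  have hn := norm_ne_zero_iff.2 hz
  have step2 : ∀ m : Fin 3, pdd (e3 m) (pdd (e3 m) (fun z : E3 => g ‖z‖ / ‖z‖)) z =
      ((deriv g ‖z‖ * ‖z‖ - g ‖z‖) / ‖z‖ ^ 3) + (z m * z m) * (deriv (deriv g) ‖z‖ / ‖z‖ ^ 3
        - 3 * ((deriv g ‖z‖ * ‖z‖ - g ‖z‖) / ‖z‖ ^ 5)) := by
    intro m
    have ev : pdd (e3 m) (fun z : E3 => g ‖z‖ / ‖z‖) =ᶠ[𝓝 z] fun y =>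
        y m * ((deriv g ‖y‖ * ‖y‖ - g ‖y‖) / ‖y‖ ^ 3) := by
      filter_upwards [isOpen_ne.mem_nhds hz] with y hy
      exact step1 m y hy
    rw [pdd_congr ev]
    have d1 := (((sm_diff hg1 ‖z‖).hasDerivAt.mul (hasDerivAt_id ‖z‖)).sub
      (sm_diff hg ‖z‖).hasDerivAt).div ((hasDerivAt_id ‖z‖).pow 3) (by simpa using hn)
    have h2 := rad_hasF hz d1
    have h4 : HasFDerivAt (fun x : E3 => x m) (EuclideanSpace.proj (𝕜 := ℝ) m) z :=
      (EuclideanSpace.proj (𝕜 := ℝ) m).hasFDerivAt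
    have h5 := (h4.mul h2).fderiv
    unfold pdd
    change (fderiv ℝ ((fun x : E3 => x m) * (fun z : E3 =>
      ((deriv g * (id : ℝ → ℝ) - g) / (id : ℝ → ℝ) ^ 3) ‖z‖)) z) (e3 m) = _
    rw [h5]
    have he : (e3 m).ofLp m = 1 := by simp [e3]
    simp [e3_inner, he]
    field_simp
    ring
  simp only [step2]
  rw [Finset.sum_add_distrib, ← Finset.sum_mul, sum_sq3]
  simp
  field_simp
  ring

lemma pdd_slice {g : ℝ × E3 → ℝ} (hg : SM g) (s : ℝ) (z w : E3) :
    pdd (0, w) g (s, z) = pdd w (fun z => g (s, z)) z := by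
  have h2 : HasFDerivAt (fun z : E3 => (s, z)) (ContinuousLinearMap.inr ℝ ℝ E3) z := by
    exact hasFDerivAt_prodMk_right s z
  have h3 := (sm_diff hg (s, z)).hasFDerivAt.comp z h2
  have h4 := h3.fderiv
  simp only [Function.comp_def] at h4
  unfold pdd
  rw [h4]; rfl

lemma kd_eq {δ : ℝ} (hδ : 0 < δ) (t s : ℝ) (z : E3) :
    kd δ t (s, z) = phi (δ⁻¹ * ‖z‖) * etad δ (t - s - ‖z‖) / ‖z‖ := by
  simp only [kd, KR, KE, scl_kap hδ]; ring

lemma deriv_smooth {g : ℝ → ℝ} (hg : SM g) : SM (deriv g) :=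
  (contDiff_infty_iff_deriv.1 hg).2

lemma kd_s {δ : ℝ} (hδ : 0 < δ) (t : ℝ) : pdd (1, 0) (kd δ t) = fun p =>
    - KE (scl 1 δ kap) (deriv (etad δ)) t (p.1, (p.2, 0)) := by
  ext p
  unfold kd
  rw [kd_pdd (KR_smooth kap_ker hδ t)]
  exact KE_s hδ (KR_van kap_ker hδ) etad_smooth t _

lemma kd_ss {δ : ℝ} (hδ : 0 < δ) (t : ℝ) (p : ℝ × E3) : pdd (1, 0) (pdd (1, 0) (kd δ t)) p =
    KE (scl 1 δ kap) (deriv (deriv (etad δ))) t (p.1, (p.2, 0)) := by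
  rw [kd_s hδ]
  have h1 := KE_smooth hδ (KR_van kap_ker hδ) (deriv_smooth (etad_smooth (δ := δ))) t
  have h2 : (fun p : ℝ × E3 => - KE (scl 1 δ kap) (deriv (etad δ)) t (p.1, (p.2, 0))) =
      fun p => (-1) * KE (scl 1 δ kap) (deriv (etad δ)) t (p.1, (p.2, 0)) := by ext; ring
  rw [h2, pdd_cmul (g := fun p : ℝ × E3 => KE (scl 1 δ kap) (deriv (etad δ)) t (p.1, (p.2, 0)))
    (h1.comp (by fun_prop)), kd_pdd h1]
  have := KE_s hδ (KR_van kap_ker hδ) (deriv_smooth (etad_smooth (δ := δ))) t (p.1, (p.2, 0))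
  rw [show ((1 : ℝ), ((0 : E3), (0 : E3))) = (1, (0 : PS)) from rfl, this]; ring

lemma box_kd {δ : ℝ} (hδ : 0 < δ) (t s : ℝ) {z : E3} (hz : z ≠ 0) : box (kd δ t) (s, z) =
    (2 * (δ⁻¹ * deriv phi (δ⁻¹ * ‖z‖)) * deriv (etad δ) (t - s - ‖z‖)
      - δ⁻¹ * (δ⁻¹ * deriv (deriv phi) (δ⁻¹ * ‖z‖)) * etad δ (t - s - ‖z‖)) / ‖z‖ := by
  have hk := kd_smooth hδ t
  unfold box
  rw [kd_ss hδ]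
  have h1 : ∀ m, pdd (0, e3 m) (pdd (0, e3 m) (kd δ t)) (s, z) =
      pdd (e3 m) (pdd (e3 m) (fun z : E3 => (fun r => phi (δ⁻¹ * r) * etad δ (t - s - r)) ‖z‖ / ‖z‖)) z := by
    intro m
    rw [pdd_slice (pdd_smooth hk _)]
    congr 1
    ext y
    rw [pdd_slice hk]
    congr 1
    ext y
    exact kd_eq hδ t s y
  simp only [h1]
  have hA : ∀ {g : ℝ → ℝ}, SM g → ∀ r, HasDerivAt (fun r => g (δ⁻¹ * r))
      (δ⁻¹ * deriv g (δ⁻¹ * r)) r := fun {g} hg r => by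
    have h2 : HasDerivAt (fun x => δ⁻¹ * x) δ⁻¹ r := by
      simpa using (hasDerivAt_id r).const_mul δ⁻¹
    have := (sm_diff hg (δ⁻¹ * r)).hasDerivAt.comp r h2
    rw [mul_comm]; exact this
  have hB : ∀ {g : ℝ → ℝ}, SM g → ∀ r, HasDerivAt (fun r => g (t - s - r))
      (- deriv g (t - s - r)) r := fun {g} hg r => by
    have h2 : HasDerivAt (fun x => t - s - x) (-1) r := by
      simpa using (hasDerivAt_id r).const_sub (t - s)
    have := (sm_diff hg (t - s - r)).hasDerivAt.comp r h2
    rw [mul_neg_one] at this; exact this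
  have hs : SM (fun r => phi (δ⁻¹ * r) * etad δ (t - s - r)) :=
    (phi_smooth.comp (contDiff_const.mul contDiff_id)).mul
      (etad_smooth.comp (contDiff_const.sub contDiff_id))
  rw [Lap hs hz]
  have d1 : deriv (fun r => phi (δ⁻¹ * r) * etad δ (t - s - r)) = fun r =>
      δ⁻¹ * deriv phi (δ⁻¹ * r) * etad δ (t - s - r) + phi (δ⁻¹ * r) * (- deriv (etad δ) (t - s - r)) := by
    ext r
    exact ((hA phi_smooth r).mul (hB etad_smooth r)).deriv
  rw [d1]
  have d2 := ((((hA (deriv_smooth phi_smooth) ‖z‖).const_mul δ⁻¹).mul (hB (etad_smooth (δ := δ)) ‖z‖)).add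
    ((hA phi_smooth ‖z‖).mul (hB (deriv_smooth (etad_smooth (δ := δ))) ‖z‖).neg)).deriv
  rw [show (fun r => δ⁻¹ * deriv phi (δ⁻¹ * r) * etad δ (t - s - r) +
    phi (δ⁻¹ * r) * (- deriv (etad δ) (t - s - r))) = _ from rfl]
  refine Eq.trans (congrArg _ (congrArg (· / ‖z‖) d2)) ?_
  simp only [KE, scl_kap hδ, Pi.neg_apply]
  ring

lemma pdd_ev {W : Type*} [NormedAddCommGroup W] [NormedSpace ℝ W] {g h : W → ℝ} {p : W}
    (h' : g =ᶠ[𝓝 p] h) (w : W) : pdd w g =ᶠ[𝓝 p] pdd w h := by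
  filter_upwards [h'.eventuallyEq_nhds] with q hq
  exact pdd_congr hq

lemma phi_d0 {x : ℝ} (h : x < 1 ∨ 2 < x) : deriv phi x = 0 ∧ deriv (deriv phi) x = 0 := by
  have : ∃ c : ℝ, phi =ᶠ[𝓝 x] fun _ => c := by
    rcases h with h | h
    · exact ⟨0, by filter_upwards [Iio_mem_nhds h] with y hy using phi_zero (le_of_lt hy)⟩
    · exact ⟨1, by filter_upwards [Ioi_mem_nhds h] with y hy using phi_one (le_of_lt hy)⟩
  obtain ⟨c, hc⟩ := this
  refine ⟨by rw [hc.deriv_eq]; simp, ?_⟩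
  rw [hc.deriv.deriv_eq]; simp

lemma etad_d0 {δ : ℝ} (hδ : 0 < δ) {x : ℝ} (h : δ < x) : deriv (etad δ) x = 0 := by
  have : etad δ =ᶠ[𝓝 x] fun _ => 0 := by
    filter_upwards [Ioi_mem_nhds h] with y hy
    exact etad_zero hδ (Or.inr (by linarith [mem_Ioi.1 hy]))
  rw [this.deriv_eq]; simp

lemma box_supp {δ : ℝ} (hδ : 0 < δ) (t s : ℝ) (z : E3) (h : box (kd δ t) (s, z) ≠ 0) :
    δ ≤ ‖z‖ ∧ ‖z‖ ≤ 2 * δ ∧ t - 3 * δ ≤ s := by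
  rcases eq_or_ne z 0 with rfl | hz
  · exfalso
    apply h
    have : kd δ t =ᶠ[𝓝 (s, (0 : E3))] fun _ => 0 := by
      have : ∀ᶠ x : ℝ × E3 in 𝓝 (s, (0 : E3)), ‖x.2‖ < δ :=
        ContinuousAt.eventually_lt (by fun_prop) continuousAt_const (by simpa using hδ)
      filter_upwards [this] with x hx
      simp [kd, KR, KE, (KR_van kap_ker hδ).zr x.2 0 hx]
    have h2 : ∀ w, pdd w (pdd w (kd δ t)) (s, (0 : E3)) = 0 := fun w => by
      rw [((pdd_ev (pdd_ev this w) w).eq_of_nhds)]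
      have : pdd w (fun _ : ℝ × E3 => (0 : ℝ)) = fun _ => 0 := by ext; simp [pdd]
      rw [this]; simp [pdd]
    simp [box, h2]
  · rw [box_kd hδ t s hz] at h
    have a1 : δ ≤ ‖z‖ := by
      by_contra hc
      obtain ⟨e1, e2⟩ := phi_d0 (x := δ⁻¹ * ‖z‖) (Or.inl (by rw [inv_mul_lt_iff₀ hδ]; linarith))
      simp [e1, e2] at h
    have a2 : ‖z‖ ≤ 2 * δ := by
      by_contra hc
      obtain ⟨e1, e2⟩ := phi_d0 (x := δ⁻¹ * ‖z‖) (Or.inr (by rw [lt_inv_mul_iff₀ hδ]; linarith))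
      simp [e1, e2] at h
    refine ⟨a1, a2, ?_⟩
    by_contra hc
    rw [etad_d0 hδ (by linarith), etad_zero hδ (Or.inr (by linarith))] at h
    simp at h

lemma box_bound : ∃ C : ℝ, 0 ≤ C ∧ ∀ δ > 0, ∀ t s z, |box (kd δ t) (s, z)| ≤ C * (δ ^ 4)⁻¹ := by
  obtain ⟨C, hC0, hC⟩ := phi_bdd
  obtain ⟨C', hC0', hC'⟩ := eta_bdd
  refine ⟨3 * C * C', by positivity, fun δ hδ t s z => ?_⟩
  by_cases h : box (kd δ t) (s, z) = 0
  · rw [h, abs_zero]; positivity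
  · obtain ⟨h1, h2, h3⟩ := box_supp hδ t s z h
    have hz : z ≠ 0 := by rintro rfl; simp at h1; linarith
    rw [box_kd hδ t s hz, abs_div, abs_of_nonneg (norm_nonneg z)]
    obtain ⟨b1, b2⟩ := hC (δ⁻¹ * ‖z‖) (by rw [inv_mul_le_iff₀ hδ]; linarith)
      (by rw [le_inv_mul_iff₀ hδ]; linarith)
    have b3 : |etad δ (t - s - ‖z‖)| ≤ δ⁻¹ * C' := by
      unfold etad
      rw [abs_mul, abs_of_pos (inv_pos.2 hδ)]
      gcongr
      exact (hC' _).1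
    have b4 : |deriv (etad δ) (t - s - ‖z‖)| ≤ δ⁻¹ * (δ⁻¹ * C') := by
      rw [etad_deriv, abs_mul, abs_mul, abs_of_pos (inv_pos.2 hδ)]
      gcongr
      exact (hC' _).2
    have hi := (inv_pos.2 hδ).le
    calc _ ≤ (2 * (δ⁻¹ * C) * (δ⁻¹ * (δ⁻¹ * C')) + δ⁻¹ * (δ⁻¹ * C) * (δ⁻¹ * C')) / δ := by
          gcongr
          refine (abs_sub _ _).trans ?_
          simp only [abs_mul, abs_of_pos (inv_pos.2 hδ), abs_two]
          gcongr
      _ = _ := by field_simp; ring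

def V3 : ℝ := 3 * volume.real (ball (0 : E3) 1)

lemma V3_pos : 0 < V3 := by
  unfold V3
  have : 0 < volume.real (ball (0 : E3) 1) :=
    ENNReal.toReal_pos (measure_ball_pos _ _ one_pos).ne' measure_ball_lt_top.ne
  linarith

lemma RAD (g : ℝ → ℝ) : ∫ x : E3, g ‖x‖ = V3 * ∫ y in Ioi (0 : ℝ), y ^ 2 * g y := by
  rw [integral_fun_norm_addHaar volume g]
  simp [V3]; ring

lemma RADi {g : ℝ → ℝ} : Integrable (fun x : E3 => g ‖x‖) ↔
    IntegrableOn (fun y => y ^ 2 * g y) (Ioi 0) := by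
  rw [integrable_fun_norm_addHaar volume (f := g)]
  simp

lemma kd_s0 {δ t : ℝ} (hδ : 0 < δ) (ht : 3 * δ < t) :
    ∫ z : E3, pdd (1, 0) (kd δ t) (0, z) = - V3 := by
  rw [kd_s hδ]
  simp only [KE, scl_kap hδ]
  rw [RAD (fun r => -(phi (δ⁻¹ * r) / r * deriv (etad δ) (t - 0 - r)))]
  have e1 : ∀ y ∈ Ioi (0 : ℝ), y ^ 2 * -(phi (δ⁻¹ * y) / y * deriv (etad δ) (t - 0 - y)) =
      - (y * deriv (etad δ) (t - y)) := by
    intro y hy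
    have hy' : y ≠ 0 := (mem_Ioi.1 hy).ne'
    rw [sub_zero]
    by_cases h : 2 * δ ≤ y
    · rw [phi_one (by rw [le_inv_mul_iff₀ hδ]; linarith)]
      field_simp
    · rw [etad_d0 hδ (x := t - y) (by linarith)]; simp
  rw [setIntegral_congr_fun measurableSet_Ioi e1]
  have hcs : HasCompactSupport (fun y => y * etad δ (t - y)) := by
    refine HasCompactSupport.intro (isCompact_Icc (a := 0) (b := t)) (fun x hx => ?_)
    rw [mem_Icc, not_and_or, not_le, not_le] at hx
    rcases hx with h | h
    · rw [etad_zero hδ (Or.inr (by linarith)), mul_zero]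
    · rw [etad_zero hδ (Or.inl (by linarith)), mul_zero]
  have hsm : SM (fun y => y * etad δ (t - y)) :=
    contDiff_id.mul (etad_smooth.comp (contDiff_const.sub contDiff_id))
  have hd : ∀ y, HasDerivAt (fun y => y * etad δ (t - y)) (1 * etad δ (t - y) + y * (- deriv (etad δ) (t - y))) y := by
    intro y
    have h2 : HasDerivAt (fun x => t - x) (-1) y := by
      simpa using (hasDerivAt_id y).const_sub t
    have := (sm_diff (etad_smooth (δ := δ)) (t - y)).hasDerivAt.comp y h2
    rw [mul_neg_one] at this
    exact (hasDerivAt_id y).mul this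
  have h3 := T1s (sm1 hsm) hcs 1
  have h4 : ∀ y, fderiv ℝ (fun y => y * etad δ (t - y)) y 1 = etad δ (t - y) - y * deriv (etad δ) (t - y) := by
    intro y
    rw [fderiv_apply_one_eq_deriv, (hd y).deriv]; ring
  simp only [h4] at h3
  have i1 : Integrable (fun y => etad δ (t - y)) := (etad_intg hδ).comp_sub_left t
  have i3 : Integrable (fun y => etad δ (t - y) - y * deriv (etad δ) (t - y)) := by
    have := (hsm.continuous_deriv (by simp)).integrable_of_hasCompactSupport (μ := volume) hcs.deriv
    refine this.congr (Eventually.of_forall fun y => ?_)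
    simp only
    rw [(hd y).deriv]; ring
  have i2 : Integrable (fun y => y * deriv (etad δ) (t - y)) :=
    (i1.sub i3).congr (Eventually.of_forall fun y => by simp)
  rw [integral_sub i1 i2, integral_sub_left_eq_self (etad δ), etad_int hδ] at h3
  have h5 : ∫ y in Ioi (0 : ℝ), - (y * deriv (etad δ) (t - y)) = ∫ y, - (y * deriv (etad δ) (t - y)) := by
    refine setIntegral_eq_integral_of_forall_compl_eq_zero (fun y hy => ?_)
    have : y ≤ 0 := by simpa using hy
    rw [etad_d0 hδ (x := t - y) (by linarith)]; simp
  rw [h5, integral_neg]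
  linear_combination V3 * h3

lemma box_int {δ t τ : ℝ} (hδ : 0 < δ) (ht : 3 * δ < t) (htτ : t < τ) :
    ∫ p in Ioo 0 t ×ˢ univ, box (kd δ t) p = V3 := by
  have hk := kd_smooth hδ t
  have hc := kd_CS hδ t τ
  have i0 : HI (volume.restrict (Ioo 0 t ×ˢ univ)) (pdd (1, 0) (pdd (1, 0) (kd δ t))) V3 := by
    have h1 := pdd_smooth hk (1, 0)
    have := T0 (by linarith) htτ (sm1 h1).contDiffOn (hc.pdd hk (1, 0)) ((kd_ZT hδ t).pdd (1, 0)).at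
    rw [kd_s0 hδ ht, neg_neg] at this
    refine ⟨intOn htτ (pdd_smooth h1 _).continuous.continuousOn ((hc.pdd hk _).pdd h1 _), ?_⟩
    rw [← this]
    exact setIntegral_congr_fun (measurableSet_Ioo.prod MeasurableSet.univ) fun p hp =>
      (dd_eq_pdd h1 ⟨⟨hp.1.1.le, hp.1.2.trans htτ⟩, mem_univ _⟩ _).symm
  have i1 : ∀ m, HI (volume.restrict (Ioo 0 t ×ˢ univ))
      (pdd (0, e3 m) (pdd (0, e3 m) (kd δ t))) 0 := by
    intro m
    have h1 := pdd_smooth hk (0, e3 m)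
    have := T1 htτ (sm1 h1).contDiffOn (hc.pdd hk (0, e3 m)) (e3 m)
    refine ⟨intOn htτ (pdd_smooth h1 _).continuous.continuousOn ((hc.pdd hk _).pdd h1 _), ?_⟩
    refine Eq.trans ?_ this
    exact setIntegral_congr_fun (measurableSet_Ioo.prod MeasurableSet.univ) fun p hp =>
      (dd_eq_pdd h1 ⟨⟨hp.1.1.le, hp.1.2.trans htτ⟩, mem_univ _⟩ _).symm
  have := (i0.sub (((i1 0).add (i1 1)).add (i1 2))).2
  simp only [box, Fin.sum_univ_three]
  rw [this]; ring

lemma box_smooth {k : ℝ × E3 → ℝ} (hk : SM k) : SM (box k) := by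
  unfold box
  exact (pdd_smooth (pdd_smooth hk _) _).sub
    (ContDiff.sum fun m _ => pdd_smooth (pdd_smooth hk _) _)

lemma box_CS {k : ℝ × E3 → ℝ} (hk : SM k) {τ : ℝ} (h : CS τ k) : CS τ (box k) := by
  have h1 := (h.pdd hk (1, 0)).pdd (pdd_smooth hk _) (1, 0)
  have h2 := CS.sum fun m => ((h.pdd hk (0, e3 m)).pdd (pdd_smooth hk _) (0, e3 m)).mul_left (fun _ => -1)
  refine (h1.add h2).congr fun p _ => ?_
  simp only [box, Fin.sum_univ_three]; ring

lemma APX {τ t : ℝ} (ht0 : 0 < t) (htτ : t < τ) {w : ℝ × E3 → ℝ} (hw : ContinuousOn w (Sl E3 τ))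
    {X δ0 : ℝ} (hδ0 : 0 < δ0) (h : ∀ δ > 0, δ < δ0 → |∫ p in Ioo 0 t ×ˢ univ, box (kd δ t) p * w p| ≤ X) :
    V3 * |w (t, 0)| ≤ X := by
  obtain ⟨C, hC0, hC⟩ := box_bound
  set v := volume.real (ball (0 : E3) 1) with hv
  refine le_of_forall_pos_le_add fun ε he => ?_
  have hcw : 0 < C * (24 * v) + 1 := by positivity
  have hmem : (t, (0 : E3)) ∈ Sl E3 τ := ⟨⟨ht0.le, htτ⟩, mem_univ _⟩
  obtain ⟨r, hr, hrw⟩ := Metric.continuousWithinAt_iff.1 (hw _ hmem) (ε / (C * (24 * v) + 1)) (by positivity)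
  set δ := min (δ0 / 2) (min (r / 4) (t / 4)) with hδd
  have hδ : 0 < δ := by positivity
  have d1 : δ ≤ δ0 / 2 := min_le_left _ _
  have d2 : δ ≤ r / 4 := (min_le_right _ _).trans (min_le_left _ _)
  have d3 : δ ≤ t / 4 := (min_le_right _ _).trans (min_le_right _ _)
  have hk := kd_smooth hδ t
  have hb := box_smooth hk
  have hbc := box_CS hk (kd_CS hδ t τ)
  have i1 : IntegrableOn (fun p => box (kd δ t) p * w p) (Ioo 0 t ×ˢ univ) :=
    intOn htτ (hb.continuous.continuousOn.mul hw) (hbc.mul_right w)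
  have i2 : IntegrableOn (fun p => box (kd δ t) p * w (t, 0)) (Ioo 0 t ×ˢ univ) :=
    intOn htτ (hb.continuous.continuousOn.mul continuousOn_const) (hbc.mul_right _)
  have e1 : ∫ p in Ioo 0 t ×ˢ univ, box (kd δ t) p * w (t, 0) = V3 * w (t, 0) := by
    rw [integral_mul_const, box_int hδ (by linarith) htτ]
  set S : Set (ℝ × E3) := Icc (t - 3 * δ) t ×ˢ closedBall 0 (2 * δ) with hS
  have vS : volume S = ENNReal.ofReal (3 * δ) * (ENNReal.ofReal ((2 * δ) ^ 3) * volume (ball (0 : E3) 1)) := by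
    rw [hS, Measure.volume_eq_prod, Measure.prod_prod, Real.volume_Icc,
      Measure.addHaar_closedBall _ _ (by positivity)]
    simp
  have vS' : volume.real S = 24 * v * δ ^ 4 := by
    rw [Measure.real, vS, ENNReal.toReal_mul, ENNReal.toReal_mul, ENNReal.toReal_ofReal (by positivity),
      ENNReal.toReal_ofReal (by positivity), hv, Measure.real]
    ring
  have vSf : volume S < ⊤ := by
    rw [vS]
    exact ENNReal.mul_lt_top ENNReal.ofReal_lt_top (ENNReal.mul_lt_top ENNReal.ofReal_lt_top measure_ball_lt_top)
  have e2 : |∫ p in Ioo 0 t ×ˢ univ, box (kd δ t) p * (w p - w (t, 0))| ≤ ε := by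
    have hSo : ∀ p ∈ Ioo 0 t ×ˢ (univ : Set E3), p ∉ S → box (kd δ t) p * (w p - w (t, 0)) = 0 := by
      rintro ⟨s, z⟩ hp hpS
      by_contra hne
      have := box_supp hδ t s z (left_ne_zero_of_mul hne)
      exact hpS ⟨⟨this.2.2, hp.1.2.le⟩, by simpa using this.2.1⟩
    have e3' : ∫ p in Ioo 0 t ×ˢ univ, box (kd δ t) p * (w p - w (t, 0)) =
        ∫ p in (Ioo 0 t ×ˢ univ) ∩ S, box (kd δ t) p * (w p - w (t, 0)) := by
      refine (setIntegral_eq_of_subset_of_forall_diff_eq_zero (measurableSet_Ioo.prod MeasurableSet.univ)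
        inter_subset_left (fun p hp => hSo p hp.1 fun hpS => hp.2 ⟨hp.1, hpS⟩)).symm ▸ rfl
    rw [e3']
    have := norm_setIntegral_le_of_norm_le_const (μ := volume) (s := (Ioo 0 t ×ˢ univ) ∩ S)
      (f := fun p => box (kd δ t) p * (w p - w (t, 0))) (C := C * (δ ^ 4)⁻¹ * (ε / (C * (24 * v) + 1)))
      ((measure_mono inter_subset_right).trans_lt vSf) (by
        rintro ⟨s, z⟩ ⟨hp, hpS⟩
        rw [norm_mul]
        refine mul_le_mul (hC δ hδ t s z) ?_ (norm_nonneg _) (by positivity)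
        have hz : ‖z‖ ≤ 2 * δ := by simpa using hpS.2
        have := hrw (x := (s, z)) ⟨⟨hp.1.1.le, hp.1.2.trans htτ⟩, mem_univ _⟩ (by
          rw [Prod.dist_eq, max_lt_iff, dist_zero_right, Real.dist_eq, abs_lt]
          have := hpS.1.1
          have := hpS.1.2
          simp only at *
          refine ⟨⟨by linarith, by linarith⟩, by linarith⟩)
        exact this.le)
    refine this.trans ?_
    calc _ ≤ C * (δ ^ 4)⁻¹ * (ε / (C * (24 * v) + 1)) * volume.real S := by
          gcongr
          · exact vSf.ne
          · exact inter_subset_right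
      _ = C * (24 * v) * ε / (C * (24 * v) + 1) := by rw [vS']; field_simp
      _ ≤ ε := by
          rw [div_le_iff₀ hcw]
          nlinarith
  have e4 : ∫ p in Ioo 0 t ×ˢ univ, box (kd δ t) p * (w p - w (t, 0)) =
      (∫ p in Ioo 0 t ×ˢ univ, box (kd δ t) p * w p) - V3 * w (t, 0) := by
    rw [← e1, ← integral_sub i1 i2]
    simp only [mul_sub]
  rw [e4] at e2
  have e5 := h δ hδ (by linarith)
  rw [show V3 * |w (t, 0)| = |V3 * w (t, 0)| by rw [abs_mul, abs_of_pos V3_pos]]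
  have := abs_sub_abs_le_abs_sub (V3 * w (t, 0)) (∫ p in Ioo 0 t ×ˢ univ, box (kd δ t) p * w p)
  rw [abs_sub_comm] at this
  linarith

def VR (R : ℝ) : ℝ := volume.real (closedBall (0 : E3) R)

lemma VR_nonneg (R : ℝ) : 0 ≤ VR R := ENNReal.toReal_nonneg

lemma rad_lint {W : ℝ → ℝ} (h0 : ∀ y, 0 ≤ W y) (hi : IntegrableOn (fun y => y ^ 2 * W y) (Ioi 0)) :
    ∫⁻ z : E3, ENNReal.ofReal (W ‖z‖) = ENNReal.ofReal (V3 * ∫ y in Ioi (0 : ℝ), y ^ 2 * W y) := by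
  rw [← RAD, ofReal_integral_eq_lintegral_ofReal (RADi.2 hi) (Eventually.of_forall fun z => h0 _)]

lemma etad_lint {δ : ℝ} (hδ : 0 < δ) (a : ℝ) : ∫⁻ s : ℝ, ENNReal.ofReal (etad δ (a - s)) = 1 := by
  rw [← ofReal_integral_eq_lintegral_ofReal ((etad_intg hδ).comp_sub_left a)
    (Eventually.of_forall fun s => etad_nonneg hδ _), integral_sub_left_eq_self (etad δ), etad_int hδ]
  simp

lemma int_le_of_lint {α : Type*} [MeasurableSpace α] {μ : Measure α} {g : α → ℝ} {G : α → ℝ≥0∞} {X : ℝ}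
    (hX : 0 ≤ X) (h : ∀ᵐ x ∂μ, ENNReal.ofReal |g x| ≤ G x) (hG : ∫⁻ x, G x ∂μ ≤ ENNReal.ofReal X) :
    |∫ x, g x ∂μ| ≤ X := by
  have := norm_integral_le_lintegral_norm (μ := μ) g
  rw [Real.norm_eq_abs] at this
  refine this.trans (ENNReal.toReal_le_of_le_ofReal hX ((lintegral_mono_ae ?_).trans hG))
  filter_upwards [h] with x hx
  simpa using hx

def rw0 (t : ℝ) (h : ℝ → ℝ) (y : ℝ) : ℝ := (Ico 0 t).indicator (fun y => (y ^ 2)⁻¹ * h y) y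

lemma rw0_int {t : ℝ} {h : ℝ → ℝ} : ∫ y in Ioi (0 : ℝ), y ^ 2 * rw0 t h y = ∫ y in Ioo 0 t, h y := by
  have : ∀ y ∈ Ioi (0 : ℝ), y ^ 2 * rw0 t h y = (Ioo 0 t).indicator h y := by
    intro y hy
    have hy0 : (0 : ℝ) < y := hy
    by_cases hyt : y < t
    · rw [rw0, indicator_of_mem (mem_Ico.2 ⟨hy0.le, hyt⟩), indicator_of_mem (mem_Ioo.2 ⟨hy0, hyt⟩)]
      field_simp
    · rw [rw0, indicator_of_notMem (fun h => hyt h.2), indicator_of_notMem (fun h => hyt h.2), mul_zero]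
  rw [setIntegral_congr_fun measurableSet_Ioi this, setIntegral_indicator measurableSet_Ioo]
  congr 2
  ext y; simp

lemma rw0_intg {t : ℝ} {h : ℝ → ℝ} (hi : IntegrableOn h (Ioo 0 t)) :
    IntegrableOn (fun y => y ^ 2 * rw0 t h y) (Ioi 0) := by
  have h1 : IntegrableOn ((Ioo 0 t).indicator h) (Ioi 0) :=
    (hi.integrable_indicator measurableSet_Ioo).integrableOn
  refine h1.congr_fun (fun y hy => ?_) measurableSet_Ioi
  have hy0 : (0 : ℝ) < y := hy
  by_cases hyt : y < t
  · rw [rw0, indicator_of_mem (mem_Ico.2 ⟨hy0.le, hyt⟩), indicator_of_mem (mem_Ioo.2 ⟨hy0, hyt⟩)]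
    field_simp
  · rw [rw0, indicator_of_notMem (fun h => hyt h.2), indicator_of_notMem (fun h => hyt h.2), mul_zero]

lemma rw0_nonneg {t : ℝ} {h : ℝ → ℝ} (h0 : ∀ y, 0 ≤ h y) (y : ℝ) : 0 ≤ rw0 t h y :=
  indicator_nonneg (fun y _ => mul_nonneg (by positivity) (h0 y)) y

lemma rw0_meas {t : ℝ} {h : ℝ → ℝ} (hm : Measurable h) : Measurable (rw0 t h) :=
  Measurable.indicator (by fun_prop) measurableSet_Ico

lemma LR {R t δ : ℝ} (hδ : 0 < δ) {h : ℝ → ℝ} (hm : Measurable h) (h0 : ∀ y, 0 ≤ h y)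
    (hi : IntegrableOn h (Ioo 0 t)) {g : ℝ × PS → ℝ}
    (hg : ∀ s ∈ Ioo 0 t, ∀ z ξ : E3, ‖z‖ < t → ‖ξ‖ ≤ R →
      |g (s, (z, ξ))| ≤ (‖z‖ ^ 2)⁻¹ * h ‖z‖ * etad δ (t - s - ‖z‖))
    (hgz : ∀ s ∈ Ioo 0 t, ∀ z ξ : E3, t ≤ ‖z‖ → g (s, (z, ξ)) = 0)
    (hR : ∀ s ∈ Ioo 0 t, ∀ z ξ : E3, R < ‖ξ‖ → g (s, (z, ξ)) = 0) :
    |∫ p in Ioo 0 t ×ˢ univ, g p| ≤ VR R * (V3 * ∫ y in Ioo 0 t, h y) := by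
  have hWm := rw0_meas (t := t) hm
  have hW0 := rw0_nonneg (t := t) h0
  have hIn : 0 ≤ V3 * ∫ y in Ioo 0 t, h y :=
    mul_nonneg V3_pos.le (setIntegral_nonneg measurableSet_Ioo fun y _ => h0 y)
  set G1 : PS → ℝ≥0∞ := fun q => ENNReal.ofReal (rw0 t h ‖q.1‖) * (closedBall (0 : E3) R).indicator 1 q.2
  have hG1 : Measurable G1 := (by fun_prop : Measurable fun q : PS => ENNReal.ofReal (rw0 t h ‖q.1‖)).mul
    ((measurable_one.indicator measurableSet_closedBall).comp measurable_snd)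
  have hec := (etad_smooth (δ := δ)).continuous
  have hG0 : Measurable fun p : ℝ × PS => ENNReal.ofReal (etad δ (t - ‖p.2.1‖ - p.1)) :=
    (ENNReal.continuous_ofReal.comp (hec.comp (by fun_prop))).measurable
  refine int_le_of_lint (G := fun p => ENNReal.ofReal (etad δ (t - ‖p.2.1‖ - p.1)) * G1 p.2)
    (mul_nonneg (VR_nonneg _) hIn) ?_ ?_
  · refine (ae_restrict_iff' (measurableSet_Ioo.prod MeasurableSet.univ)).2 (Eventually.of_forall ?_)
    rintro ⟨s, z, ξ⟩ ⟨hs, -⟩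
    by_cases hz : t ≤ ‖z‖
    · rw [hgz s hs z ξ hz]; simp
    by_cases hx : R < ‖ξ‖
    · rw [hR s hs z ξ hx]; simp
    push Not at hz hx
    simp only [G1]
    rw [indicator_of_mem (by simpa using hx), Pi.one_apply, mul_one, ← ENNReal.ofReal_mul (etad_nonneg hδ _)]
    refine ENNReal.ofReal_le_ofReal ((hg s hs z ξ hz hx).trans (le_of_eq ?_))
    rw [rw0, indicator_of_mem (mem_Ico.2 ⟨norm_nonneg z, hz⟩), mul_comm,
      show t - s - ‖z‖ = t - ‖z‖ - s by ring]
  · refine (setLIntegral_le_lintegral _ _).trans ?_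
    have hGm : Measurable fun p : ℝ × PS => ENNReal.ofReal (etad δ (t - ‖p.2.1‖ - p.1)) * G1 p.2 :=
      hG0.mul (hG1.comp measurable_snd)
    rw [Measure.volume_eq_prod, lintegral_prod_symm _ hGm.aemeasurable]
    have e1 : ∀ q : PS, ∫⁻ s : ℝ, ENNReal.ofReal (etad δ (t - ‖q.1‖ - s)) * G1 q = G1 q := fun q => by
      rw [lintegral_mul_const (f := fun s => ENNReal.ofReal (etad δ (t - ‖q.1‖ - s))) _
          (ENNReal.continuous_ofReal.comp (hec.comp (by fun_prop))).measurable,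
        etad_lint hδ, one_mul]
    simp only [e1]
    rw [Measure.volume_eq_prod]
    simp only [G1]
    rw [lintegral_prod_mul (f := fun z : E3 => ENNReal.ofReal (rw0 t h ‖z‖))
      (g := (closedBall (0 : E3) R).indicator 1) (by fun_prop)
      (measurable_one.indicator measurableSet_closedBall).aemeasurable,
      lintegral_indicator_one measurableSet_closedBall, rad_lint hW0 (rw0_intg hi), rw0_int,
      mul_comm (VR R), ENNReal.ofReal_mul hIn]
    refine mul_le_mul_right (le_of_eq ?_) _
    rw [VR, Measure.real, ENNReal.ofReal_toReal measure_closedBall_lt_top.ne]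

lemma D_lint {t δ : ℝ} (hδ : 0 < δ) : ∫⁻ z : E3, ENNReal.ofReal (rw0 t (fun y => etad δ (t - y)) ‖z‖)
    ≤ ENNReal.ofReal V3 := by
  have hi := (etad_intg hδ).comp_sub_left t
  rw [rad_lint (rw0_nonneg fun y => etad_nonneg hδ _) (rw0_intg hi.integrableOn), rw0_int]
  refine ENNReal.ofReal_le_ofReal ?_
  have : ∫ y in Ioo 0 t, etad δ (t - y) ≤ ∫ y, etad δ (t - y) :=
    setIntegral_le_integral hi (Eventually.of_forall fun y => etad_nonneg hδ _)
  rw [integral_sub_left_eq_self (etad δ) volume, etad_int hδ] at this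
  nlinarith [V3_pos]

lemma DR0 {t δ A : ℝ} (hδ : 0 < δ) (hA : 0 ≤ A) {g : E3 → ℝ}
    (hg : ∀ z : E3, ‖z‖ < t → |g z| ≤ A * (‖z‖ ^ 2)⁻¹ * etad δ (t - ‖z‖))
    (hgz : ∀ z : E3, t ≤ ‖z‖ → g z = 0) : |∫ z, g z| ≤ A * V3 := by
  refine int_le_of_lint (G := fun z : E3 => ENNReal.ofReal A *
    ENNReal.ofReal (rw0 t (fun y => etad δ (t - y)) ‖z‖)) (mul_nonneg hA V3_pos.le)
    (Eventually.of_forall fun z => ?_) ?_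
  · by_cases hz : t ≤ ‖z‖
    · rw [hgz z hz]; simp
    push Not at hz
    rw [← ENNReal.ofReal_mul hA]
    refine ENNReal.ofReal_le_ofReal ((hg z hz).trans (le_of_eq ?_))
    rw [rw0, indicator_of_mem (mem_Ico.2 ⟨norm_nonneg z, hz⟩), mul_assoc]
  · rw [lintegral_const_mul' _ _ ENNReal.ofReal_ne_top, ENNReal.ofReal_mul hA]
    exact mul_le_mul_right (D_lint hδ) _

lemma DR {R t δ A : ℝ} (hδ : 0 < δ) (hA : 0 ≤ A) {g : PS → ℝ}
    (hg : ∀ z ξ : E3, ‖z‖ < t → ‖ξ‖ ≤ R → |g (z, ξ)| ≤ A * (‖z‖ ^ 2)⁻¹ * etad δ (t - ‖z‖))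
    (hgz : ∀ z ξ : E3, t ≤ ‖z‖ → g (z, ξ) = 0) (hR : ∀ z ξ : E3, R < ‖ξ‖ → g (z, ξ) = 0) :
    |∫ q, g q| ≤ VR R * (A * V3) := by
  have hem : Measurable (etad δ) := etad_smooth.continuous.measurable
  have hm := rw0_meas (t := t) (h := fun y => etad δ (t - y)) (by fun_prop)
  refine int_le_of_lint (G := fun q : PS => (ENNReal.ofReal A *
    ENNReal.ofReal (rw0 t (fun y => etad δ (t - y)) ‖q.1‖)) * (closedBall (0 : E3) R).indicator 1 q.2)
    (mul_nonneg (VR_nonneg _) (mul_nonneg hA V3_pos.le))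
    (Eventually.of_forall ?_) ?_
  · rintro ⟨z, ξ⟩
    by_cases hz : t ≤ ‖z‖
    · rw [hgz z ξ hz]; simp
    by_cases hx : R < ‖ξ‖
    · rw [hR z ξ hx]; simp
    push Not at hz hx
    rw [indicator_of_mem (by simpa using hx), Pi.one_apply, mul_one, ← ENNReal.ofReal_mul hA]
    refine ENNReal.ofReal_le_ofReal ((hg z ξ hz hx).trans (le_of_eq ?_))
    rw [rw0, indicator_of_mem (mem_Ico.2 ⟨norm_nonneg z, hz⟩), mul_assoc]
  · rw [Measure.volume_eq_prod, lintegral_prod_mul (f := fun z : E3 => ENNReal.ofReal A *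
      ENNReal.ofReal (rw0 t (fun y => etad δ (t - y)) ‖z‖))
      (g := (closedBall (0 : E3) R).indicator 1) (by fun_prop)
      (measurable_one.indicator measurableSet_closedBall).aemeasurable,
      lintegral_indicator_one measurableSet_closedBall, lintegral_const_mul' _ _ ENNReal.ofReal_ne_top,
      mul_comm (VR R), ENNReal.ofReal_mul (mul_nonneg hA V3_pos.le), ENNReal.ofReal_mul hA]
    refine mul_le_mul' (mul_le_mul_right (D_lint hδ) _) (le_of_eq ?_)
    rw [VR, Measure.real, ENNReal.ofReal_toReal measure_closedBall_lt_top.ne]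

lemma KR_abs {n : ℕ} {b : PS → ℝ} {ρ δ t C s : ℝ} (hδ : 0 < δ) {z ξ : E3}
    (hC : |scl n ρ b (z, ξ)| ≤ C) : |KR n b ρ δ t (s, (z, ξ))| ≤ C * etad δ (t - s - ‖z‖) := by
  unfold KR KE
  rw [abs_mul, abs_of_nonneg (etad_nonneg hδ _)]
  exact mul_le_mul_of_nonneg_right hC (etad_nonneg hδ _)

lemma KRI {R t δ ρ : ℝ} (hδ : 0 < δ) {h : ℝ → ℝ} (hm : Measurable h) (h0 : ∀ y, 0 ≤ h y)
    (hi : IntegrableOn h (Ioo 0 t)) {n : ℕ} {b : PS → ℝ} {G : ℝ × PS → ℝ}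
    (hg : ∀ s ∈ Ioo 0 t, ∀ z ξ : E3, s + ‖z‖ < t → ‖ξ‖ ≤ R →
      |scl n ρ b (z, ξ)| * |G (s, (z, ξ))| ≤ (‖z‖ ^ 2)⁻¹ * h ‖z‖)
    (hR : ∀ s ∈ Ioo 0 t, ∀ z ξ : E3, R < ‖ξ‖ → G (s, (z, ξ)) = 0) :
    |∫ p in Ioo 0 t ×ˢ univ, KR n b ρ δ t p * G p| ≤ VR R * (V3 * ∫ y in Ioo 0 t, h y) := by
  refine LR hδ hm h0 hi (fun s hs z ξ _ hx => ?_) (fun s hs z ξ hz => ?_) fun s hs z ξ hx => ?_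
  · by_cases h1 : s + ‖z‖ < t
    · rw [abs_mul]
      unfold KR KE
      rw [abs_mul, abs_of_nonneg (etad_nonneg hδ _), mul_right_comm]
      exact mul_le_mul_of_nonneg_right (hg s hs z ξ h1 hx) (etad_nonneg hδ _)
    · rw [KR_zero hδ (by linarith), zero_mul, abs_zero]
      exact mul_nonneg (mul_nonneg (by positivity) (h0 _)) (etad_nonneg hδ _)
  · rw [KR_zero hδ (by linarith [hs.1]), zero_mul]
  · rw [hR s hs z ξ hx, mul_zero]

def GB (R t : ℝ) (m : ℝ → ℝ) (G : ℝ × PS → ℝ) : Prop :=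
  (∀ s ∈ Ioo 0 t, ∀ z ξ : E3, s + ‖z‖ < t → ‖ξ‖ ≤ R → |G (s, (z, ξ))| ≤ m s) ∧
  ∀ s ∈ Ioo 0 t, ∀ z ξ : E3, R < ‖ξ‖ → G (s, (z, ξ)) = 0

lemma inv12 (r : ℝ) : (r ^ 1)⁻¹ = (r ^ 2)⁻¹ * r := by
  rcases eq_or_ne r 0 with rfl | h
  · simp
  · field_simp

lemma inv32 (r : ℝ) : (r ^ 3)⁻¹ = (r ^ 2)⁻¹ * r⁻¹ := by
  rw [← mul_inv]; ring_nf

lemma exp_int {t lam : ℝ} (hl : 0 < lam) (ht : 0 ≤ t) :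
    ∫ y in Ioo 0 t, Real.exp (lam * (t - y)) ≤ Real.exp (lam * t) / lam := by
  rw [← integral_Ioc_eq_integral_Ioo, ← intervalIntegral.integral_of_le ht]
  have : ∀ y ∈ uIcc 0 t, HasDerivAt (fun y => - Real.exp (lam * (t - y)) / lam) (Real.exp (lam * (t - y))) y := by
    intro y _
    have h1 : HasDerivAt (fun y => lam * (t - y)) (-lam) y := by
      simpa using ((hasDerivAt_id y).const_sub t).const_mul lam
    have h2 := (h1.exp.neg).div_const lam
    refine h2.congr_deriv ?_
    rw [mul_neg, neg_neg, mul_div_assoc, div_self hl.ne', mul_one]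
  rw [intervalIntegral.integral_eq_sub_of_hasDerivAt this
    (Continuous.intervalIntegrable (by fun_prop) _ _)]
  simp only [sub_self, mul_zero, Real.exp_zero, sub_zero]
  rw [neg_div, neg_div, sub_neg_eq_add]
  have : 0 < 1 / lam := by positivity
  linarith

lemma K1 {b : PS → ℝ} (hb : Ker 1 b) (R : ℝ) {τ : ℝ} (hτ : 0 < τ) : ∃ C : ℝ, 0 ≤ C ∧
    ∀ t ∈ Ioo 0 τ, ∀ δ > 0, ∀ ρ > 0, ∀ lam > 0, ∀ M ≥ 0, ∀ G,
      GB R t (fun s => M * Real.exp (lam * s)) G →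
      |∫ p in Ioo 0 t ×ˢ univ, KR 1 b ρ δ t p * G p| ≤ C * (M * (Real.exp (lam * t) / lam)) := by
  obtain ⟨C, hC0, hC⟩ := hb.bound R
  refine ⟨VR R * (V3 * (C * τ)), mul_nonneg (VR_nonneg _) (mul_nonneg V3_pos.le (by positivity)), ?_⟩
  intro t ht δ hδ ρ hρ lam hl M hM G hG
  have := KRI (R := R) (t := t) (δ := δ) (ρ := ρ) hδ (h := fun y => C * τ * M * Real.exp (lam * (t - y)))
    (by fun_prop) (fun y => by positivity)
    ((Continuous.integrableOn_Icc (a := 0) (b := t) (by fun_prop)).mono_set Ioo_subset_Icc_self) (n := 1) (b := b) (G := G) (fun s hs z ξ hz hx => ?_)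
    hG.2
  · refine this.trans ?_
    rw [integral_const_mul]
    have h1 := exp_int hl ht.1.le
    have h2 : C * τ * M * ∫ y in Ioo 0 t, Real.exp (lam * (t - y)) ≤ C * τ * M * (Real.exp (lam * t) / lam) :=
      mul_le_mul_of_nonneg_left h1 (by positivity)
    have h3 := mul_le_mul_of_nonneg_left (mul_le_mul_of_nonneg_left h2 V3_pos.le) (VR_nonneg R)
    refine h3.trans (le_of_eq (by ring))
  · have h1 := hC ρ hρ z ξ hx
    have h2 := hG.1 s hs z ξ hz hx
    have h3 : Real.exp (lam * s) ≤ Real.exp (lam * (t - ‖z‖)) :=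
      Real.exp_le_exp.2 (mul_le_mul_of_nonneg_left (by linarith) hl.le)
    rw [inv12] at h1
    calc _ ≤ (C * ((‖z‖ ^ 2)⁻¹ * ‖z‖)) * (M * Real.exp (lam * (t - ‖z‖))) :=
          mul_le_mul h1 (h2.trans (mul_le_mul_of_nonneg_left h3 hM)) (abs_nonneg _) (by positivity)
      _ ≤ (C * ((‖z‖ ^ 2)⁻¹ * τ)) * (M * Real.exp (lam * (t - ‖z‖))) := by
          have : ‖z‖ ≤ τ := by linarith [hs.1, ht.2]
          gcongr
      _ = _ := by ring

lemma K2 {b : PS → ℝ} (hb : Ker 2 b) (R : ℝ) {τ : ℝ} (hτ : 0 < τ) : ∃ C : ℝ, 0 ≤ C ∧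
    ∀ t ∈ Ioo 0 τ, ∀ δ > 0, ∀ ρ > 0, ∀ M ≥ 0, ∀ G, GB R t (fun _ => M) G →
      |∫ p in Ioo 0 t ×ˢ univ, KR 2 b ρ δ t p * G p| ≤ C * M := by
  obtain ⟨C, hC0, hC⟩ := hb.bound R
  refine ⟨VR R * (V3 * (C * τ)), mul_nonneg (VR_nonneg _) (mul_nonneg V3_pos.le (by positivity)), ?_⟩
  intro t ht δ hδ ρ hρ M hM G hG
  have := KRI (R := R) (t := t) (δ := δ) (ρ := ρ) hδ (h := fun y => C * M)
    (by fun_prop) (fun y => by positivity)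
    ((Continuous.integrableOn_Icc (a := 0) (b := t) (by fun_prop)).mono_set Ioo_subset_Icc_self) (n := 2) (b := b) (G := G) (fun s hs z ξ hz hx => ?_)
    hG.2
  · refine this.trans ?_
    have : ∫ y in Ioo 0 t, C * M ≤ C * M * τ := by
      simp [ht.1.le]
      rw [mul_comm]
      exact mul_le_mul_of_nonneg_left ht.2.le (by positivity)
    have h3 := mul_le_mul_of_nonneg_left (mul_le_mul_of_nonneg_left this V3_pos.le) (VR_nonneg R)
    refine h3.trans (le_of_eq (by ring))
  · refine (mul_le_mul (hC ρ hρ z ξ hx) (hG.1 s hs z ξ hz hx) (abs_nonneg _) (by positivity)).trans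
      (le_of_eq (by ring))

lemma K2d {b : PS → ℝ} (hb : Ker 2 b) (R : ℝ) : ∃ C : ℝ, 0 ≤ C ∧
    ∀ t δ, 0 < t → 0 < δ → ∀ ρ ≥ δ, ∀ M ≥ 0, ∀ G, GB R t (fun _ => M) G →
      |∫ p in Ioo 0 t ×ˢ univ, (KR 2 b δ δ t p - KR 2 b ρ δ t p) * G p| ≤ C * (M * ρ) := by
  obtain ⟨C, hC0, hC⟩ := hb.bound R
  refine ⟨VR R * (V3 * (4 * C)), mul_nonneg (VR_nonneg _) (mul_nonneg V3_pos.le (by positivity)), ?_⟩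
  intro t δ ht hδ ρ hρ M hM G hG
  have hρ0 : 0 < ρ := hδ.trans_le hρ
  have := LR (R := R) (t := t) (δ := δ) hδ (h := (Iic (2 * ρ)).indicator (fun y => 2 * C * M))
    (measurable_const.indicator measurableSet_Iic) (fun y => indicator_nonneg (fun _ _ => by positivity) y)
    ((integrable_const _).indicator measurableSet_Iic)
    (g := fun p => (KR 2 b δ δ t p - KR 2 b ρ δ t p) * G p)
    (fun s hs z ξ hz hx => ?_) (fun s hs z ξ hz => ?_) (fun s hs z ξ hx => ?_)
  · refine this.trans ?_
    have : ∫ y in Ioo 0 t, (Iic (2 * ρ)).indicator (fun y => 2 * C * M) y ≤ 4 * C * M * ρ := by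
      rw [setIntegral_indicator measurableSet_Iic]
      have h1 : ∫ y in Ioo 0 t ∩ Iic (2 * ρ), 2 * C * M ≤ ∫ y in Icc 0 (2 * ρ), 2 * C * M :=
        setIntegral_mono_set (Continuous.integrableOn_Icc (by fun_prop)) (Eventually.of_forall fun _ => by positivity)
          (HasSubset.Subset.eventuallyLE fun y hy => ⟨hy.1.1.le, hy.2⟩)
      refine h1.trans (le_of_eq ?_)
      simp [hρ0.le]; ring
    have h3 := mul_le_mul_of_nonneg_left (mul_le_mul_of_nonneg_left this V3_pos.le) (VR_nonneg R)
    refine h3.trans (le_of_eq (by ring))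
  · by_cases h1 : s + ‖z‖ < t
    · by_cases h2 : ‖z‖ ≤ 2 * ρ
      · rw [indicator_of_mem (by exact h2), abs_mul]
        have a1 := KR_abs (t := t) (s := s) hδ (hC δ hδ z ξ hx)
        have a2 := KR_abs (t := t) (s := s) hδ (hC ρ hρ0 z ξ hx)
        have a3 := abs_sub (KR 2 b δ δ t (s, (z, ξ))) (KR 2 b ρ δ t (s, (z, ξ)))
        have a4 := hG.1 s hs z ξ h1 hx
        have a5 := mul_le_mul (a3.trans (add_le_add a1 a2)) a4 (abs_nonneg _)
          (by have := etad_nonneg hδ (t - s - ‖z‖); positivity)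
        exact a5.trans (le_of_eq (by ring))
      · have : KR 2 b δ δ t (s, (z, ξ)) = KR 2 b ρ δ t (s, (z, ξ)) := by
          unfold KR KE
          simp only
          rw [hb.scl_eq hδ hρ (not_le.1 h2)]
        rw [this, sub_self, zero_mul, abs_zero]
        exact mul_nonneg (mul_nonneg (by positivity) (indicator_nonneg (fun _ _ => by positivity) _)) (etad_nonneg hδ _)
    · rw [KR_zero hδ (by linarith), KR_zero hδ (by linarith), sub_self, zero_mul, abs_zero]
      exact mul_nonneg (mul_nonneg (by positivity) (indicator_nonneg (fun _ _ => by positivity) _)) (etad_nonneg hδ _)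
  · rw [KR_zero hδ (by linarith [hs.1]), KR_zero hδ (by linarith [hs.1]), sub_self, zero_mul]
  · rw [hG.2 s hs z ξ hx, mul_zero]

lemma K3 {b : PS → ℝ} (hb : Ker 3 b) (R : ℝ) {τ : ℝ} (hτ : 0 < τ) : ∃ C : ℝ, 0 ≤ C ∧
    ∀ t ∈ Ioo 0 τ, ∀ δ > 0, ∀ ρ > 0, ρ ≤ τ → ∀ M ≥ 0, ∀ G, GB R t (fun _ => M) G →
      |∫ p in Ioo 0 t ×ˢ univ, KR 3 b ρ δ t p * G p| ≤ C * (M * Real.log (τ / ρ)) := by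
  obtain ⟨C, hC0, hC⟩ := hb.bound R
  refine ⟨VR R * (V3 * C), mul_nonneg (VR_nonneg _) (mul_nonneg V3_pos.le (by positivity)), ?_⟩
  intro t ht δ hδ ρ hρ hρτ M hM G hG
  have hint : IntegrableOn (fun y => C * M * y⁻¹) (Icc ρ τ) :=
    ContinuousOn.integrableOn_Icc (continuousOn_const.mul
      (continuousOn_id.inv₀ fun y hy => (hρ.trans_le hy.1).ne'))
  have := KRI (R := R) (t := t) (δ := δ) (ρ := ρ) hδ (h := (Icc ρ τ).indicator (fun y => C * M * y⁻¹))
    (Measurable.indicator (by fun_prop) measurableSet_Icc)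
    (fun y => indicator_nonneg (fun y hy => mul_nonneg (by positivity) (inv_nonneg.2 (hρ.le.trans hy.1))) y)
    (hint.integrable_indicator measurableSet_Icc).integrableOn (n := 3) (b := b) (G := G)
    (fun s hs z ξ hz hx => ?_) hG.2
  · refine this.trans ?_
    have : ∫ y in Ioo 0 t, (Icc ρ τ).indicator (fun y => C * M * y⁻¹) y ≤ C * M * Real.log (τ / ρ) := by
      have h1 := setIntegral_le_integral (s := Ioo 0 t) (hint.integrable_indicator measurableSet_Icc)
        (Eventually.of_forall fun y => indicator_nonneg
          (fun y hy => mul_nonneg (by positivity) (inv_nonneg.2 (hρ.le.trans hy.1))) y)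
      refine h1.trans (le_of_eq ?_)
      rw [integral_indicator measurableSet_Icc, integral_Icc_eq_integral_Ioc,
        ← intervalIntegral.integral_of_le hρτ, intervalIntegral.integral_const_mul,
        integral_inv_of_pos hρ hτ]
    have h3 := mul_le_mul_of_nonneg_left (mul_le_mul_of_nonneg_left this V3_pos.le) (VR_nonneg R)
    refine h3.trans (le_of_eq (by ring))
  · by_cases hzρ : ‖z‖ < ρ
    · rw [(KR_van hb hρ).zr z ξ hzρ, abs_zero, zero_mul]
      exact mul_nonneg (by positivity) (indicator_nonneg
          (fun y hy => mul_nonneg (by positivity) (inv_nonneg.2 (hρ.le.trans hy.1))) _)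
    · rw [indicator_of_mem (mem_Icc.2 ⟨not_lt.1 hzρ, by linarith [hs.1, ht.2]⟩)]
      have h1 := hC ρ hρ z ξ hx
      rw [inv32] at h1
      refine (mul_le_mul h1 (hG.1 s hs z ξ hz hx) (abs_nonneg _) (by positivity)).trans
        (le_of_eq (by ring))

lemma Ker.bound2 {n : ℕ} {b : PS → ℝ} (h : Ker n b) (hn : n = 1 ∨ n = 2) (R : ℝ) {τ : ℝ} (hτ : 0 < τ) :
    ∃ C : ℝ, 0 ≤ C ∧ ∀ δ > 0, ∀ z ξ : E3, ‖z‖ < τ →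
    ‖ξ‖ ≤ R → |scl n δ b (z, ξ)| ≤ C * (‖z‖ ^ 2)⁻¹ := by
  obtain ⟨C, hC0, hC⟩ := h.bound R
  rcases hn with rfl | rfl
  · refine ⟨C * τ, by positivity, fun δ hδ z ξ hz hx => (hC δ hδ z ξ hx).trans ?_⟩
    rw [inv12]
    have : C * ((‖z‖ ^ 2)⁻¹ * ‖z‖) ≤ C * ((‖z‖ ^ 2)⁻¹ * τ) := by gcongr
    exact this.trans (le_of_eq (by ring))
  · exact ⟨C, hC0, fun δ hδ z ξ hz hx => hC δ hδ z ξ hx⟩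

lemma KD {n : ℕ} {b : PS → ℝ} (h : Ker n b) (hn : n = 1 ∨ n = 2) (R : ℝ) {τ : ℝ} (hτ : 0 < τ) :
    ∃ C : ℝ, 0 ≤ C ∧ ∀ t ∈ Ioo 0 τ, ∀ δ > 0, ∀ ρ > 0, ∀ M ≥ 0, ∀ G : PS → ℝ,
      (∀ z ξ : E3, |G (z, ξ)| ≤ M) → (∀ z ξ : E3, R < ‖ξ‖ → G (z, ξ) = 0) →
      |∫ q, KR n b ρ δ t (0, q) * G q| ≤ C * M := by
  obtain ⟨C, hC0, hC⟩ := h.bound2 hn R hτ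
  refine ⟨VR R * (C * V3), mul_nonneg (VR_nonneg _) (mul_nonneg hC0 V3_pos.le), ?_⟩
  intro t ht δ hδ ρ hρ M hM G hG hGR
  have := DR (R := R) (t := t) (δ := δ) (A := C * M) hδ (by positivity)
    (g := fun q => KR n b ρ δ t (0, q) * G q) (fun z ξ hz hx => ?_) (fun z ξ hz => ?_) (fun z ξ hx => ?_)
  · exact this.trans (le_of_eq (by ring))
  · simp only [abs_mul]
    have h1 := KR_abs (t := t) (s := 0) hδ (hC ρ hρ z ξ (hz.trans ht.2) hx)
    have h2 := mul_le_mul h1 (hG z ξ) (abs_nonneg _)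
      (by have := etad_nonneg hδ (t - 0 - ‖z‖); positivity)
    rw [sub_zero] at h2
    exact h2.trans (le_of_eq (by ring))
  · rw [KR_zero hδ (by linarith), zero_mul]
  · rw [hGR z ξ hx, mul_zero]

lemma KD0 {n : ℕ} {b : PS → ℝ} (h : Ker n b) (hn : n = 1 ∨ n = 2) {τ : ℝ} (hτ : 0 < τ) :
    ∃ C : ℝ, 0 ≤ C ∧ ∀ t ∈ Ioo 0 τ, ∀ δ > 0, ∀ ρ > 0, ∀ M ≥ 0, ∀ g : E3 → ℝ,
      (∀ z : E3, |g z| ≤ M) → |∫ z, KR n b ρ δ t (0, (z, 0)) * g z| ≤ C * M := by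
  obtain ⟨C, hC0, hC⟩ := h.bound2 hn 0 hτ
  refine ⟨C * V3, mul_nonneg hC0 V3_pos.le, ?_⟩
  intro t ht δ hδ ρ hρ M hM G hG
  have := DR0 (t := t) (δ := δ) (A := C * M) hδ (by positivity)
    (g := fun z => KR n b ρ δ t (0, (z, 0)) * G z) (fun z hz => ?_) (fun z hz => ?_)
  · exact this.trans (le_of_eq (by ring))
  · simp only [abs_mul]
    have h1 := KR_abs (t := t) (s := 0) hδ (hC ρ hρ z 0 (hz.trans ht.2) (by simp))
    have h2 := mul_le_mul h1 (hG z) (abs_nonneg _)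
      (by have := etad_nonneg hδ (t - 0 - ‖z‖); positivity)
    rw [sub_zero] at h2
    exact h2.trans (le_of_eq (by ring))
  · rw [KR_zero hδ (by linarith), zero_mul]

lemma KR0_smooth {n : ℕ} {b : PS → ℝ} (hb : Ker n b) {ρ δ : ℝ} (hρ : 0 < ρ) (t : ℝ) :
    SM (fun z : E3 => KR n b ρ δ t (0, (z, 0))) :=
  (KR_smooth hb hρ t).comp (by fun_prop)

lemma KR0_cs {n : ℕ} {b : PS → ℝ} {ρ δ t : ℝ} (hδ : 0 < δ) :
    HasCompactSupport (fun z : E3 => KR n b ρ δ t (0, (z, 0))) :=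
  HasCompactSupport.intro (isCompact_closedBall (0 : E3) t) fun z hz => KR_zero hδ (by
    have : t < ‖z‖ := by simpa using hz
    linarith)

lemma KR0_int {n : ℕ} {b : PS → ℝ} (hb : Ker n b) {ρ δ : ℝ} (hρ : 0 < ρ) (hδ : 0 < δ) (t : ℝ) {g : E3 → ℝ}
    (hg : Continuous g) : Integrable (fun z : E3 => KR n b ρ δ t (0, (z, 0)) * g z) :=
  ((KR0_smooth hb hρ t).continuous.mul hg).integrable_of_hasCompactSupport (KR0_cs hδ).mul_right

lemma KR0_d {n : ℕ} {b : PS → ℝ} (hb : Ker n b) {ρ δ : ℝ} (hρ : 0 < ρ) (t : ℝ) (w z : E3) :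
    fderiv ℝ (fun z : E3 => KR n b ρ δ t (0, (z, 0))) z w = pdd (0, (w, 0)) (KR n b ρ δ t) (0, (z, 0)) := by
  have h2 : HasFDerivAt (fun z : E3 => ((0 : ℝ), (z, (0 : E3))))
      ((0 : E3 →L[ℝ] ℝ).prod ((ContinuousLinearMap.id ℝ E3).prod (0 : E3 →L[ℝ] E3))) z :=
    (hasFDerivAt_const _ _).prodMk ((hasFDerivAt_id z).prodMk (hasFDerivAt_const _ _))
  have h3 := (sm_diff (KR_smooth (δ := δ) hb hρ t) (0, (z, 0))).hasFDerivAt.comp z h2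
  have h4 := h3.fderiv
  simp only [Function.comp_def] at h4
  rw [h4]; rfl

lemma ibp {h g : E3 → ℝ} (hh : ContDiff ℝ 1 h) (hc : HasCompactSupport h) (hg : ContDiff ℝ 1 g) (w : E3) :
    Integrable (fun z => fderiv ℝ h z w * g z) ∧
    ∫ z, fderiv ℝ h z w * g z = - ∫ z, h z * fderiv ℝ g z w := by
  have c1 : Continuous fun z => fderiv ℝ h z w :=
    (hh.continuous_fderiv one_ne_zero).clm_apply continuous_const
  have c2 : Continuous fun z => fderiv ℝ g z w :=
    (hg.continuous_fderiv one_ne_zero).clm_apply continuous_const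
  have s1 : HasCompactSupport fun z => fderiv ℝ h z w := by
    refine hc.fderiv (𝕜 := ℝ) |>.comp_left (g := fun L : E3 →L[ℝ] ℝ => L w) rfl
  have i1 : Integrable (fun z => fderiv ℝ h z w * g z) :=
    (c1.mul hg.continuous).integrable_of_hasCompactSupport s1.mul_right
  have i2 : Integrable (fun z => h z * fderiv ℝ g z w) :=
    (hh.continuous.mul c2).integrable_of_hasCompactSupport hc.mul_right
  refine ⟨i1, ?_⟩
  have h1 := T1s (hh.mul hg) hc.mul_right w
  have h2 : ∀ z, fderiv ℝ (h * g) z w = fderiv ℝ h z w * g z + h z * fderiv ℝ g z w := fun z => by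
    rw [fderiv_mul (hh.differentiable one_ne_zero z) (hg.differentiable one_ne_zero z)]
    simp; ring
  change ∫ z, fderiv ℝ (h * g) z w = 0 at h1
  simp only [h2] at h1
  rw [integral_add i1 i2] at h1
  linarith

lemma vv0 (j : Fin 3) : vv j 0 = 0 := by simp [vv_eq]

lemma tq0 (i : Fin 3) (z : E3) : tq (fun _ => 0) (cj i) (z, 0) = om i z := by
  simp [tq, vv0, cj]

lemma om_sum (z : E3) (hz : z ≠ 0) : om 0 z ^ 2 + om 1 z ^ 2 + om 2 z ^ 2 = 1 := by
  unfold om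
  have h := EuclideanSpace.real_norm_sq_eq z
  rw [Fin.sum_univ_three] at h
  have : ‖z‖ ^ 2 ≠ 0 := by simpa using hz
  simp only [div_pow, ← add_div]
  rw [← h, div_self this]

lemma KS_id {δ : ℝ} (hδ : 0 < δ) (t : ℝ) (z : E3) :
    pdd (1, 0) (kd δ t) (0, z) =
      ∑ i, (pdd (0, (e3 i, 0)) (KR 1 (TT (fun _ => 0) (cj i) kap) δ δ t) (0, (z, 0))
        - KR 2 (NN (fun _ => 0) (cj i) (TT (fun _ => 0) (cj i) kap)) δ δ t (0, (z, 0))) := by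
  have hk := KR_smooth (δ := δ) kap_ker hδ t
  have hb : ∀ i, Ker 1 (TT (fun _ => 0) (cj i) kap) := fun i => kap_ker.TT c00_smooth (cj_smooth i)
  have hb2 : ∀ i, Ker 1 (TT (fun _ => 0) (cj i) (TT (fun _ => 0) (cj i) kap)) :=
    fun i => (hb i).TT c00_smooth (cj_smooth i)
  have e1 : pdd (1, 0) (kd δ t) (0, z) = pdd (1, 0) (KR 1 kap δ δ t) (0, (z, 0)) := kd_pdd hk 1 0 (0, z)
  rw [e1]
  have e2 : ∀ i, pdd (0, (e3 i, 0)) (KR 1 (TT (fun _ => 0) (cj i) kap) δ δ t) (0, (z, 0))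
        - KR 2 (NN (fun _ => 0) (cj i) (TT (fun _ => 0) (cj i) kap)) δ δ t (0, (z, 0)) =
      pdd (1, 0) (KR 1 (TT (fun _ => 0) (cj i) (TT (fun _ => 0) (cj i) kap)) δ δ t) (0, (z, 0)) := by
    intro i
    rw [KR_j i (hb i) hδ t]
    simp [DP, vv0]
  simp only [e2]
  unfold KR
  rw [KE_s hδ (KR_van kap_ker hδ) etad_smooth]
  have e3' : ∀ i, scl 1 δ (TT (fun _ => 0) (cj i) (TT (fun _ => 0) (cj i) kap)) (z, 0) =
      scl 1 δ kap (z, 0) * om i z ^ 2 := by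
    intro i
    rw [← scl_TT hδ]
    have := scl_TT (n := 1) (c0 := fun _ => 0) (c := cj i) hδ kap
    rw [← this]
    simp only [TT, tq0]; ring
  rw [Fin.sum_univ_three, KE_s hδ (KR_van (hb2 0) hδ) etad_smooth, KE_s hδ (KR_van (hb2 1) hδ) etad_smooth,
    KE_s hδ (KR_van (hb2 2) hδ) etad_smooth]
  simp only [KE, e3']
  by_cases hz : z = 0
  · have : scl 1 δ kap (z, 0) = 0 := (KR_van kap_ker hδ).zr z 0 (by simpa [hz] using hδ)
    rw [this]; ring
  · have := om_sum z hz
    linear_combination (scl 1 δ kap (z, 0) * deriv (etad δ) (t - 0 - ‖z‖)) * this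

lemma KS {τ : ℝ} (hτ : 0 < τ) : ∃ C : ℝ, 0 ≤ C ∧ ∀ t ∈ Ioo 0 τ, ∀ δ > 0, ∀ A ≥ 0, ∀ g : E3 → ℝ,
    ContDiff ℝ 1 g → (∀ z, |g z| ≤ A) → (∀ i z, |fderiv ℝ g z (e3 i)| ≤ A) →
    |∫ z, pdd (1, 0) (kd δ t) (0, z) * g z| ≤ C * A := by
  have hb : ∀ i, Ker 1 (TT (fun _ => 0) (cj i) kap) := fun i => kap_ker.TT c00_smooth (cj_smooth i)
  have hn : ∀ i, Ker 2 (NN (fun _ => 0) (cj i) (TT (fun _ => 0) (cj i) kap)) :=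
    fun i => (hb i).NN c00_smooth (cj_smooth i)
  choose C1 hC1 h1 using fun i => KD0 (hb i) (Or.inl rfl) hτ
  choose C2 hC2 h2 using fun i => KD0 (hn i) (Or.inr rfl) hτ
  refine ⟨∑ i, (C1 i + C2 i), Finset.sum_nonneg fun i _ => add_nonneg (hC1 i) (hC2 i), ?_⟩
  intro t ht δ hδ A hA g hg hgA hgA'
  have hi : ∀ i, HI volume (fun z => pdd (0, (e3 i, 0)) (KR 1 (TT (fun _ => 0) (cj i) kap) δ δ t) (0, (z, 0)) * g z
      - KR 2 (NN (fun _ => 0) (cj i) (TT (fun _ => 0) (cj i) kap)) δ δ t (0, (z, 0)) * g z)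
      (-(∫ z, KR 1 (TT (fun _ => 0) (cj i) kap) δ δ t (0, (z, 0)) * fderiv ℝ g z (e3 i)) -
        ∫ z, KR 2 (NN (fun _ => 0) (cj i) (TT (fun _ => 0) (cj i) kap)) δ δ t (0, (z, 0)) * g z) := by
    intro i
    have := ibp (sm1 (KR0_smooth (δ := δ) (hb i) hδ t)) (KR0_cs hδ) hg (e3 i)
    simp only [KR0_d (hb i) hδ] at this
    exact HI.sub this ⟨KR0_int (hn i) hδ hδ t hg.continuous, rfl⟩
  have tot := (((hi 0).add (hi 1)).add (hi 2)).2
  have e := Eq.trans (integral_congr_ae (Eventually.of_forall fun z => (by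
    simp only; rw [KS_id hδ t z, Fin.sum_univ_three]; ring :
    (fun z => pdd (1, 0) (kd δ t) (0, z) * g z) z = _))) tot
  rw [e, Fin.sum_univ_three]
  have k1 := fun i => abs_le.1 (h1 i t ht δ hδ δ hδ A hA _ (hgA' i))
  have k2 := fun i => abs_le.1 (h2 i t ht δ hδ δ hδ A hA _ hgA)
  rw [abs_le]
  have a0 := k1 0; have a1 := k1 1; have a2 := k1 2
  have b0 := k2 0; have b1 := k2 1; have b2 := k2 2
  constructor <;> linarith [a0.1, a0.2, a1.1, a1.2, a2.1, a2.2, b0.1, b0.2, b1.1, b1.2, b2.1, b2.2]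

structure Cmp (τ : ℝ) (f : ℝ × PS → ℝ) (u : ℝ × E3 → ℝ) (d : E3 → ℝ) (c0 : E3 → ℝ)
    (c : Fin 3 → E3 → ℝ) : Prop where
  hu : ContDiffOn ℝ 1 u (Sl E3 τ)
  h0 : SM c0
  hc : ∀ j, SM (c j)
  ww : ∀ t ∈ Ioo 0 τ, ∀ k : ℝ × E3 → ℝ, SM k → CS τ k → ZT t k →
    ∫ p in Ioo 0 t ×ˢ univ, box k p * u p =
      - (∫ z, pdd (1, 0) k (0, z) * u (0, z)) + (∫ z, k (0, z) * d z)
      + ∫ p in Ioo 0 t ×ˢ univ, DP c0 c (fun p => k (pz p)) p * f p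

section
variable {τ R : ℝ} {f : ℝ × PS → ℝ} {E B : Fin 3 → ℝ × E3 → ℝ}

lemma cE_smooth (i j : Fin 3) : SM (cE i j) := contDiff_const

lemma cB_smooth (i j : Fin 3) : SM (cB i j) := by
  unfold cB
  split_ifs
  · exact (vv_smooth _).neg
  · exact vv_smooth _
  · exact contDiff_const

lemma Sol.cmpE (h : Sol τ R f E B) (i : Fin 3) : Cmp τ f (E i)
    (fun z => dd τ (B (i + 2)) (0, e3 (i + 1)) (0, z) - dd τ (B (i + 1)) (0, e3 (i + 2)) (0, z))
    (vv i) (cE i) :=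
  ⟨h.hE i, vv_smooth i, cE_smooth i, fun t ht k hk hc hz => WWE h ht.1 ht.2 i hk hc hz⟩

lemma Sol.cmpB (h : Sol τ R f E B) (i : Fin 3) : Cmp τ f (B i)
    (fun z => - (dd τ (E (i + 2)) (0, e3 (i + 1)) (0, z) - dd τ (E (i + 1)) (0, e3 (i + 2)) (0, z)))
    (fun _ => 0) (cB i) :=
  ⟨h.hB i, c00_smooth, cB_smooth i, fun t ht k hk hc hz => WWB h ht.1 ht.2 i hk hc hz⟩

lemma slI {t : ℝ} (htτ : t < τ) {V : Type*} {p : ℝ × V} (hp : p ∈ Ioo 0 t ×ˢ (univ : Set V)) : p ∈ Sl V τ :=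
  ⟨⟨hp.1.1.le, hp.1.2.trans htτ⟩, hp.2⟩

lemma KR_cdo {n : ℕ} {b : PS → ℝ} (hb : Ker n b) {ρ δ : ℝ} (hρ : 0 < ρ) (t : ℝ) :
    ContDiffOn ℝ 1 (KR n b ρ δ t) (Sl PS τ) := (sm1 (KR_smooth hb hρ t)).contDiffOn

lemma mIoo {t : ℝ} {V : Type*} [MeasurableSpace V] : MeasurableSet (Ioo 0 t ×ˢ (univ : Set V)) :=
  measurableSet_Ioo.prod MeasurableSet.univ

lemma Fo_KR {n : ℕ} {b : PS → ℝ} (hb : Ker n b) {ρ δ : ℝ} (hρ : 0 < ρ) (t : ℝ) {p : ℝ × PS}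
    (hp : p ∈ Sl PS τ) : Fo τ E B (KR n b ρ δ t) p =
    ∑ l, Lf E B l p * KR n (pdd (0, e3 l) b) ρ δ t p := by
  unfold Fo
  refine Finset.sum_congr rfl fun l _ => ?_
  rw [dd_eq_pdd (KR_smooth hb hρ t) hp, KR_x hb hρ]

lemma WK (h : Sol τ R f E B) {t : ℝ} (ht : t ∈ Ioo 0 τ) {n : ℕ} {b : PS → ℝ} (hb : Ker n b) {ρ δ : ℝ}
    (hρ : 0 < ρ) (hδ : 0 < δ) :
    HI (volume.restrict (Ioo 0 t ×ˢ univ)) (fun p => DP (fun _ => 1) vv (KR n b ρ δ t) p * f p)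
    (- (∑ l, ∫ p in Ioo 0 t ×ˢ univ, KR n (pdd (0, e3 l) b) ρ δ t p * (Lf E B l p * f p))
      - ∫ q, KR n b ρ δ t (0, q) * f (0, q)) := by
  have hK := KR_cdo (τ := τ) (δ := δ) hb hρ t
  have e1 : EqOn (fun p => Tr τ (KR n b ρ δ t) p * f p)
      (fun p => DP (fun _ => 1) vv (KR n b ρ δ t) p * f p) (Ioo 0 t ×ˢ univ) := fun p hp => by
    simp only; rw [Tr_DP (KR_smooth hb hρ t) (slI ht.2 hp)]
  refine ⟨(h.int ht.2 (Tr_cont hK) (Tr_CZ (KR_CZ hδ))).congr_fun e1 mIoo, ?_⟩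
  rw [← setIntegral_congr_fun mIoo e1, WV h ht.1 ht.2 hK (KR_CZ hδ) (KR_t hδ)]
  congr 2
  have e2 : EqOn (fun p => Fo τ E B (KR n b ρ δ t) p * f p) (fun p =>
      ∑ l, KR n (pdd (0, e3 l) b) ρ δ t p * (Lf E B l p * f p)) (Ioo 0 t ×ˢ univ) := fun p hp => by
    simp only
    rw [Fo_KR hb hρ t (slI ht.2 hp), Finset.sum_mul]
    exact Finset.sum_congr rfl fun l _ => by ring
  rw [setIntegral_congr_fun mIoo e2, integral_finsetSum]
  intro l _
  refine (h.int (G := fun p => KR n (pdd (0, e3 l) b) ρ δ t p * Lf E B l p) ht.2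
    ((KR_cdo (hb.px _) hρ t).continuousOn.mul (Lf_cd h.hE h.hB l).continuousOn)
    ((KR_CZ hδ).mul_right _)).congr (Eventually.of_forall fun p => ?_)
  ring

lemma Sol.KRint (h : Sol τ R f E B) {t : ℝ} (ht : t ∈ Ioo 0 τ) {n : ℕ} {b : PS → ℝ} (hb : Ker n b) {ρ δ : ℝ}
    (hρ : 0 < ρ) (hδ : 0 < δ) : IntegrableOn (fun p => KR n b ρ δ t p * f p) (Ioo 0 t ×ˢ univ) :=
  h.int ht.2 (KR_cdo hb hρ t).continuousOn (KR_CZ hδ)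

lemma B0id (h : Sol τ R f E B) {t : ℝ} (ht : t ∈ Ioo 0 τ) {u d c0 c} (hu : Cmp τ f u d c0 c) {δ : ℝ}
    (hδ : 0 < δ) :
    ∫ p in Ioo 0 t ×ˢ univ, box (kd δ t) p * u p =
      - (∫ z, pdd (1, 0) (kd δ t) (0, z) * u (0, z)) + (∫ z, KR 1 kap δ δ t (0, (z, 0)) * d z)
      + (- (∑ l, ∫ p in Ioo 0 t ×ˢ univ, KR 1 (pdd (0, e3 l) (TT c0 c kap)) δ δ t p * (Lf E B l p * f p))
      - (∫ q, KR 1 (TT c0 c kap) δ δ t (0, q) * f (0, q))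
      + ∫ p in Ioo 0 t ×ˢ univ, KR 2 (NN c0 c kap) δ δ t p * f p) := by
  rw [hu.ww t ht _ (kd_smooth hδ t) (kd_CS hδ t τ) (kd_ZT hδ t), kd_pz]
  have ha := kap_ker.TT hu.h0 hu.hc
  have hm := kap_ker.NN hu.h0 hu.hc
  have := (HI.add (WK h ht ha hδ hδ) (⟨h.KRint ht hm hδ hδ, rfl⟩ : HI _ _ _)).2
  rw [← this]
  congr 2
  ext p
  rw [KR_DIV hu.h0 hu.hc kap_ker hδ t p, add_mul]

end

section
variable {τ R : ℝ}

lemma B0 (hτ : 0 < τ) (R : ℝ) {c0 : E3 → ℝ} {c : Fin 3 → E3 → ℝ} (h0 : SM c0)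
    (hc : ∀ j, SM (c j)) : ∃ C : ℝ, 0 ≤ C ∧
    ∀ f E B u d, Sol τ R f E B → Cmp τ f u d c0 c → ∀ t ∈ Ioo 0 τ, ∀ A ≥ 0,
      (∀ z, |u (0, z)| ≤ A) → (∀ i z, |dd τ u (0, e3 i) (0, z)| ≤ A) → (∀ z, |d z| ≤ A) →
      (∀ q, |f (0, q)| ≤ A) → GB R t (fun _ => A) f →
      ∀ lam > 0, ∀ M ≥ 0, (∀ l, GB R t (fun s => M * Real.exp (lam * s)) (fun p => Lf E B l p * f p)) →
      |u (t, 0)| ≤ C * (A + M * (Real.exp (lam * t) / lam)) := by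
  have ha := kap_ker.TT h0 hc
  have hm := kap_ker.NN h0 hc
  obtain ⟨C1, p1, h1⟩ := KS hτ
  obtain ⟨C2, p2, h2⟩ := KD0 kap_ker (Or.inl rfl) hτ
  choose C3 p3 h3 using fun l => K1 (ha.px (e3 l)) R hτ
  obtain ⟨C4, p4, h4⟩ := KD ha (Or.inl rfl) R hτ
  obtain ⟨C5, p5, h5⟩ := K2 hm R hτ
  set C := C1 + C2 + (C3 0 + C3 1 + C3 2) + C4 + C5 with hC
  have q0 := p3 0; have q1 := p3 1; have q2 := p3 2
  have hC0 : 0 ≤ C := by positivity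
  refine ⟨V3⁻¹ * C, mul_nonneg (inv_nonneg.2 V3_pos.le) hC0, ?_⟩
  intro f E B u d h hu t ht A hA u0 u1 d0 f0 fA lam hl M hM hL
  have key := APX ht.1 ht.2 hu.hu.continuousOn (X := C * (A + M * (Real.exp (lam * t) / lam))) one_pos ?_
  · rw [mul_assoc, inv_mul_eq_div, le_div_iff₀ V3_pos, mul_comm]; exact key
  intro δ hδ _
  rw [B0id h ht hu hδ, Fin.sum_univ_three]
  have z0 : (0 : ℝ) ∈ Ico 0 τ := ⟨le_rfl, hτ⟩
  have a1 := abs_le.1 (h1 t ht δ hδ A hA _ (slice_contDiff hu.hu z0) u0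
    (fun i z => by rw [← dd_z hu.hu z0]; exact u1 i z))
  have a2 := abs_le.1 (h2 t ht δ hδ δ hδ A hA _ d0)
  have a3 := fun l => abs_le.1 (h3 l t ht δ hδ δ hδ lam hl M hM _ (hL l))
  have a4 := abs_le.1 (h4 t ht δ hδ δ hδ A hA (fun q => f (0, q)) (fun z ξ => f0 _) (h.fR 0 z0))
  have a5 := abs_le.1 (h5 t ht δ hδ δ hδ A hA _ fA)
  have b0 := a3 0; have b1 := a3 1; have b2 := a3 2
  set X := M * (Real.exp (lam * t) / lam) with hX
  have hX0 : 0 ≤ X := by positivity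
  have e : C * (A + X) = (C1 * A + C2 * A + C4 * A + C5 * A + C3 0 * X + C3 1 * X + C3 2 * X)
    + ((C3 0 + C3 1 + C3 2) * A + (C1 + C2 + C4 + C5) * X) := by rw [hC]; ring
  have e2 : 0 ≤ (C3 0 + C3 1 + C3 2) * A + (C1 + C2 + C4 + C5) * X := by positivity
  rw [abs_le, e]
  constructor <;> linarith [a1.1, a1.2, a2.1, a2.2, b0.1, b0.2, b1.1, b1.2, b2.1, b2.2, a4.1, a4.2, a5.1, a5.2]

end

section
variable {V : Type*} [NormedAddCommGroup V] [NormedSpace ℝ V] [FiniteDimensional ℝ V]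
  [MeasureSpace V] [BorelSpace V] [(volume : Measure V).IsAddHaarMeasure]

lemma ibpS {τ t : ℝ} (htτ : t < τ) {K u : ℝ × V → ℝ} (hK : ContDiffOn ℝ 1 K (Sl V τ))
    (hu : ContDiffOn ℝ 1 u (Sl V τ)) (w : V) (h1 : CS τ (fun p => K p * u p))
    (h2 : CS τ (fun p => dd τ K (0, w) p * u p)) :
    HI (volume.restrict (Ioo 0 t ×ˢ univ)) (fun p => dd τ K (0, w) p * u p)
      (- ∫ p in Ioo 0 t ×ˢ univ, K p * dd τ u (0, w) p) := by
  have i1 : IntegrableOn (fun p => dd τ K (0, w) p * u p) (Ioo 0 t ×ˢ univ) := intOn htτ ((dd_cont hK (0, w)).mul hu.continuousOn) h2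
  have i2 := intOn htτ (dd_cont (hK.mul hu) (0, w)) (h1.dd _)
  refine ⟨i1, ?_⟩
  have z := T1 htτ (hK.mul hu) h1 w
  have e : EqOn (fun p => K p * dd τ u (0, w) p) (fun p => dd τ (fun p => K p * u p) (0, w) p - dd τ K (0, w) p * u p)
      (Ioo 0 t ×ˢ univ) := fun p hp => by
    simp only
    rw [dd_mul hK hu ⟨⟨hp.1.1.le, hp.1.2.trans htτ⟩, hp.2⟩]; ring
  rw [setIntegral_congr_fun (measurableSet_Ioo.prod MeasurableSet.univ) e, integral_sub i2 i1]
  change ∫ p in Ioo 0 t ×ˢ univ, dd τ (fun p => K p * u p) (0, w) p = 0 at z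
  rw [z]; ring

lemma ibp0 {τ : ℝ} (hτ : 0 < τ) {K u : ℝ × V → ℝ} (hK : ContDiffOn ℝ 1 K (Sl V τ))
    (hu : ContDiffOn ℝ 1 u (Sl V τ)) (w : V) (h1 : CS τ (fun p => K p * u p))
    (h2 : CS τ (fun p => dd τ K (0, w) p * u p)) :
    ∫ z, dd τ K (0, w) (0, z) * u (0, z) = - ∫ z, K (0, z) * dd τ u (0, w) (0, z) := by
  have z0 : (0 : ℝ) ∈ Ico 0 τ := ⟨le_rfl, hτ⟩
  have cc : ∀ g : ℝ × V → ℝ, ContinuousOn g (Sl V τ) → Continuous (fun z => g (0, z)) := fun g hg => by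
    rw [← continuousOn_univ]
    exact hg.comp (by fun_prop) (fun z _ => ⟨z0, mem_univ _⟩)
  have i1 : Integrable (fun z => dd τ K (0, w) (0, z) * u (0, z)) :=
    (cc _ ((dd_cont hK (0, w)).mul hu.continuousOn)).integrable_of_hasCompactSupport (slice_cs h2 z0)
  have i2 : Integrable (fun z => dd τ (fun p => K p * u p) (0, w) (0, z)) :=
    (cc _ (dd_cont (hK.mul hu) (0, w))).integrable_of_hasCompactSupport (slice_cs (h1.dd _) z0)
  have z : ∫ z, dd τ (fun p => K p * u p) (0, w) (0, z) = 0 := by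
    simp only [dd_z (hK.mul hu) z0]
    exact T1s (slice_contDiff (hK.mul hu) z0) (slice_cs h1 z0) w
  have e : (fun z => K (0, z) * dd τ u (0, w) (0, z)) = fun z =>
      dd τ (fun p => K p * u p) (0, w) (0, z) - dd τ K (0, w) (0, z) * u (0, z) := by
    ext z
    rw [dd_mul hK hu ⟨z0, mem_univ _⟩]; ring
  rw [e, integral_sub i2 i1, z]; ring
end

section
variable {τ R : ℝ} {f : ℝ × PS → ℝ} {E B : Fin 3 → ℝ × E3 → ℝ}

structure Bd (τ R : ℝ) (f : ℝ × PS → ℝ) (E B : Fin 3 → ℝ × E3 → ℝ) (j : Fin 3) (t N M lam : ℝ) : Prop where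
  f0 : ∀ q, |f (0, q)| ≤ N
  f1 : ∀ q, |dd τ f (0, (e3 j, 0)) (0, q)| ≤ N
  L0 : ∀ l q, |Lf E B l (0, q) * f (0, q)| ≤ N
  gf : GB R t (fun _ => N) f
  gL : ∀ l, GB R t (fun _ => N) (fun p => Lf E B l p * f p)
  gLL : ∀ l m, GB R t (fun _ => N) (fun p => Lf E B m p * Lf E B l p * f p)
  gLd : ∀ l m, GB R t (fun _ => N) (fun p => Lf E B m p * dd τ (Lf E B l) (0, (0, e3 m)) p * f p)
  gT : ∀ l, GB R t (fun s => M * Real.exp (lam * s)) (fun p => Tr τ (Lf E B l) p * f p)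

lemma GB.exp1 {t N : ℝ} (hN : 0 ≤ N) {G : ℝ × PS → ℝ} (h : GB R t (fun _ => N) G) :
    GB R t (fun s => N * Real.exp (1 * s)) G :=
  ⟨fun s hs z ξ hz hx => (h.1 s hs z ξ hz hx).trans (le_mul_of_one_le_right hN (Real.one_le_exp (by linarith [hs.1]))), h.2⟩

lemma K1c {b : PS → ℝ} (hb : Ker 1 b) (R : ℝ) (hτ : 0 < τ) : ∃ C : ℝ, 0 ≤ C ∧
    ∀ t ∈ Ioo 0 τ, ∀ δ > 0, ∀ ρ > 0, ∀ M ≥ 0, ∀ G, GB R t (fun _ => M) G →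
      |∫ p in Ioo 0 t ×ˢ univ, KR 1 b ρ δ t p * G p| ≤ C * M := by
  obtain ⟨C, hC, h⟩ := K1 hb R hτ
  refine ⟨C * Real.exp τ, by positivity, fun t ht δ hδ ρ hρ M hM G hG => ?_⟩
  refine (h t ht δ hδ ρ hρ 1 one_pos M hM G (hG.exp1 hM)).trans ?_
  rw [one_mul, div_one, mul_assoc]
  refine mul_le_mul_of_nonneg_left ?_ hC
  rw [mul_comm]
  exact mul_le_mul_of_nonneg_right (Real.exp_le_exp.2 ht.2.le) hM

lemma WL (h : Sol τ R f E B) {t : ℝ} (ht : t ∈ Ioo 0 τ) {b : PS → ℝ} (hb : Ker 1 b) {δ : ℝ}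
    (hδ : 0 < δ) (l : Fin 3) :
    HI (volume.restrict (Ioo 0 t ×ˢ univ)) (fun p => Lf E B l p * DP (fun _ => 1) vv (KR 1 b δ δ t) p * f p)
    (- (∑ m, ((∫ p in Ioo 0 t ×ˢ univ, KR 1 b δ δ t p * (Lf E B m p * dd τ (Lf E B l) (0, (0, e3 m)) p * f p))
        + ∫ p in Ioo 0 t ×ˢ univ, KR 1 (pdd (0, e3 m) b) δ δ t p * (Lf E B m p * Lf E B l p * f p)))
      - (∫ q, KR 1 b δ δ t (0, q) * (Lf E B l (0, q) * f (0, q)))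
      - ∫ p in Ioo 0 t ×ˢ univ, KR 1 b δ δ t p * (Tr τ (Lf E B l) p * f p)) := by
  have hk := KR_smooth (δ := δ) hb hδ t
  have hK0 := KR_cdo (τ := τ) (δ := δ) hb hδ t
  have hz0 : CZ τ (KR 1 b δ δ t) := KR_CZ hδ
  have hL := fun l => Lf_cd h.hE h.hB l
  set K : ℝ × PS → ℝ := fun p => KR 1 b δ δ t p * Lf E B l p with hKd
  have hK : ContDiffOn ℝ 1 K (Sl PS τ) := hK0.mul (hL l)
  have hz : CZ τ K := hz0.mul_right _
  have w := WV h ht.1 ht.2 hK hz (fun q => by simp [hKd, KR_t hδ])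
  have i1 := h.int ht.2 (Tr_cont hK) (Tr_CZ hz)
  have i2 : IntegrableOn (fun p => KR 1 b δ δ t p * (Tr τ (Lf E B l) p * f p)) (Ioo 0 t ×ˢ univ) :=
    (h.int ht.2 (hK0.continuousOn.mul (Tr_cont (hL l))) (hz0.mul_right _)).congr
      (Eventually.of_forall fun p => by simp only [Pi.mul_apply]; ring)
  have e1 : EqOn (fun p => Tr τ K p * f p - KR 1 b δ δ t p * (Tr τ (Lf E B l) p * f p))
      (fun p => Lf E B l p * DP (fun _ => 1) vv (KR 1 b δ δ t) p * f p) (Ioo 0 t ×ˢ univ) := fun p hp => by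
    have hp' := slI ht.2 hp
    simp only
    rw [← Tr_DP hk hp']
    simp only [Tr, hKd, dd_mul hK0 (hL l) hp', Fin.sum_univ_three]
    ring
  refine ⟨(i1.sub i2).congr_fun e1 mIoo, ?_⟩
  rw [← setIntegral_congr_fun mIoo e1, integral_sub i1 i2, w]
  congr 1
  have e2 : EqOn (fun p => Fo τ E B K p * f p) (fun p =>
      ∑ m, (KR 1 b δ δ t p * (Lf E B m p * dd τ (Lf E B l) (0, (0, e3 m)) p * f p)
        + KR 1 (pdd (0, e3 m) b) δ δ t p * (Lf E B m p * Lf E B l p * f p))) (Ioo 0 t ×ˢ univ) := fun p hp => by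
    have hp' := slI ht.2 hp
    simp only [Fo, hKd, dd_mul hK0 (hL l) hp', dd_eq_pdd hk hp', KR_x hb hδ, Fin.sum_univ_three]
    ring
  have j1 : ∀ m, IntegrableOn (fun p => KR 1 b δ δ t p * (Lf E B m p * dd τ (Lf E B l) (0, (0, e3 m)) p * f p))
      (Ioo 0 t ×ˢ univ) := fun m =>
    (h.int ht.2 (hK0.continuousOn.mul ((hL m).continuousOn.mul (dd_cont (hL l) _))) (hz0.mul_right _)).congr
      (Eventually.of_forall fun p => by simp only [Pi.mul_apply]; ring)
  have j2 : ∀ m, IntegrableOn (fun p => KR 1 (pdd (0, e3 m) b) δ δ t p * (Lf E B m p * Lf E B l p * f p))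
      (Ioo 0 t ×ˢ univ) := fun m =>
    (h.int ht.2 ((KR_cdo (hb.px (e3 m)) hδ t).continuousOn.mul ((hL m).continuousOn.mul (hL l).continuousOn))
      ((KR_CZ hδ).mul_right _)).congr
      (Eventually.of_forall fun p => by simp only [Pi.mul_apply]; ring)
  congr 1
  · rw [setIntegral_congr_fun mIoo e2, integral_finsetSum]
    · congr 1
      exact Finset.sum_congr rfl fun m _ => integral_add (j1 m) (j2 m)
    · exact fun m _ => (j1 m).add (j2 m)
  · congr 1; ext q; simp only [hKd]; ring

lemma pdd_CZ {K : ℝ × PS → ℝ} (hK : SM K) (hz : CZ τ K) (w : ℝ × PS) : CZ τ (pdd w K) := by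
  obtain ⟨r, h⟩ := hz.dd w
  exact ⟨r, fun s hs z ξ hx => by rw [← dd_eq_pdd hK ⟨hs, mem_univ _⟩]; exact h s hs z ξ hx⟩

lemma WJ (h : Sol τ R f E B) {t : ℝ} (ht : t ∈ Ioo 0 τ) {b : PS → ℝ} (hb : Ker 1 b) {δ : ℝ}
    (hδ : 0 < δ) (j : Fin 3) :
    HI (volume.restrict (Ioo 0 t ×ˢ univ))
      (fun p => DP (fun _ => 1) vv (pdd (0, (e3 j, 0)) (KR 1 b δ δ t)) p * f p)
    (- (∑ l, ((∫ p in Ioo 0 t ×ˢ univ, Lf E B l p *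
          DP (fun _ => 1) vv (KR 1 (TT (fun _ => 0) (cj j) (pdd (0, e3 l) b)) δ δ t) p * f p)
        + ∫ p in Ioo 0 t ×ˢ univ, KR 2 (NN (fun _ => 0) (cj j) (pdd (0, e3 l) b)) δ δ t p * (Lf E B l p * f p)))
      + ∫ q, KR 1 b δ δ t (0, q) * dd τ f (0, (e3 j, 0)) (0, q)) := by
  have hk := KR_smooth (δ := δ) hb hδ t
  have hk' := pdd_smooth hk (0, (e3 j, 0))
  have hK := (sm1 hk').contDiffOn (s := Sl PS τ)
  have hz : CZ τ (pdd (0, (e3 j, 0)) (KR 1 b δ δ t)) := pdd_CZ hk (KR_CZ hδ) _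
  have hzt : ZT t (KR 1 b δ δ t) := by
    refine ⟨δ / 4, by positivity, fun s hs q => KR_zero hδ (by linarith [norm_nonneg q.1])⟩
  have e1 : EqOn (fun p => Tr τ (pdd (0, (e3 j, 0)) (KR 1 b δ δ t)) p * f p)
      (fun p => DP (fun _ => 1) vv (pdd (0, (e3 j, 0)) (KR 1 b δ δ t)) p * f p) (Ioo 0 t ×ˢ univ) := fun p hp => by
    simp only; rw [Tr_DP hk' (slI ht.2 hp)]
  refine ⟨(h.int ht.2 (Tr_cont hK) (Tr_CZ hz)).congr_fun e1 mIoo, ?_⟩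
  rw [← setIntegral_congr_fun mIoo e1, WV h ht.1 ht.2 hK hz (fun q => (hzt.pdd _).at q), sub_eq_add_neg]
  congr 1
  · congr 1
    have e2 : EqOn (fun p => Fo τ E B (pdd (0, (e3 j, 0)) (KR 1 b δ δ t)) p * f p) (fun p =>
        ∑ l, (Lf E B l p * DP (fun _ => 1) vv (KR 1 (TT (fun _ => 0) (cj j) (pdd (0, e3 l) b)) δ δ t) p * f p
          + KR 2 (NN (fun _ => 0) (cj j) (pdd (0, e3 l) b)) δ δ t p * (Lf E B l p * f p)))
          (Ioo 0 t ×ˢ univ) := fun p hp => by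
      have hp' := slI ht.2 hp
      simp only [Fo, Finset.sum_mul]
      refine Finset.sum_congr rfl fun l _ => ?_
      rw [dd_eq_pdd hk' hp', pdd_comm hk, KR_x hb hδ, KR_j j (hb.px (e3 l)) hδ]
      ring
    have hbl := fun l => hb.px (e3 l)
    have j2 : ∀ l, IntegrableOn (fun p => KR 2 (NN (fun _ => 0) (cj j) (pdd (0, e3 l) b)) δ δ t p * (Lf E B l p * f p))
        (Ioo 0 t ×ˢ univ) := fun l =>
      (h.int ht.2 ((KR_cdo ((hbl l).NN c00_smooth (cj_smooth j)) hδ t).continuousOn.mul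
        (Lf_cd h.hE h.hB l).continuousOn) ((KR_CZ hδ).mul_right _)).congr
        (Eventually.of_forall fun p => by simp only [Pi.mul_apply]; ring)
    have j1 := fun l => (WL h ht ((hbl l).TT c00_smooth (cj_smooth j)) hδ l).1
    rw [setIntegral_congr_fun mIoo e2, integral_finsetSum]
    · exact Finset.sum_congr rfl fun m _ => integral_add (j1 m) (j2 m)
    · exact fun m _ => (j1 m).add (j2 m)
  · have z0 : 0 < τ := ht.1.trans ht.2
    have := ibp0 z0 (KR_cdo (τ := τ) (δ := δ) hb hδ t) h.hf (e3 j, 0) ((KR_CZ hδ).mulf h.fR)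
      (((KR_CZ hδ).dd _).mulf h.fR)
    rw [← neg_eq_iff_eq_neg.2 this]
    congr 1
    refine integral_congr_ae (Eventually.of_forall fun q => ?_)
    simp only
    rw [dd_eq_pdd hk ⟨⟨le_rfl, z0⟩, mem_univ _⟩]

lemma Q1 (hτ : 0 < τ) (R : ℝ) {b : PS → ℝ} (hb : Ker 1 b) (j : Fin 3) : ∃ C : ℝ, 0 ≤ C ∧
    ∀ f E B, Sol τ R f E B → ∀ t ∈ Ioo 0 τ, ∀ δ > 0, ∀ N ≥ 0, ∀ M ≥ 0, ∀ lam > 0, Bd τ R f E B j t N M lam →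
    |∫ p in Ioo 0 t ×ˢ univ, DP (fun _ => 1) vv (pdd (0, (e3 j, 0)) (KR 1 b δ δ t)) p * f p| ≤
      C * (N + M * (Real.exp (lam * t) / lam)) := by
  have hbl := fun l => hb.px (e3 l)
  have ha := fun l => (hbl l).TT c00_smooth (cj_smooth j)
  have hn := fun l => (hbl l).NN c00_smooth (cj_smooth j)
  choose C1 p1 h1 using fun l => K1c (ha l) R hτ
  choose C2 p2 h2 using fun l m => K1c ((ha l).px (e3 m)) R hτ
  choose C3 p3 h3 using fun l => KD (ha l) (Or.inl rfl) R hτ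
  choose C4 p4 h4 using fun l => K1 (ha l) R hτ
  choose C5 p5 h5 using fun l => K2 (hn l) R hτ
  obtain ⟨C6, p6, h6⟩ := KD hb (Or.inl rfl) R hτ
  set C := (∑ l, (3 * C1 l + (C2 l 0 + C2 l 1 + C2 l 2) + C3 l + C4 l + C5 l)) + C6 with hC
  have hD : ∀ l, 0 ≤ 3 * C1 l + (C2 l 0 + C2 l 1 + C2 l 2) + C3 l + C4 l + C5 l := fun l => by
    have := p1 l; have := p2 l 0; have := p2 l 1; have := p2 l 2; have := p3 l; have := p4 l; have := p5 l
    positivity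
  have hC0 : 0 ≤ C := add_nonneg (Finset.sum_nonneg fun l _ => hD l) p6
  refine ⟨C, hC0, ?_⟩
  intro f E B h t ht δ hδ N hN M hM lam hl hB
  have z0 : (0 : ℝ) ∈ Ico 0 τ := ⟨le_rfl, hτ⟩
  rw [(WJ h ht hb hδ j).2]
  simp only [(WL h ht (ha _) hδ _).2]
  set X := M * (Real.exp (lam * t) / lam) with hX
  have hX0 : 0 ≤ X := by positivity
  have t6 := h6 t ht δ hδ δ hδ N hN (fun q => dd τ f (0, (e3 j, 0)) (0, q)) (fun z ξ => hB.f1 _)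
    (fun z ξ hx => by
      rw [dd_z h.hf z0]
      have : (fun q => f (0, q)) =ᶠ[𝓝 (z, ξ)] fun _ => 0 := by
        have ho : IsOpen {q : PS | R < ‖q.2‖} := isOpen_lt continuous_const (by fun_prop)
        filter_upwards [ho.mem_nhds hx] with q hq
        exact h.fR 0 z0 q.1 q.2 hq
      rw [this.fderiv_eq]; simp)
  refine (abs_add_le _ _).trans ?_
  rw [abs_neg, hC, add_mul]
  refine add_le_add ?_ (t6.trans (mul_le_mul_of_nonneg_left (by linarith) p6))
  rw [Finset.sum_mul]
  refine (Finset.abs_sum_le_sum_abs _ _).trans (Finset.sum_le_sum fun l _ => ?_)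
  have t1 := fun m => abs_le.1 (h1 l t ht δ hδ δ hδ N hN _ (hB.gLd l m))
  have t2 := fun m => abs_le.1 (h2 l m t ht δ hδ δ hδ N hN _ (hB.gLL l m))
  have t3 := abs_le.1 (h3 l t ht δ hδ δ hδ N hN (fun q => Lf E B l (0, q) * f (0, q)) (fun z ξ => hB.L0 l _)
    (fun z ξ hx => by simp only [h.fR 0 z0 z ξ hx, mul_zero]))
  have t4 := abs_le.1 (h4 l t ht δ hδ δ hδ lam hl M hM _ (hB.gT l))
  have t5 := abs_le.1 (h5 l t ht δ hδ δ hδ N hN _ (hB.gL l))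
  rw [Fin.sum_univ_three]
  have u0 := t1 0; have u1 := t1 1; have u2 := t1 2
  have w0 := t2 0; have w1 := t2 1; have w2 := t2 2
  rw [← hX] at t4
  have e : (3 * C1 l + (C2 l 0 + C2 l 1 + C2 l 2) + C3 l + C4 l + C5 l) * (N + X) =
    (3 * (C1 l * N) + (C2 l 0 * N + C2 l 1 * N + C2 l 2 * N) + C3 l * N + C4 l * X + C5 l * N) +
    ((3 * C1 l + (C2 l 0 + C2 l 1 + C2 l 2) + C3 l + C5 l) * X + C4 l * N) := by ring
  have e2 : 0 ≤ (3 * C1 l + (C2 l 0 + C2 l 1 + C2 l 2) + C3 l + C5 l) * X + C4 l * N := by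
    have := p1 l; have := p2 l 0; have := p2 l 1; have := p2 l 2; have := p3 l; have := p4 l; have := p5 l
    positivity
  rw [e, abs_le]
  constructor <;> linarith [u0.1, u0.2, u1.1, u1.2, u2.1, u2.2, w0.1, w0.2, w1.1, w1.2, w2.1, w2.2,
    t3.1, t3.2, t4.1, t4.2, t5.1, t5.2]

end

section
variable {τ R : ℝ} {f : ℝ × PS → ℝ} {E B : Fin 3 → ℝ × E3 → ℝ}

lemma Q2 (hτ : 0 < τ) (R : ℝ) {b : PS → ℝ} (hb : Ker 2 b) (j : Fin 3) : ∃ C : ℝ, 0 ≤ C ∧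
    ∀ f E B, Sol τ R f E B → ∀ t ∈ Ioo 0 τ, ∀ δ > 0, ∀ ρ ≥ δ, ρ ≤ τ → ∀ N ≥ 0, ∀ M lam, Bd τ R f E B j t N M lam →
    ∀ G ≥ 0, GB R t (fun _ => G) (dd τ f (0, (e3 j, 0))) →
    |∫ p in Ioo 0 t ×ˢ univ, pdd (0, (e3 j, 0)) (KR 2 b δ δ t) p * f p| ≤
      C * (N + G * ρ + N * Real.log (τ / ρ)) := by
  have ha := hb.TT c00_smooth (cj_smooth j)
  have hn := hb.NN c00_smooth (cj_smooth j)
  obtain ⟨C1, p1, h1⟩ := K2d hb R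
  choose C2 p2 h2 using fun l => K2 (ha.px (e3 l)) R hτ
  obtain ⟨C3, p3, h3⟩ := KD ha (Or.inr rfl) R hτ
  obtain ⟨C4, p4, h4⟩ := K3 hn R hτ
  set C := C1 + (C2 0 + C2 1 + C2 2) + C3 + C4 with hC
  have q0 := p2 0; have q1 := p2 1; have q2 := p2 2
  refine ⟨C, by positivity, ?_⟩
  intro f E B h t ht δ hδ ρ hρ hρτ N hN M lam hB G hG hGB
  have hρ0 : 0 < ρ := hδ.trans_le hρ
  have z0 : (0 : ℝ) ∈ Ico 0 τ := ⟨le_rfl, hτ⟩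
  have k1 := KR_smooth (δ := δ) hb hδ t
  have k2 := KR_smooth (δ := δ) hb hρ0 t
  have cd1 := KR_cdo (τ := τ) (δ := δ) hb hδ t
  have cd2 := KR_cdo (τ := τ) (δ := δ) hb hρ0 t
  have hz1 : CZ τ (KR 2 b δ δ t) := KR_CZ hδ
  have hz2 : CZ τ (KR 2 b ρ δ t) := KR_CZ hδ
  have hz : CZ τ (fun p => KR 2 b δ δ t p - KR 2 b ρ δ t p) :=
    ⟨t, fun s hs z ξ hz => by
      simp only; rw [KR_zero hδ (by linarith [hs.1]), KR_zero hδ (by linarith [hs.1])]; ring⟩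
  have i1 := ibpS ht.2 (cd1.sub cd2) h.hf (e3 j, 0) (hz.mulf h.fR) ((hz.dd _).mulf h.fR)
  have i2 := WK h ht ha hρ0 hδ
  have i3 : HI _ _ _ := ⟨h.KRint ht hn hρ0 hδ, rfl⟩
  have tot := ((i1.add (i2.add i3))).2
  have e : EqOn (fun p => pdd (0, (e3 j, 0)) (KR 2 b δ δ t) p * f p) _ (Ioo 0 t ×ˢ univ) := fun p hp => by
    have hp' := slI ht.2 hp
    have : dd τ (fun p => KR 2 b δ δ t p - KR 2 b ρ δ t p) (0, (e3 j, 0)) p =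
      pdd (0, (e3 j, 0)) (KR 2 b δ δ t) p - pdd (0, (e3 j, 0)) (KR 2 b ρ δ t) p := by
      have dsub : DifferentiableAt ℝ (fun p => KR 2 b δ δ t p - KR 2 b ρ δ t p) p :=
        (sm_diff k1 p).sub (sm_diff k2 p)
      rw [dd_eq_fderiv dsub hp', fderiv_fun_sub (sm_diff k1 p) (sm_diff k2 p)]
      rfl
    have h2 := KR_j j hb hρ0 t p (δ := δ)
    show _ = dd τ (fun p => KR 2 b δ δ t p - KR 2 b ρ δ t p) (0, (e3 j, 0)) p * f p +
      (DP (fun _ => 1) vv (KR 2 (TT (fun _ => 0) (cj j) b) ρ δ t) p * f p +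
      KR (2 + 1) (NN (fun _ => 0) (cj j) b) ρ δ t p * f p)
    simp only
    rw [this, h2]; ring
  rw [setIntegral_congr_fun mIoo e]
  refine (le_of_eq (congrArg abs tot)).trans ?_
  have a1 := abs_le.1 (h1 t δ ht.1 hδ ρ hρ G hG _ hGB)
  have a2 := fun l => abs_le.1 (h2 l t ht δ hδ ρ hρ0 N hN _ (hB.gL l))
  have a3 := abs_le.1 (h3 t ht δ hδ ρ hρ0 N hN (fun q => f (0, q)) (fun z ξ => hB.f0 _) (h.fR 0 z0))
  have a4 := abs_le.1 (h4 t ht δ hδ ρ hρ0 hρτ N hN _ hB.gf)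
  have b0 := a2 0; have b1 := a2 1; have b2 := a2 2
  have hX : 0 ≤ N * Real.log (τ / ρ) := mul_nonneg hN (Real.log_nonneg (by rw [le_div_iff₀ hρ0]; linarith))
  have hY : 0 ≤ G * ρ := by positivity
  set X := N * Real.log (τ / ρ)
  set Y := G * ρ
  have e : C * (N + Y + X) = (C1 * Y + (C2 0 * N + C2 1 * N + C2 2 * N) + C3 * N + C4 * X) +
    (C1 * (N + X) + (C2 0 + C2 1 + C2 2) * (Y + X) + C3 * (Y + X) + C4 * (N + Y)) := by rw [hC]; ring
  have e2 : 0 ≤ C1 * (N + X) + (C2 0 + C2 1 + C2 2) * (Y + X) + C3 * (Y + X) + C4 * (N + Y) := by positivity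
  rw [e, abs_le, Fin.sum_univ_three]
  simp only [Nat.reduceAdd]
  constructor <;> linarith [a1.1, a1.2, b0.1, b0.2, b1.1, b1.2, b2.1, b2.2, a3.1, a3.2, a4.1, a4.2]

lemma box_pdd {k : ℝ × E3 → ℝ} (hk : SM k) (w : ℝ × E3) : box (pdd w k) = pdd w (box k) := by
  have s2 : ∀ a, SM (pdd a (pdd a k)) := fun a => pdd_smooth (pdd_smooth hk a) a
  have cm : ∀ a, pdd a (pdd a (pdd w k)) = pdd w (pdd a (pdd a k)) := fun a => by
    rw [pdd_comm hk a w, pdd_comm (pdd_smooth hk a) a w]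
  have e : box k = fun p => pdd (1, 0) (pdd (1, 0) k) p - (pdd (0, e3 0) (pdd (0, e3 0) k) p
      + pdd (0, e3 1) (pdd (0, e3 1) k) p + pdd (0, e3 2) (pdd (0, e3 2) k) p) := by
    ext p; simp only [box, Fin.sum_univ_three]
  rw [e]
  ext p
  simp only [box, cm, Fin.sum_univ_three]
  conv_rhs => unfold pdd
  have d : ∀ a, DifferentiableAt ℝ (pdd a (pdd a k)) p := fun a => sm_diff (s2 a) p
  change _ = fderiv ℝ (fun p => pdd (1, 0) (pdd (1, 0) k) p - (pdd (0, e3 0) (pdd (0, e3 0) k) p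
      + pdd (0, e3 1) (pdd (0, e3 1) k) p + pdd (0, e3 2) (pdd (0, e3 2) k) p)) p w
  have t := ((d (1, 0)).hasFDerivAt.sub (((d (0, e3 0)).hasFDerivAt.add (d (0, e3 1)).hasFDerivAt).add
    (d (0, e3 2)).hasFDerivAt)).fderiv
  exact (congrArg (fun L => L w) t).symm

lemma pdd_xi {a : E3 → ℝ} (ha : SM a) (w : E3) (p : ℝ × PS) :
    pdd (0, (w, 0)) (fun p : ℝ × PS => a p.2.2) p = 0 := by
  have h2 : HasFDerivAt (fun p : ℝ × PS => p.2.2) ((ContinuousLinearMap.snd ℝ E3 E3).comp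
      (ContinuousLinearMap.snd ℝ ℝ PS)) p :=
    ((ContinuousLinearMap.snd ℝ E3 E3).comp (ContinuousLinearMap.snd ℝ ℝ PS)).hasFDerivAt
  have h3 := (sm_diff ha p.2.2).hasFDerivAt.comp p h2
  have h4 := h3.fderiv
  simp only [Function.comp_def] at h4
  unfold pdd
  rw [h4]; simp

lemma DP_smooth {c0 : E3 → ℝ} {c : Fin 3 → E3 → ℝ} (h0 : SM c0)
    (hc : ∀ j, SM (c j)) {K : ℝ × PS → ℝ} (hK : SM K) :
    SM (DP c0 c K) := by
  unfold DP
  exact ((xi_smooth h0).mul (pdd_smooth hK _)).add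
    (ContDiff.sum fun j _ => (xi_smooth (hc j)).mul (pdd_smooth hK _))

lemma DP_pdd {c0 : E3 → ℝ} {c : Fin 3 → E3 → ℝ} (h0 : SM c0)
    (hc : ∀ j, SM (c j)) {K : ℝ × PS → ℝ} (hK : SM K) (w : E3) (p : ℝ × PS) :
    DP c0 c (pdd (0, (w, 0)) K) p = pdd (0, (w, 0)) (DP c0 c K) p := by
  have e : DP c0 c K = fun p => c0 p.2.2 * pdd (1, 0) K p + (c 0 p.2.2 * pdd (0, (e3 0, 0)) K p
      + c 1 p.2.2 * pdd (0, (e3 1, 0)) K p + c 2 p.2.2 * pdd (0, (e3 2, 0)) K p) := by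
    ext p; simp only [DP, Fin.sum_univ_three]
  have d : ∀ {a : E3 → ℝ}, SM a → ∀ v, HasFDerivAt (fun p : ℝ × PS => a p.2.2 * pdd v K p)
     (a p.2.2 • fderiv ℝ (pdd v K) p + pdd v K p • fderiv ℝ (fun p : ℝ × PS => a p.2.2) p) p := fun ha v =>
    (sm_diff (xi_smooth ha) p).hasFDerivAt.mul (sm_diff (pdd_smooth hK v) p).hasFDerivAt
  have x : ∀ {a : E3 → ℝ}, SM a → fderiv ℝ (fun p : ℝ × PS => a p.2.2) p (0, (w, 0)) = 0 :=
    fun ha => pdd_xi ha w p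
  have t := ((d h0 (1, 0)).add (((d (hc 0) (0, (e3 0, 0))).add (d (hc 1) (0, (e3 1, 0)))).add
    (d (hc 2) (0, (e3 2, 0))))).fderiv
  rw [e]
  refine Eq.trans ?_ (congrArg (fun L => L (0, (w, 0))) t).symm
  simp only [DP, Fin.sum_univ_three]
  simp only [pdd_comm hK _ (0, (w, 0))]
  simp [x h0, x (hc _), pdd]

lemma B1id (h : Sol τ R f E B) {t : ℝ} (ht : t ∈ Ioo 0 τ) {u d c0 c} (hu : Cmp τ f u d c0 c)
    (hd : ContDiff ℝ 1 d) {δ : ℝ} (hδ : 0 < δ) (j : Fin 3) :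
    ∫ p in Ioo 0 t ×ˢ univ, box (kd δ t) p * dd τ u (0, e3 j) p =
      - ((∫ z, pdd (1, 0) (kd δ t) (0, z) * dd τ u (0, e3 j) (0, z))
      - (∫ z, KR 1 kap δ δ t (0, (z, 0)) * fderiv ℝ d z (e3 j))
      + ((∫ p in Ioo 0 t ×ˢ univ, DP (fun _ => 1) vv (pdd (0, (e3 j, 0)) (KR 1 (TT c0 c kap) δ δ t)) p * f p)
      + ∫ p in Ioo 0 t ×ˢ univ, pdd (0, (e3 j, 0)) (KR 2 (NN c0 c kap) δ δ t) p * f p)) := by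
  have z0 : 0 < τ := ht.1.trans ht.2
  have hk := kd_smooth hδ t
  have hc := kd_CS hδ t τ
  have hw := hu.ww t ht _ (pdd_smooth hk (0, e3 j)) (hc.pdd hk _) ((kd_ZT hδ t).pdd _)
  have s1 := (ibpS ht.2 (sm1 (box_smooth hk)).contDiffOn hu.hu (e3 j) ((box_CS hk hc).mul_right _)
    (((box_CS hk hc).dd _).mul_right _)).2
  have hks := pdd_smooth hk (1, 0)
  have hkc : CS τ (pdd (1, 0) (kd δ t)) := hc.pdd hk _
  have s2 := ibp0 z0 (sm1 hks).contDiffOn hu.hu (e3 j) (hkc.mul_right _) ((hkc.dd _).mul_right _)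
  have s3 := (ibp (sm1 (KR0_smooth (δ := δ) kap_ker hδ t)) (KR0_cs hδ) hd (e3 j)).2
  rw [← neg_eq_iff_eq_neg] at s1
  rw [← s1]
  have r1 : ∫ p in Ioo 0 t ×ˢ univ, dd τ (box (kd δ t)) (0, e3 j) p * u p =
      ∫ p in Ioo 0 t ×ˢ univ, box (pdd (0, e3 j) (kd δ t)) p * u p := by
    refine setIntegral_congr_fun mIoo fun p hp => ?_
    rw [dd_eq_pdd (box_smooth hk) (slI ht.2 hp), box_pdd hk]
  have r2 : ∫ z, pdd (1, 0) (pdd (0, e3 j) (kd δ t)) (0, z) * u (0, z) =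
      ∫ z, dd τ (pdd (1, 0) (kd δ t)) (0, e3 j) (0, z) * u (0, z) := by
    refine integral_congr_ae (Eventually.of_forall fun z => ?_)
    simp only
    rw [dd_eq_pdd hks ⟨⟨le_rfl, z0⟩, mem_univ _⟩, pdd_comm hk]
  have r3 : ∫ z, pdd (0, e3 j) (kd δ t) (0, z) * d z =
      ∫ z, fderiv ℝ (fun z : E3 => KR 1 kap δ δ t (0, (z, 0))) z (e3 j) * d z := by
    refine integral_congr_ae (Eventually.of_forall fun z => ?_)
    simp only
    rw [KR0_d kap_ker hδ]
    congr 1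
    exact kd_pdd (KR_smooth kap_ker hδ t) 0 (e3 j) (0, z)
  have hkK := KR_smooth (δ := δ) kap_ker hδ t
  have ha := kap_ker.TT hu.h0 hu.hc
  have hm := kap_ker.NN hu.h0 hu.hc
  have r4 : ∫ p in Ioo 0 t ×ˢ univ, DP c0 c (fun p => pdd (0, e3 j) (kd δ t) (pz p)) p * f p =
      (∫ p in Ioo 0 t ×ˢ univ, DP (fun _ => 1) vv (pdd (0, (e3 j, 0)) (KR 1 (TT c0 c kap) δ δ t)) p * f p)
      + ∫ p in Ioo 0 t ×ˢ univ, pdd (0, (e3 j, 0)) (KR 2 (NN c0 c kap) δ δ t) p * f p := by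
    have hka := KR_smooth (δ := δ) ha hδ t
    have hkm := KR_smooth (δ := δ) hm hδ t
    have i1 := (WJ h ht ha hδ j).1
    have i2 : IntegrableOn (fun p => pdd (0, (e3 j, 0)) (KR 2 (NN c0 c kap) δ δ t) p * f p) (Ioo 0 t ×ˢ univ) :=
      h.int ht.2 (pdd_smooth hkm _).continuous.continuousOn (pdd_CZ hkm (KR_CZ hδ) _)
    refine Eq.trans ?_ (integral_add i1 i2)
    refine integral_congr_ae (Eventually.of_forall fun p => ?_)
    have e1 : (fun p => pdd (0, e3 j) (kd δ t) (pz p)) = pdd (0, (e3 j, 0)) (KR 1 kap δ δ t) := by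
      ext p
      rw [← pdd_lift hk 0 (e3 j) 0 p, kd_pz]
    simp only
    rw [e1, DP_pdd hu.h0 hu.hc hkK, funext (KR_DIV hu.h0 hu.hc kap_ker hδ t),
      pdd_add (DP_smooth contDiff_const vv_smooth hka) hkm, ← DP_pdd contDiff_const vv_smooth hka, add_mul]
  rw [r1, hw, r2, r3, s2, s3, r4]
  ring

lemma B1 (hτ : 0 < τ) (R : ℝ) {c0 : E3 → ℝ} {c : Fin 3 → E3 → ℝ} (h0 : SM c0)
    (hc : ∀ j, SM (c j)) (j : Fin 3) : ∃ C : ℝ, 0 ≤ C ∧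
    ∀ f E B u d, Sol τ R f E B → Cmp τ f u d c0 c → ∀ t ∈ Ioo 0 τ, ∀ N ≥ 1, ContDiff ℝ 1 d →
      ContDiff ℝ 1 (fun z => dd τ u (0, e3 j) (0, z)) →
      (∀ z, |dd τ u (0, e3 j) (0, z)| ≤ N) →
      (∀ i z, |fderiv ℝ (fun z => dd τ u (0, e3 j) (0, z)) z (e3 i)| ≤ N) → (∀ z, |fderiv ℝ d z (e3 j)| ≤ N) →
      ∀ lam > 0, ∀ M ≥ 0, Bd τ R f E B j t N M lam → ∀ G ≥ 1, GB R t (fun _ => G) (dd τ f (0, (e3 j, 0))) →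
      |dd τ u (0, e3 j) (t, 0)| ≤ C * (N + M * (Real.exp (lam * t) / lam) + N * Real.log G) := by
  have ha := kap_ker.TT h0 hc
  have hm := kap_ker.NN h0 hc
  obtain ⟨C1, p1, h1⟩ := KS hτ
  obtain ⟨C2, p2, h2⟩ := KD0 kap_ker (Or.inl rfl) hτ
  obtain ⟨C3, p3, h3⟩ := Q1 hτ R ha j
  obtain ⟨C4, p4, h4⟩ := Q2 hτ R hm j
  set C := C1 + C2 + C3 + C4 * (1 + τ) with hC
  have hC0 : 0 ≤ C := by positivity
  refine ⟨V3⁻¹ * C, mul_nonneg (inv_nonneg.2 V3_pos.le) hC0, ?_⟩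
  intro f E B u d h hu t ht N hN1 hd hu1 u0 u1 d0 lam hl M hM hB G hG1 hG
  have hN : 0 ≤ N := by linarith
  have hG0 : 0 < G := by linarith
  set X := M * (Real.exp (lam * t) / lam) with hX
  have hX0 : 0 ≤ X := by positivity
  have hY0 : 0 ≤ N * Real.log G := mul_nonneg hN (Real.log_nonneg hG1)
  set Y := N * Real.log G with hY
  have key := APX ht.1 ht.2 (dd_cont hu.hu (0, e3 j)) (X := C * (N + X + Y)) (δ0 := τ / G) (by positivity) ?_
  · rw [mul_assoc, inv_mul_eq_div, le_div_iff₀ V3_pos, mul_comm]; exact key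
  intro δ hδ hδ2
  rw [B1id h ht hu hd hδ j]
  have a1 := abs_le.1 (h1 t ht δ hδ N hN _ hu1 u0 u1)
  have a2 := abs_le.1 (h2 t ht δ hδ δ hδ N hN _ d0)
  have a3 := abs_le.1 (h3 f E B h t ht δ hδ N hN M hM lam hl hB)
  have a4 := abs_le.1 (h4 f E B h t ht δ hδ (τ / G) hδ2.le (div_le_self hτ.le hG1) N hN M lam hB G hG0.le hG)
  have e1 : τ / (τ / G) = G := by field_simp
  have e2 : G * (τ / G) = τ := by field_simp
  rw [e1, e2, ← hY] at a4
  rw [← hX] at a3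
  have e : C * (N + X + Y) = (C1 * N + C2 * N + C3 * (N + X) + C4 * (N + τ + Y)) +
    (C1 * (X + Y) + C2 * (X + Y) + C3 * Y + C4 * X + C4 * τ * (N - 1) + C4 * τ * (X + Y)) := by rw [hC]; ring
  have e3' : 0 ≤ C1 * (X + Y) + C2 * (X + Y) + C3 * Y + C4 * X + C4 * τ * (N - 1) + C4 * τ * (X + Y) := by
    have : 0 ≤ N - 1 := by linarith
    positivity
  rw [e, abs_le]
  constructor <;> linarith [a1.1, a1.2, a2.1, a2.2, a3.1, a3.2, a4.1, a4.2]

end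

section
variable {V : Type*} [NormedAddCommGroup V] [NormedSpace ℝ V]

def sh (x : V) (g : ℝ × V → ℝ) (p : ℝ × V) : ℝ := g (p.1, p.2 + x)

open scoped Pointwise in
lemma dd_sh (τ : ℝ) (x : V) (g : ℝ × V → ℝ) (w p : ℝ × V) :
    dd τ (sh x g) w p = dd τ g w (p.1, p.2 + x) := by
  unfold dd
  have e : sh x g = fun p => g (p + (0, x)) := by
    ext p; simp [sh, Prod.add_def]
  have e2 : ((0 : ℝ), x) +ᵥ Sl V τ = Sl V τ := by
    ext p
    rw [Set.mem_vadd_set]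
    constructor
    · rintro ⟨q, hq, rfl⟩
      refine ⟨?_, mem_univ _⟩
      simpa using hq.1
    · intro hp
      refine ⟨(p.1, p.2 - x), ⟨hp.1, mem_univ _⟩, ?_⟩
      simp
  have e3' : (p.1, p.2 + x) = p + (0, x) := by simp [Prod.add_def]
  rw [e, fderivWithin_comp_add_right, e2, e3']

lemma sh_cd {τ : ℝ} (x : V) {g : ℝ × V → ℝ} (hg : ContDiffOn ℝ 1 g (Sl V τ)) :
    ContDiffOn ℝ 1 (sh x g) (Sl V τ) :=
  hg.comp (t := Sl V τ) (f := fun p : ℝ × V => (p.1, p.2 + x)) (by fun_prop) (fun p hp => ⟨hp.1, mem_univ _⟩)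

end

section
variable {τ R : ℝ} {f : ℝ × PS → ℝ} {E B : Fin 3 → ℝ × E3 → ℝ}

lemma Lf_sh (x : E3) (l : Fin 3) (p : ℝ × PS) :
    Lf (fun i => sh x (E i)) (fun i => sh x (B i)) l p = sh (x, 0) (Lf E B l) p := by
  simp [Lf, sh, pz]

lemma Sol.sh (h : Sol τ R f E B) (x : E3) :
    Sol τ R (sh (x, 0) f) (fun i => sh x (E i)) (fun i => sh x (B i)) where
  hf := sh_cd _ h.hf
  hE i := sh_cd _ (h.hE i)
  hB i := sh_cd _ (h.hB i)
  fR s hs z ξ hx := by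
    have := h.fR s hs (z + x) ξ hx
    simpa [_root_.sh] using this
  vl p hp := by
    have := h.vl (p.1, p.2 + (x, 0)) ⟨hp.1, mem_univ _⟩
    simpa only [dd_sh, Lf_sh, _root_.sh, Prod.snd_add, add_zero] using this
  am i p hp := by
    have := h.am i (p.1, p.2 + x) ⟨hp.1, mem_univ _⟩
    simpa [dd_sh, _root_.sh] using this
  fa i p hp := by
    have := h.fa i (p.1, p.2 + x) ⟨hp.1, mem_univ _⟩
    simpa [dd_sh, _root_.sh] using this
  gE p hp := by
    have := h.gE (p.1, p.2 + x) ⟨hp.1, mem_univ _⟩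
    simpa [dd_sh, _root_.sh] using this
  gB p hp := by
    have := h.gB (p.1, p.2 + x) ⟨hp.1, mem_univ _⟩
    simpa [dd_sh, _root_.sh] using this

structure Ini (τ A : ℝ) (u : ℝ × E3 → ℝ) : Prop where
  b0 : ∀ z, |u (0, z)| ≤ A
  b1 : ∀ j z, |dd τ u (0, e3 j) (0, z)| ≤ A
  c1 : ∀ j, ContDiff ℝ 1 (fun z => dd τ u (0, e3 j) (0, z))
  b2 : ∀ i j z, |fderiv ℝ (fun z => dd τ u (0, e3 j) (0, z)) z (e3 i)| ≤ A

lemma Ini.sh {A : ℝ} {u : ℝ × E3 → ℝ} (h : Ini τ A u) (x : E3) : Ini τ A (sh x u) where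
  b0 z := h.b0 (z + x)
  b1 j z := by rw [dd_sh]; exact h.b1 j (z + x)
  c1 j := by
    simp only [dd_sh]
    exact (h.c1 j).comp (by fun_prop : ContDiff ℝ 1 fun z : E3 => z + x)
  b2 i j z := by
    simp only [dd_sh]
    rw [fderiv_comp_add_right (f := fun z => dd τ u (0, e3 j) (0, z)) x]
    exact h.b2 i j (z + x)

lemma curl_b {A : ℝ} {u v : ℝ × E3 → ℝ} (hu : Ini τ A u) (hv : Ini τ A v) (i j : Fin 3) (z : E3) :
    |dd τ u (0, e3 i) (0, z) - dd τ v (0, e3 j) (0, z)| ≤ 2 * A := by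
  refine (abs_sub _ _).trans ?_
  linarith [hu.b1 i z, hv.b1 j z]

lemma curl_b2 {A : ℝ} {u v : ℝ × E3 → ℝ} (hu : Ini τ A u) (hv : Ini τ A v) (i j k : Fin 3) (z : E3) :
    |fderiv ℝ (fun z => dd τ u (0, e3 i) (0, z) - dd τ v (0, e3 j) (0, z)) z (e3 k)| ≤ 2 * A := by
  rw [fderiv_fun_sub ((hu.c1 i).differentiable one_ne_zero z) ((hv.c1 j).differentiable one_ne_zero z)]
  refine (abs_sub _ _).trans ?_
  exact (add_le_add (hu.b2 k i z) (hv.b2 k j z)).trans (by linarith)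

lemma B0all (hτ : 0 < τ) (R : ℝ) : ∃ C : ℝ, 0 ≤ C ∧
    ∀ f E B, Sol τ R f E B → ∀ A ≥ 0, (∀ i, Ini τ A (E i)) → (∀ i, Ini τ A (B i)) →
      (∀ s ∈ Ico 0 τ, ∀ q, |f (s, q)| ≤ A) → ∀ t ∈ Ioo 0 τ,
      ∀ lam > 0, ∀ M ≥ 0, (∀ l, ∀ s ∈ Ioo 0 t, ∀ q, |Lf E B l (s, q) * f (s, q)| ≤ M * Real.exp (lam * s)) →
      ∀ x i, |E i (t, x)| ≤ C * (2 * A + M * (Real.exp (lam * t) / lam)) ∧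
        |B i (t, x)| ≤ C * (2 * A + M * (Real.exp (lam * t) / lam)) := by
  choose C1 p1 h1 using fun i => B0 hτ R (vv_smooth i) (cE_smooth i)
  choose C2 p2 h2 using fun i => B0 hτ R c00_smooth (cB_smooth i)
  refine ⟨∑ i, (C1 i + C2 i), Finset.sum_nonneg fun i _ => add_nonneg (p1 i) (p2 i), ?_⟩
  intro f E B h A hA hE hB hf t ht lam hl M hM hL x i
  have hs := h.sh x
  have z0 : (0 : ℝ) ∈ Ico 0 τ := ⟨le_rfl, hτ⟩
  have hX : 0 ≤ M * (Real.exp (lam * t) / lam) := by positivity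
  have gf : GB R t (fun _ => 2 * A) (sh (x, 0) f) :=
    ⟨fun s hs z ξ _ _ => (hf s ⟨hs.1.le, hs.2.trans ht.2⟩ _).trans (by linarith),
      fun s hs' z ξ hx => hs.fR s ⟨hs'.1.le, hs'.2.trans ht.2⟩ z ξ hx⟩
  have gL : ∀ l, GB R t (fun s => M * Real.exp (lam * s))
      (fun p => Lf (fun i => sh x (E i)) (fun i => sh x (B i)) l p * sh (x, 0) f p) := fun l =>
    ⟨fun s hs z ξ _ _ => by simp only; rw [Lf_sh]; exact hL l s hs _,
      fun s hs' z ξ hx => by simp only; rw [hs.fR s ⟨hs'.1.le, hs'.2.trans ht.2⟩ z ξ hx, mul_zero]⟩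
  have hle : ∀ j, C1 j ≤ ∑ i, (C1 i + C2 i) ∧ C2 j ≤ ∑ i, (C1 i + C2 i) := fun j => by
    have := Finset.single_le_sum (f := fun i => C1 i + C2 i) (fun i _ => add_nonneg (p1 i) (p2 i)) (Finset.mem_univ j)
    constructor <;> linarith [p1 j, p2 j]
  have a2 : ∀ r : ℝ, r ≤ A → r ≤ 2 * A := fun r hr => by linarith
  constructor
  · have := h1 i _ _ _ _ _ hs (hs.cmpE i) t ht (2 * A) (by linarith) (fun z => a2 _ (((hE i).sh x).b0 z))
      (fun k z => a2 _ (((hE i).sh x).b1 k z)) (fun z => curl_b ((hB _).sh x) ((hB _).sh x) _ _ z)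
      (fun q => a2 _ (hf 0 z0 _)) gf lam hl M hM gL
    simp only [sh, zero_add] at this
    exact this.trans (mul_le_mul_of_nonneg_right (hle i).1 (by positivity))
  · have := h2 i _ _ _ _ _ hs (hs.cmpB i) t ht (2 * A) (by linarith) (fun z => a2 _ (((hB i).sh x).b0 z))
      (fun k z => a2 _ (((hB i).sh x).b1 k z))
      (fun z => by rw [abs_neg]; exact curl_b ((hE _).sh x) ((hE _).sh x) _ _ z)
      (fun q => a2 _ (hf 0 z0 _)) gf lam hl M hM gL
    simp only [sh, zero_add] at this
    exact this.trans (mul_le_mul_of_nonneg_right (hle i).2 (by positivity))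

lemma Tr_sh (x : PS) (hx : x.2 = 0) (K : ℝ × PS → ℝ) (p : ℝ × PS) : Tr τ (sh x K) p = sh x (Tr τ K) p := by
  simp only [Tr, dd_sh, sh, Prod.snd_add, hx, add_zero]

lemma B1all (hτ : 0 < τ) (R : ℝ) : ∃ C : ℝ, 0 ≤ C ∧
    ∀ f E B, Sol τ R f E B → ∀ N ≥ 1, (∀ i, Ini τ N (E i)) → (∀ i, Ini τ N (B i)) →
      (∀ s ∈ Ico 0 τ, ∀ q, |f (s, q)| ≤ N) → (∀ j q, |dd τ f (0, (e3 j, 0)) (0, q)| ≤ N) →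
      (∀ l, ∀ s ∈ Ico 0 τ, ∀ q, |Lf E B l (s, q) * f (s, q)| ≤ N) →
      (∀ l m, ∀ s ∈ Ico 0 τ, ∀ q, |Lf E B m (s, q) * Lf E B l (s, q) * f (s, q)| ≤ N) →
      (∀ l m, ∀ s ∈ Ico 0 τ, ∀ q, ‖q.2‖ ≤ R →
        |Lf E B m (s, q) * dd τ (Lf E B l) (0, (0, e3 m)) (s, q) * f (s, q)| ≤ N) →
      ∀ t ∈ Ioo 0 τ, ∀ lam > 0, ∀ M ≥ 0,
      (∀ l, ∀ s ∈ Ioo 0 t, ∀ q, ‖q.2‖ ≤ R → |Tr τ (Lf E B l) (s, q) * f (s, q)| ≤ M * Real.exp (lam * s)) →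
      ∀ G ≥ 1, (∀ j, ∀ s ∈ Ioo 0 t, ∀ q, |dd τ f (0, (e3 j, 0)) (s, q)| ≤ G) →
      ∀ x i j, |dd τ (E i) (0, e3 j) (t, x)| ≤ C * (2 * N + M * (Real.exp (lam * t) / lam) + 2 * N * Real.log G) ∧
        |dd τ (B i) (0, e3 j) (t, x)| ≤ C * (2 * N + M * (Real.exp (lam * t) / lam) + 2 * N * Real.log G) := by
  choose C1 p1 h1 using fun i j => B1 hτ R (vv_smooth i) (cE_smooth i) j
  choose C2 p2 h2 using fun i j => B1 hτ R c00_smooth (cB_smooth i) j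
  have pp : ∀ i j, 0 ≤ C1 i j + C2 i j := fun i j => add_nonneg (p1 i j) (p2 i j)
  refine ⟨∑ i, ∑ j, (C1 i j + C2 i j), Finset.sum_nonneg fun i _ => Finset.sum_nonneg fun j _ => pp i j, ?_⟩
  intro f E B h N hN hE hB hf hf1 hL hLL hLd t ht lam hl M hM hT G hG hGf x i j
  have hs := h.sh x
  have z0 : (0 : ℝ) ∈ Ico 0 τ := ⟨le_rfl, hτ⟩
  have hX : 0 ≤ M * (Real.exp (lam * t) / lam) := by positivity
  have hY : 0 ≤ Real.log G := Real.log_nonneg hG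
  have a2 : ∀ r : ℝ, r ≤ N → r ≤ 2 * N := fun r hr => by linarith
  have ic : ∀ s ∈ Ioo 0 t, s ∈ Ico 0 τ := fun s hs => ⟨hs.1.le, hs.2.trans ht.2⟩
  have mk : ∀ (m : ℝ → ℝ) (K g : ℝ × PS → ℝ), (∀ p, K p = sh (x, 0) g p) →
      (∀ s ∈ Ioo 0 t, ∀ q, ‖q.2‖ ≤ R → |g (s, q) * f (s, q)| ≤ m s) →
      GB R t m (fun p => K p * sh (x, 0) f p) := fun m K g e b =>
    ⟨fun s hs z ξ _ hx => by simp only; rw [e]; exact b s hs ((z, ξ) + (x, 0)) (by simpa using hx),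
      fun s hs' z ξ hx => by simp only [hs.fR s (ic s hs') z ξ hx, mul_zero]⟩
  have dL : ∀ l, Lf (fun i => sh x (E i)) (fun i => sh x (B i)) l = sh (x, 0) (Lf E B l) := fun l =>
    funext fun p => Lf_sh x l p
  have bd : ∀ j, Bd τ R (sh (x, 0) f) (fun i => sh x (E i)) (fun i => sh x (B i)) j t (2 * N) M lam := fun j =>
    { f0 := fun q => a2 _ (hf 0 z0 _)
      f1 := fun q => by rw [dd_sh]; exact a2 _ (hf1 j _)
      L0 := fun l q => by rw [Lf_sh]; exact a2 _ (hL l 0 z0 _)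
      gf := ⟨fun s hs z ξ _ _ => a2 _ (hf s (ic s hs) _), fun s hs' z ξ hx => hs.fR s (ic s hs') z ξ hx⟩
      gL := fun l => mk _ _ _ (Lf_sh x l) fun s hs q _ => a2 _ (hL l s (ic s hs) q)
      gLL := fun l m => mk _ _ (fun p => Lf E B m p * Lf E B l p) (fun p => by simp only [Lf_sh]; rfl)
        fun s hs q _ => a2 _ (hLL l m s (ic s hs) q)
      gLd := fun l m => mk _ _ (fun p => Lf E B m p * dd τ (Lf E B l) (0, (0, e3 m)) p)
        (fun p => by rw [dL, dL, dd_sh]; rfl) fun s hs q hq => a2 _ (hLd l m s (ic s hs) q hq)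
      gT := fun l => mk _ _ (Tr τ (Lf E B l)) (fun p => by rw [dL]; exact Tr_sh _ rfl _ p)
        fun s hs q hq => hT l s hs q hq }
  have gG : ∀ j, GB R t (fun _ => G) (dd τ (sh (x, 0) f) (0, (e3 j, 0))) := fun j =>
    ⟨fun s hs z ξ _ _ => by rw [dd_sh]; exact hGf j s hs _, fun s hs' z ξ hx => by
      rw [dd_z hs.hf (ic s hs')]
      have : (fun q => sh (x, 0) f (s, q)) =ᶠ[𝓝 (z, ξ)] fun _ => 0 := by
        have ho : IsOpen {q : PS | R < ‖q.2‖} := isOpen_lt continuous_const (by fun_prop)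
        filter_upwards [ho.mem_nhds hx] with q hq
        exact hs.fR s (ic s hs') q.1 q.2 hq
      rw [this.fderiv_eq]; simp⟩
  have hle : C1 i j ≤ ∑ i, ∑ j, (C1 i j + C2 i j) ∧ C2 i j ≤ ∑ i, ∑ j, (C1 i j + C2 i j) := by
    have := Finset.single_le_sum (f := fun j => C1 i j + C2 i j) (fun j _ => pp i j) (Finset.mem_univ j)
    have := Finset.single_le_sum (f := fun i => ∑ j, (C1 i j + C2 i j))
      (fun i _ => Finset.sum_nonneg fun j _ => pp i j) (Finset.mem_univ i)
    constructor <;> linarith [p1 i j, p2 i j]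
  have hN0 : 0 ≤ 2 * N * Real.log G := by positivity
  constructor
  · have hu := (hE i).sh x
    have v1 := (hB (i + 2)).sh x
    have v2 := (hB (i + 1)).sh x
    have := h1 i j _ _ _ _ _ hs (hs.cmpE i) t ht (2 * N) (by linarith) ((v1.c1 _).sub (v2.c1 _)) (hu.c1 j)
      (fun z => a2 _ (hu.b1 j z)) (fun k z => a2 _ (hu.b2 k j z)) (fun z => curl_b2 v1 v2 _ _ _ z)
      lam hl M hM (bd j) G hG (gG j)
    simp only [dd_sh, zero_add] at this
    exact this.trans (mul_le_mul_of_nonneg_right hle.1 (by positivity))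
  · have hu := (hB i).sh x
    have v1 := (hE (i + 2)).sh x
    have v2 := (hE (i + 1)).sh x
    have := h2 i j _ _ _ _ _ hs (hs.cmpB i) t ht (2 * N) (by linarith) ((v1.c1 _).sub (v2.c1 _)).neg (hu.c1 j)
      (fun z => a2 _ (hu.b1 j z)) (fun k z => a2 _ (hu.b2 k j z))
      (fun z => by
        rw [fderiv_fun_neg]
        simp only [ContinuousLinearMap.neg_apply, abs_neg]
        exact curl_b2 v1 v2 _ _ _ z)
      lam hl M hM (bd j) G hG (gG j)
    simp only [dd_sh, zero_add] at this
    exact this.trans (mul_le_mul_of_nonneg_right hle.2 (by positivity))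

end

lemma mxp {V : Type*} [NormedAddCommGroup V] [NormedSpace ℝ V] {Ψ : ℝ × V → ℝ} {D : Set (ℝ × V)}
    (hD : IsCompact D) (hc : ContinuousOn Ψ D) {T : ℝ} (hT : ∀ p ∈ D, p.1 ∈ Icc 0 T)
    (hw : ∀ p ∈ D, 0 < p.1 → ∃ (w : V) (d : ℝ), (∀ᶠ h in 𝓝[>] (0 : ℝ), (p.1 - h, p.2 - h • w) ∈ D) ∧
      HasDerivAt (fun h : ℝ => Ψ (p.1 - h, p.2 - h • w)) d 0 ∧ 0 ≤ d)
    {c : ℝ} (h0 : ∀ p ∈ D, p.1 = 0 → Ψ p ≤ c) : ∀ p ∈ D, Ψ p ≤ c := by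
  intro p hp
  have key : ∀ ε > 0, Ψ p ≤ c + ε * T := by
    intro ε hε
    obtain ⟨q, hq, hm⟩ := hD.exists_isMaxOn ⟨p, hp⟩
      (hc.sub (f := Ψ) (g := fun q : ℝ × V => ε * q.1) (by fun_prop))
    have hqp := hm hp
    simp only [mem_setOf_eq, Pi.sub_apply] at hqp
    have e1 : ε * p.1 ≤ ε * T := mul_le_mul_of_nonneg_left (hT p hp).2 hε.le
    rcases (hT q hq).1.eq_or_lt with h | h
    · have := h0 q hq h.symm
      rw [← h] at hqp
      linarith
    · exfalso
      obtain ⟨w, d, h1, h2, h3⟩ := hw q hq h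
      have h4 : HasDerivAt (fun h : ℝ => Ψ (q.1 - h, q.2 - h • w) - ε * (q.1 - h)) (d - ε * (0 - 1)) 0 :=
        h2.sub (((hasDerivAt_const (0:ℝ) q.1).sub (hasDerivAt_id 0)).const_mul ε)
      have h5 := (hasDerivWithinAt_iff_tendsto_slope' (s := Ioi (0:ℝ)) (by simp)).1 h4.hasDerivWithinAt
      have h6 := h5.eventually (lt_mem_nhds (show (0:ℝ) < _ by linarith))
      obtain ⟨h, a1, a2, a3⟩ := (h1.and (h6.and self_mem_nhdsWithin)).exists
      have a4 := hm a1
      simp only [mem_setOf_eq, Pi.sub_apply] at a4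
      rw [slope_def_field] at a2
      simp only [sub_zero, zero_smul] at a2
      have a5 := (div_pos_iff_of_pos_right a3).1 a2
      linarith
  have hTn : 0 ≤ T := (hT p hp).1.trans (hT p hp).2
  refine le_of_forall_pos_le_add fun ε hε => (key (ε / (T + 1)) (by positivity)).trans ?_
  gcongr
  rw [div_mul_eq_mul_div, div_le_iff₀ (by positivity)]
  nlinarith

lemma nsum (x : E3) : ‖x‖ ≤ ∑ i, |x i| := by
  rw [EuclideanSpace.norm_eq, Real.sqrt_le_left (Finset.sum_nonneg fun i _ => abs_nonneg _)]
  simp only [Fin.sum_univ_three, Real.norm_eq_abs]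
  nlinarith [abs_nonneg (x 0), abs_nonneg (x 1), abs_nonneg (x 2), mul_nonneg (abs_nonneg (x 0)) (abs_nonneg (x 1)),
    mul_nonneg (abs_nonneg (x 0)) (abs_nonneg (x 2)), mul_nonneg (abs_nonneg (x 1)) (abs_nonneg (x 2))]

lemma nsum' {x : E3} {c : ℝ} (h : ∀ i, |x i| ≤ c) : ‖x‖ ≤ 3 * c := by
  have := nsum x
  rw [Fin.sum_univ_three] at this
  linarith [h 0, h 1, h 2]

lemma dec (x : E3) : x = ∑ i, x i • e3 i := by
  ext j
  fin_cases j <;> simp [Fin.sum_univ_three, e3]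

lemma dd_dec {τ : ℝ} {f : ℝ × PS → ℝ} (p : ℝ × PS) (x y : E3) : dd τ f (1, (x, y)) p = dd τ f (1, 0) p
    + ∑ j, x j * dd τ f (0, (e3 j, 0)) p + ∑ l, y l * dd τ f (0, (0, e3 l)) p := by
  have e : ((1 : ℝ), (x, y)) = (1, 0) + ∑ j, x j • (0, (e3 j, 0)) + ∑ j, y j • ((0 : ℝ), ((0 : E3), e3 j)) := by
    ext1
    · simp [Fin.sum_univ_three]
    · ext1
      · simp only [Prod.snd_add, Prod.fst_add, Prod.snd_sum, Prod.fst_sum, Prod.smul_snd, Prod.smul_fst]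
        simpa using dec x
      · simp only [Prod.snd_add, Prod.fst_add, Prod.snd_sum, Prod.fst_sum, Prod.smul_snd, Prod.smul_fst]
        simpa using dec y
  unfold dd
  rw [e]
  simp only [map_add, map_sum, map_smul, smul_eq_mul]

def Lv (E B : Fin 3 → ℝ × E3 → ℝ) (p : ℝ × PS) : E3 := WithLp.toLp 2 fun l => Lf E B l p

def Wd (E B : Fin 3 → ℝ × E3 → ℝ) (p : ℝ × PS) : PS := (vrel p.2.2, Lv E B p)

lemma lf_abs {E B : Fin 3 → ℝ × E3 → ℝ} {p : ℝ × PS} {m : ℝ} (hE : ∀ i, |E i (pz p)| ≤ m) (hB : ∀ i, |B i (pz p)| ≤ m)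
    (l : Fin 3) : |Lf E B l p| ≤ 3 * m := by
  have a : ∀ i j, |vv i p.2.2 * B j (pz p)| ≤ m := fun i j => by
    rw [abs_mul]; nlinarith [vv_abs i p.2.2, abs_nonneg (B j (pz p)), hB j, abs_nonneg (vv i p.2.2)]
  unfold Lf
  linarith [abs_add_le (E l (pz p)) (vv (l + 1) p.2.2 * B (l + 2) (pz p) - vv (l + 2) p.2.2 * B (l + 1) (pz p)),
    abs_sub (vv (l + 1) p.2.2 * B (l + 2) (pz p)) (vv (l + 2) p.2.2 * B (l + 1) (pz p)), a (l + 1) (l + 2), a (l + 2) (l + 1), hE l]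

section
variable {τ : ℝ} {f : ℝ × PS → ℝ} {E B : Fin 3 → ℝ × E3 → ℝ}

lemma dd_curve (hf : ContDiffOn ℝ 1 f (Sl PS τ))
    (vl : ∀ p ∈ Ioo 0 τ ×ˢ (univ : Set PS), dd τ f (1, 0) p
    + ∑ j, vv j p.2.2 * dd τ f (0, (e3 j, 0)) p + ∑ l, Lf E B l p * dd τ f (0, (0, e3 l)) p = 0)
    {s : ℝ} (hs : s ∈ Ioo 0 τ) (z : PS) :
    HasDerivAt (fun h : ℝ => f (s - h, z - h • Wd E B (s, z))) 0 0 := by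
  have h1 := dd_hasD hf hs z
  have h2 : HasDerivAt (fun h : ℝ => (s - h, z - h • Wd E B (s, z))) (-(1 : ℝ), -Wd E B (s, z)) 0 := by
    have a := (hasDerivAt_const (0:ℝ) s).sub (hasDerivAt_id 0)
    have b := (hasDerivAt_const (0:ℝ) z).sub ((hasDerivAt_id (0:ℝ)).smul_const (Wd E B (s, z)))
    have := a.prodMk b
    simpa using this
  have h3 : HasFDerivAt f (fderivWithin ℝ f (Sl PS τ) (s, z)) (s - 0, z - (0:ℝ) • Wd E B (s, z)) := by simpa using h1
  have h4 := h3.comp_hasDerivAt (0:ℝ) h2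
  have h5 : (fderivWithin ℝ f (Sl PS τ) (s, z)) (-(1 : ℝ), -Wd E B (s, z)) = 0 := by
    have e : (-(1 : ℝ), -Wd E B (s, z)) = -((1 : ℝ), Wd E B (s, z)) := rfl
    rw [e, map_neg]
    have := (dd_dec (τ := τ) (f := f) (s, z) (vrel z.2) (Lv E B (s, z))).trans (vl (s, z) ⟨hs, mem_univ _⟩)
    exact neg_eq_zero.2 this
  rw [h5] at h4
  exact h4

lemma U1 (hf : ContDiffOn ℝ 1 f (Sl PS τ))
    (vl : ∀ p ∈ Ioo 0 τ ×ˢ (univ : Set PS), dd τ f (1, 0) p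
    + ∑ j, vv j p.2.2 * dd τ f (0, (e3 j, 0)) p + ∑ l, Lf E B l p * dd τ f (0, (0, e3 l)) p = 0)
    {t : ℝ} (ht : t ∈ Ico 0 τ) (x ξ : E3) {m c : ℝ}
    (hE : ∀ i, ∀ s ∈ Icc 0 t, ∀ y, ‖y - x‖ ≤ t → |E i (s, y)| ≤ m)
    (hB : ∀ i, ∀ s ∈ Icc 0 t, ∀ y, ‖y - x‖ ≤ t → |B i (s, y)| ≤ m)
    (h0 : ∀ y η, ‖y - x‖ ≤ t → ‖η - ξ‖ ≤ 9 * m * t → |f (0, (y, η))| ≤ c) : |f (t, (x, ξ))| ≤ c := by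
  have hm : 0 ≤ m := (abs_nonneg _).trans (hE 0 0 ⟨le_rfl, ht.1⟩ x (by simpa using ht.1))
  set D : Set (ℝ × PS) := {p | p.1 ∈ Icc 0 t ∧ ‖p.2.1 - x‖ ≤ t - p.1 ∧ ‖p.2.2 - ξ‖ ≤ 9 * m * (t - p.1)} with hDd
  have hcl : IsClosed D := by
    simp only [hDd, setOf_and]
    exact (isClosed_Icc.preimage continuous_fst).inter ((isClosed_le (by fun_prop) (by fun_prop)).inter
      (isClosed_le (by fun_prop) (by fun_prop)))
  have hDc : IsCompact D := by
    refine ((isCompact_Icc (a := (0:ℝ)) (b := t)).prod ((isCompact_closedBall x t).prod (isCompact_closedBall ξ (9 * m * t)))).of_isClosed_subset hcl ?_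
    rintro p ⟨h1, h2, h3⟩
    refine ⟨h1, ?_, ?_⟩ <;> rw [mem_closedBall, dist_eq_norm]
    · linarith [h1.1]
    · nlinarith [h1.1, mul_nonneg hm h1.1]
  have hsub : D ⊆ Sl PS τ := fun p hp => ⟨⟨hp.1.1, hp.1.2.trans_lt ht.2⟩, mem_univ _⟩
  have hpt : (t, (x, ξ)) ∈ D := ⟨⟨ht.1, le_rfl⟩, by simp, by simp⟩
  have mv : ∀ p ∈ D, 0 < p.1 → ∀ᶠ h in 𝓝[>] (0 : ℝ), (p.1 - h, p.2 - h • Wd E B p) ∈ D := by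
    rintro p ⟨h1, h2, h3⟩ hp
    filter_upwards [Ioo_mem_nhdsGT hp] with h hh
    have e1 : ‖Lv E B p‖ ≤ 9 * m := by
      have hy : ‖p.2.1 - x‖ ≤ t := by linarith [h1.1]
      have := nsum' (x := Lv E B p) (lf_abs (fun i => hE i p.1 h1 p.2.1 hy) (fun i => hB i p.1 h1 p.2.1 hy))
      linarith
    refine ⟨⟨by linarith [hh.2], by linarith [hh.1, h1.2]⟩, ?_, ?_⟩
    · have : p.2.1 - h • vrel p.2.2 - x = (p.2.1 - x) - h • vrel p.2.2 := by abel
      change ‖p.2.1 - h • vrel p.2.2 - x‖ ≤ t - (p.1 - h)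
      rw [this]
      refine (norm_sub_le _ _).trans ?_
      rw [norm_smul, Real.norm_of_nonneg hh.1.le]
      nlinarith [vrel_norm p.2.2, hh.1]
    · have : p.2.2 - h • Lv E B p - ξ = (p.2.2 - ξ) - h • Lv E B p := by abel
      change ‖p.2.2 - h • Lv E B p - ξ‖ ≤ 9 * m * (t - (p.1 - h))
      rw [this]
      refine (norm_sub_le _ _).trans ?_
      rw [norm_smul, Real.norm_of_nonneg hh.1.le]
      nlinarith [hh.1]
  have dv : ∀ p ∈ D, 0 < p.1 → HasDerivAt (fun h : ℝ => f (p.1 - h, p.2 - h • Wd E B p)) 0 0 := fun p hp h =>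
    dd_curve hf vl ⟨h, (hsub hp).1.2⟩ p.2
  have hfc := hf.continuousOn.mono hsub
  have ini : ∀ p ∈ D, p.1 = 0 → |f p| ≤ c := by
    rintro ⟨s, y, η⟩ ⟨h1, h2, h3⟩ h
    simp only at h h2 h3
    subst h
    exact h0 y η (by simpa using h2) (by simpa using h3)
  rw [abs_le']
  constructor
  · exact mxp hDc hfc (fun p hp => hp.1) (fun p hp h => ⟨_, 0, mv p hp h, dv p hp h, le_rfl⟩)
      (fun p hp h => (abs_le'.1 (ini p hp h)).1) _ hpt
  · exact mxp (Ψ := fun p => -f p) hDc hfc.neg (fun p hp => hp.1)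
      (fun p hp h => ⟨_, 0, mv p hp h, by simpa using (dv p hp h).fun_neg, le_rfl⟩)
      (fun p hp h => (abs_le'.1 (ini p hp h)).2) _ hpt

lemma U2 (hf : ContDiffOn ℝ 1 f (Sl PS τ))
    (vl : ∀ p ∈ Ioo 0 τ ×ˢ (univ : Set PS), dd τ f (1, 0) p
    + ∑ j, vv j p.2.2 * dd τ f (0, (e3 j, 0)) p + ∑ l, Lf E B l p * dd τ f (0, (0, e3 l)) p = 0)
    {T : ℝ} (hT : T ∈ Ico 0 τ) {r m : ℝ}
    (hL : ∀ s ∈ Icc 0 T, ∀ z, ‖Lv E B (s, z)‖ ≤ m)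
    {G G' A : ℝ → ℝ} (hG : ∀ s, HasDerivAt G (G' s) s) (hG0 : ∀ s, 0 ≤ G s)
    (hA : ∀ s ∈ Ioc 0 T, ∀ z z' : PS, ‖z.1‖ ≤ r + T → ‖z'.1‖ ≤ r + T →
      |⟪z.1 - z'.1, vrel z.2 - vrel z'.2⟫ + ⟪z.2 - z'.2, Lv E B (s, z) - Lv E B (s, z')⟫| ≤
        A s * (‖z.1 - z'.1‖ ^ 2 + ‖z.2 - z'.2‖ ^ 2))
    (hGA : ∀ s ∈ Ioc 0 T, 2 * A s * G s ≤ G' s) (hGn : ∀ s ∈ Ioc 0 T, 0 ≤ G' s)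
    (h0 : ∀ z z', f (0, z) - f (0, z') ≤ G 0 * ‖z - z'‖) (z z' : PS) (hz : ‖z.1‖ ≤ r) (hz' : ‖z'.1‖ ≤ r) :
    f (T, z) - f (T, z') ≤ 2 * G T * ‖z - z'‖ := by
  by_cases hzz : z = z'
  · subst hzz; simp
  have hδ : 0 < ‖z - z'‖ := norm_pos_iff.2 (sub_ne_zero.2 hzz)
  set δ := ‖z - z'‖ with hδd
  have hm : 0 ≤ m := (norm_nonneg _).trans (hL 0 ⟨le_rfl, hT.1⟩ z)
  set ρ := max ‖z.2‖ ‖z'.2‖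
  let Q : PS × PS → ℝ := fun y => ‖y.1.1 - y.2.1‖ ^ 2 + ‖y.1.2 - y.2.2‖ ^ 2
  let Ψ : ℝ × (PS × PS) → ℝ := fun p => f (p.1, p.2.1) - f (p.1, p.2.2) - G p.1 * (δ / 2 + Q p.2 / (2 * δ))
  let S : ℝ → Set PS := fun s => {y | ‖y.1‖ ≤ r + (T - s) ∧ ‖y.2‖ ≤ ρ + m * (T - s)}
  set D : Set (ℝ × (PS × PS)) := {p | p.1 ∈ Icc 0 T ∧ p.2.1 ∈ S p.1 ∧ p.2.2 ∈ S p.1} with hDd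
  have hcl : IsClosed D := by
    simp only [hDd, S, mem_setOf_eq, setOf_and]
    exact (isClosed_Icc.preimage continuous_fst).inter
      (((isClosed_le (by fun_prop) (by fun_prop)).inter (isClosed_le (by fun_prop) (by fun_prop))).inter
        ((isClosed_le (by fun_prop) (by fun_prop)).inter (isClosed_le (by fun_prop) (by fun_prop))))
  have sm : ∀ s ∈ Icc 0 T, S s ⊆ closedBall (0 : E3) (r + T) ×ˢ closedBall (0 : E3) (ρ + m * T) := by
    rintro s h1 y ⟨h2, h3⟩
    refine ⟨?_, ?_⟩ <;> rw [mem_closedBall, dist_zero_right]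
    · linarith [h1.1]
    · nlinarith [h1.1, mul_nonneg hm h1.1]
  have hDc : IsCompact D := by
    have hb := (isCompact_closedBall (0 : E3) (r + T)).prod (isCompact_closedBall (0 : E3) (ρ + m * T))
    exact ((isCompact_Icc (a := (0:ℝ)) (b := T)).prod (hb.prod hb)).of_isClosed_subset hcl
      fun p hp => ⟨hp.1, sm _ hp.1 hp.2.1, sm _ hp.1 hp.2.2⟩
  have ic : ∀ p ∈ D, p.1 ∈ Ico 0 τ := fun p hp => ⟨hp.1.1, hp.1.2.trans_lt hT.2⟩
  have Gc : Continuous G := continuous_iff_continuousAt.2 fun s => (hG s).continuousAt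
  have hΨ : ContinuousOn Ψ D := by
    have c1 : ContinuousOn (fun p : ℝ × (PS × PS) => f (p.1, p.2.1)) D :=
      hf.continuousOn.comp (f := fun p : ℝ × (PS × PS) => (p.1, p.2.1)) (by fun_prop) fun p hp => ⟨ic p hp, mem_univ _⟩
    have c2 : ContinuousOn (fun p : ℝ × (PS × PS) => f (p.1, p.2.2)) D :=
      hf.continuousOn.comp (f := fun p : ℝ × (PS × PS) => (p.1, p.2.2)) (by fun_prop) fun p hp => ⟨ic p hp, mem_univ _⟩
    refine (c1.sub c2).sub (Continuous.continuousOn ?_)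
    simp only [Q]; fun_prop
  have mvS : ∀ s, ∀ y ∈ S s, s ∈ Icc 0 T → ∀ h > 0, y - h • Wd E B (s, y) ∈ S (s - h) := by
    rintro s y ⟨h2, h3⟩ hs h hh
    refine ⟨?_, ?_⟩
    · change ‖y.1 - h • vrel y.2‖ ≤ _
      refine (norm_sub_le _ _).trans ?_
      rw [norm_smul, Real.norm_of_nonneg hh.le]
      nlinarith [vrel_norm y.2]
    · change ‖y.2 - h • Lv E B (s, y)‖ ≤ _
      refine (norm_sub_le _ _).trans ?_
      rw [norm_smul, Real.norm_of_nonneg hh.le]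
      nlinarith [hL s hs y]
  have QL : ∀ y : PS × PS, ‖y.1 - y.2‖ ^ 2 ≤ Q y ∧ Q y ≤ 2 * ‖y.1 - y.2‖ ^ 2 := by
    intro y
    have a := norm_fst_le (y.1 - y.2)
    have b := norm_snd_le (y.1 - y.2)
    constructor
    · rw [Prod.norm_def]
      rcases max_choice ‖(y.1 - y.2).1‖ ‖(y.1 - y.2).2‖ with h | h <;> rw [h]
      · exact le_add_of_nonneg_right (sq_nonneg _)
      · exact le_add_of_nonneg_left (sq_nonneg _)
    · have a2 := pow_le_pow_left₀ (norm_nonneg _) a 2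
      have b2 := pow_le_pow_left₀ (norm_nonneg _) b 2
      simp only [Prod.fst_sub, Prod.snd_sub] at a2 b2
      simp only [Q]; linarith
  have main := mxp (c := 0) hDc hΨ (fun p hp => hp.1) (fun p hp h => by
    obtain ⟨s, y, y'⟩ := p
    have hs : s ∈ Ioo 0 τ := ⟨h, (ic _ hp).2⟩
    have hs2 : s ∈ Ioc 0 T := ⟨h, hp.1.2⟩
    set W := Wd E B (s, y) with hW
    set W' := Wd E B (s, y') with hW'
    have q1 : HasDerivAt (fun h : ℝ => ‖(y.1 - h • W.1) - (y'.1 - h • W'.1)‖ ^ 2) (2 * ⟪y.1 - y'.1, -(W.1 - W'.1)⟫) 0 := by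
      have a := ((hasDerivAt_const (0:ℝ) y.1).sub ((hasDerivAt_id (0:ℝ)).smul_const W.1)).sub
        ((hasDerivAt_const (0:ℝ) y'.1).sub ((hasDerivAt_id (0:ℝ)).smul_const W'.1))
      have := a.norm_sq
      simpa [sub_eq_add_neg, add_comm] using this
    have q2 : HasDerivAt (fun h : ℝ => ‖(y.2 - h • W.2) - (y'.2 - h • W'.2)‖ ^ 2) (2 * ⟪y.2 - y'.2, -(W.2 - W'.2)⟫) 0 := by
      have a := ((hasDerivAt_const (0:ℝ) y.2).sub ((hasDerivAt_id (0:ℝ)).smul_const W.2)).sub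
        ((hasDerivAt_const (0:ℝ) y'.2).sub ((hasDerivAt_id (0:ℝ)).smul_const W'.2))
      have := a.norm_sq
      simpa [sub_eq_add_neg, add_comm] using this
    have g1 : HasDerivAt (fun h : ℝ => G (s - h)) (-(G' s)) 0 := by
      have a := (hasDerivAt_const (0:ℝ) s).sub (hasDerivAt_id (0:ℝ))
      have b : HasDerivAt G (G' s) (s - 0) := by simpa using hG s
      have := b.comp (0:ℝ) a
      simpa [Function.comp_def] using this
    have tot := ((dd_curve hf vl hs y).sub (dd_curve hf vl hs y')).sub
      (g1.mul (((q1.add q2).div_const (2 * δ)).const_add (δ / 2)))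
    refine ⟨(W, W'), _, ?_, tot, ?_⟩
    · filter_upwards [Ioo_mem_nhdsGT h] with k hk
      exact ⟨⟨sub_nonneg.2 hk.2.le, (sub_le_self _ hk.1.le).trans hp.1.2⟩, mvS s y hp.2.1 hp.1 k hk.1,
        mvS s y' hp.2.2 hp.1 k hk.1⟩
    · have b1 : ‖y.1‖ ≤ r + T := (hp.2.1.1).trans (by linarith [h.le])
      have b2 : ‖y'.1‖ ≤ r + T := (hp.2.2.1).trans (by linarith [h.le])
      have ha := hA s hs2 y y' b1 b2
      have hg := hGA s hs2
      have hgn := hGn s hs2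
      have hgg := hG0 s
      simp only [Pi.add_apply, zero_smul, sub_zero, inner_neg_right]
      set X := ⟪y.1 - y'.1, W.1 - W'.1⟫ with hX
      set Y := ⟪y.2 - y'.2, W.2 - W'.2⟫ with hY
      set q := ‖y.1 - y'.1‖ ^ 2 + ‖y.2 - y'.2‖ ^ 2 with hq
      have hqn : 0 ≤ q := by positivity
      have ha2 : |X + Y| ≤ A s * q := ha
      have ha3 := neg_le_of_abs_le ha2
      have k1 : 0 ≤ G' s * q + G s * (2 * (X + Y)) := by nlinarith
      have k2 : 0 ≤ G' s * (δ / 2) := by positivity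
      have k3 : 0 ≤ (G' s * q + G s * (2 * (X + Y))) / (2 * δ) := by positivity
      refine (add_nonneg k2 k3).trans (le_of_eq ?_)
      field_simp
      ring)
    (by
      rintro ⟨s, y, y'⟩ hp h
      simp only at h
      subst h
      have a := h0 y y'
      have q := (QL (y, y')).1
      simp only at q
      have b : ‖y - y'‖ ≤ δ / 2 + Q (y, y') / (2 * δ) := by
        rw [div_add_div _ _ (by positivity) (by positivity), le_div_iff₀ (by positivity)]
        nlinarith [sq_nonneg (‖y - y'‖ - δ)]
      have c := mul_le_mul_of_nonneg_left b (hG0 0)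
      simp only [Ψ]; linarith) (T, (z, z'))
    ⟨⟨hT.1, le_rfl⟩, ⟨by simpa using hz, by simp [ρ]⟩, ⟨by simpa using hz', by simp [ρ]⟩⟩
  simp only [Ψ] at main
  have q := (QL (z, z')).2
  simp only [← hδd] at q
  have b : δ / 2 + Q (z, z') / (2 * δ) ≤ 2 * δ := by
    rw [div_add_div _ _ (by positivity) (by positivity), div_le_iff₀ (by positivity)]
    nlinarith
  have c := mul_le_mul_of_nonneg_left b (hG0 T)
  linarith

lemma clo {φ : ℝ × E3 → ℝ} (hφ : ContinuousOn φ (Sl E3 τ)) {K : Set E3} (hK : IsCompact K) {lam a : ℝ}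
    (hl : 0 < lam) (ha : 0 ≤ a)
    (h : ∀ T ∈ Ioo 0 τ, ∀ M ≥ 0, (∀ s ∈ Icc 0 T, ∀ x ∈ K, φ (s, x) ≤ M * Real.exp (lam * s)) →
      ∀ t ∈ Icc 0 T, ∀ x, φ (t, x) ≤ (a + M / 2) * Real.exp (lam * t)) :
    ∀ t ∈ Ico 0 τ, ∀ x, φ (t, x) ≤ 2 * a * Real.exp (lam * τ) := by
  have key : ∀ T ∈ Ioo 0 τ, ∀ t ∈ Icc 0 T, ∀ x, φ (t, x) ≤ 2 * a * Real.exp (lam * τ) := by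
    intro T hT t ht x
    have ex : ∀ M : ℝ, M ≤ 2 * a → 0 ≤ M → (∀ s ∈ Icc 0 T, ∀ x ∈ K, φ (s, x) ≤ M * Real.exp (lam * s)) →
        φ (t, x) ≤ 2 * a * Real.exp (lam * τ) := by
      intro M h1 h2 h3
      refine (h T hT M h2 h3 t ht x).trans ?_
      have : Real.exp (lam * t) ≤ Real.exp (lam * τ) :=
        Real.exp_le_exp.2 (mul_le_mul_of_nonneg_left (ht.2.trans hT.2.le) hl.le)
      exact mul_le_mul (by linarith) this (Real.exp_pos _).le (by linarith)
    rcases K.eq_empty_or_nonempty with hK0 | hK0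
    · exact ex 0 (by linarith) le_rfl (by simp [hK0])
    · have hc : ContinuousOn (fun p : ℝ × E3 => φ p * Real.exp (-(lam * p.1))) (Icc 0 T ×ˢ K) :=
        (hφ.mono fun p hp => ⟨⟨hp.1.1, hp.1.2.trans_lt hT.2⟩, mem_univ _⟩).mul (by fun_prop)
      obtain ⟨q, hq, hm⟩ := (isCompact_Icc.prod hK).exists_isMaxOn
        ((nonempty_Icc.2 hT.1.le).prod hK0) hc
      set M := max 0 (φ q * Real.exp (-(lam * q.1)))
      have hM : ∀ s ∈ Icc 0 T, ∀ x ∈ K, φ (s, x) ≤ M * Real.exp (lam * s) := by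
        intro s hs x hx
        have h1 : φ (s, x) * Real.exp (-(lam * s)) ≤ M := (hm ⟨hs, hx⟩).trans (le_max_right _ _)
        rw [Real.exp_neg] at h1
        rwa [mul_inv_le_iff₀ (Real.exp_pos _)] at h1
      refine ex M ?_ (le_max_left _ _) hM
      have h2 := h T hT M (le_max_left _ _) hM q.1 hq.1 q.2
      have h3 : φ q * Real.exp (-(lam * q.1)) ≤ a + M / 2 := by
        rw [Real.exp_neg, mul_inv_le_iff₀ (Real.exp_pos _)]; exact h2
      have h4 : M ≤ max 0 (a + M / 2) := max_le_max le_rfl h3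
      have h5 : 0 ≤ M := le_max_left _ _
      rw [max_eq_right (by positivity)] at h4
      linarith
  intro t ht x
  have := ht.1
  exact key ((t + τ) / 2) ⟨by linarith [ht.2], by linarith [ht.2]⟩ t ⟨ht.1, by linarith [ht.2]⟩ x

end

lemma op3 {L : E3 →L[ℝ] ℝ} {D : ℝ} (h : ∀ j, |L (e3 j)| ≤ D) : ‖L‖ ≤ 3 * D := by
  have hD : 0 ≤ D := (abs_nonneg _).trans (h 0)
  refine L.opNorm_le_bound (by positivity) fun v => ?_
  conv_lhs => rw [dec v]
  rw [map_sum, Fin.sum_univ_three]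
  have a : ∀ j, ‖L (v j • e3 j)‖ ≤ D * ‖v‖ := fun j => by
    rw [map_smul, norm_smul, mul_comm]
    exact mul_le_mul (h j) (PiLp.norm_apply_le v j) (norm_nonneg _) hD
  refine norm_add₃_le.trans ?_
  linarith [a 0, a 1, a 2]

lemma lip3 {u : E3 → ℝ} (hu : Differentiable ℝ u) {S : Set E3} (hS : Convex ℝ S) {D : ℝ}
    (h : ∀ x ∈ S, ∀ j, |fderiv ℝ u x (e3 j)| ≤ D) {x y : E3} (hx : x ∈ S) (hy : y ∈ S) :
    |u x - u y| ≤ 3 * D * ‖x - y‖ :=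
  hS.norm_image_sub_le_of_norm_fderiv_le (𝕜 := ℝ) (fun x _ => hu x) (fun x hx => op3 (h x hx)) hy hx

lemma vv_pdd (i l : Fin 3) (ξ : E3) : |pdd (e3 l) (vv i) ξ| ≤ 2 := by
  have e : (Real.sqrt (1 + ‖ξ‖ ^ 2))⁻¹ ^ 3 * (ξ i * ξ l) = (Real.sqrt (1 + ‖ξ‖ ^ 2))⁻¹ * (vv i ξ * vv l ξ) := by
    rw [vv_eq, vv_eq]; ring
  rw [vv_deriv, e]
  have g0 : 0 ≤ (Real.sqrt (1 + ‖ξ‖ ^ 2))⁻¹ := by positivity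
  have g1 : (Real.sqrt (1 + ‖ξ‖ ^ 2))⁻¹ ≤ 1 := by
    apply inv_le_one_of_one_le₀
    rw [Real.one_le_sqrt]; nlinarith [norm_nonneg ξ]
  set g := (Real.sqrt (1 + ‖ξ‖ ^ 2))⁻¹
  have a : |vv i ξ * vv l ξ| ≤ 1 := by
    rw [abs_mul]; exact mul_le_one₀ (vv_abs _ _) (abs_nonneg _) (vv_abs _ _)
  have b := abs_le.1 a
  split_ifs <;> rw [abs_le] <;> constructor <;> nlinarith

lemma vv_lip (i : Fin 3) (x y : E3) : |vv i x - vv i y| ≤ 6 * ‖x - y‖ := by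
  have := lip3 (sm1 (vv_smooth i)|>.differentiable one_ne_zero) convex_univ (fun x _ j => vv_pdd i j x) (mem_univ x) (mem_univ y)
  linarith

section
variable {τ R : ℝ} {f : ℝ × PS → ℝ} {E B : Fin 3 → ℝ × E3 → ℝ}

lemma ALip {s r N D : ℝ} (hN : ∀ i x, |E i (s, x)| ≤ N ∧ |B i (s, x)| ≤ N)
    (hD : ∀ i x y, ‖x‖ ≤ r → ‖y‖ ≤ r → |E i (s, x) - E i (s, y)| ≤ 3 * D * ‖x - y‖ ∧ |B i (s, x) - B i (s, y)| ≤ 3 * D * ‖x - y‖)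
    (hD0 : 0 ≤ D)
    (z z' : PS) (hz : ‖z.1‖ ≤ r) (hz' : ‖z'.1‖ ≤ r) :
    |⟪z.1 - z'.1, vrel z.2 - vrel z'.2⟫ + ⟪z.2 - z'.2, Lv E B (s, z) - Lv E B (s, z')⟫| ≤
        (18 + 36 * N + 27 * D) * (‖z.1 - z'.1‖ ^ 2 + ‖z.2 - z'.2‖ ^ 2) := by
  set a := ‖z.1 - z'.1‖ with ha
  set b := ‖z.2 - z'.2‖ with hb
  have a0 : 0 ≤ a := norm_nonneg _
  have b0 : 0 ≤ b := norm_nonneg _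
  have N0 : 0 ≤ N := (abs_nonneg _).trans (hN 0 0).1
  have h1 : ‖vrel z.2 - vrel z'.2‖ ≤ 3 * (6 * b) := nsum' fun i => vv_lip i z.2 z'.2
  have p : ∀ i j, |vv i z.2 * B j (s, z.1) - vv i z'.2 * B j (s, z'.1)| ≤ 3 * D * a + 6 * N * b := fun i j => by
    have e : vv i z.2 * B j (s, z.1) - vv i z'.2 * B j (s, z'.1) = vv i z.2 * (B j (s, z.1) - B j (s, z'.1))
      + (vv i z.2 - vv i z'.2) * B j (s, z'.1) := by ring
    rw [e]
    refine (abs_add_le _ _).trans ?_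
    rw [abs_mul, abs_mul]
    have k1 := mul_le_mul (vv_abs i z.2) (hD j _ _ hz hz').2 (abs_nonneg _) zero_le_one
    have k2 := mul_le_mul (vv_lip i z.2 z'.2) (hN j z'.1).2 (abs_nonneg _) (by positivity)
    linarith
  have h2 : ‖Lv E B (s, z) - Lv E B (s, z')‖ ≤ 3 * (9 * D * a + 12 * N * b) := nsum' fun l => by
    have e : (Lv E B (s, z) - Lv E B (s, z')) l = (E l (s, z.1) - E l (s, z'.1)) +
      ((vv (l + 1) z.2 * B (l + 2) (s, z.1) - vv (l + 1) z'.2 * B (l + 2) (s, z'.1)) -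
      (vv (l + 2) z.2 * B (l + 1) (s, z.1) - vv (l + 2) z'.2 * B (l + 1) (s, z'.1))) := by
      simp [Lv, Lf, pz]; ring
    rw [e]
    refine (abs_add_le _ _).trans ((add_le_add_right (abs_sub _ _) _).trans ?_)
    linarith [p (l + 1) (l + 2), p (l + 2) (l + 1), (hD l _ _ hz hz').1]
  refine (abs_add_le _ _).trans ?_
  have i1 := abs_real_inner_le_norm (z.1 - z'.1) (vrel z.2 - vrel z'.2)
  have i2 := abs_real_inner_le_norm (z.2 - z'.2) (Lv E B (s, z) - Lv E B (s, z'))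
  have j1 := mul_le_mul_of_nonneg_left h1 a0
  have j2 := mul_le_mul_of_nonneg_left h2 b0
  have ab : a * b ≤ a ^ 2 + b ^ 2 := by nlinarith [sq_nonneg (a - b)]
  have c1 := mul_le_mul_of_nonneg_left ab (show 0 ≤ 18 + 27 * D by positivity)
  have c2 : N * b ^ 2 ≤ N * (a ^ 2 + b ^ 2) := by nlinarith [sq_nonneg a]
  linarith

def Gf (A N M lam s : ℝ) : ℝ := A * Real.exp (2 * ((18 + 36 * N) * s + 27 * M * ((Real.exp (lam * s) - 1) / lam)))

structure Vd (τ R0 A : ℝ) (f : ℝ × PS → ℝ) (E B : Fin 3 → ℝ × E3 → ℝ) : Prop where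
  hf : ContDiffOn ℝ 1 f (Sl PS τ)
  hE : ∀ i, ContDiffOn ℝ 1 (E i) (Sl E3 τ)
  hB : ∀ i, ContDiffOn ℝ 1 (B i) (Sl E3 τ)
  vl : ∀ p ∈ Ioo 0 τ ×ˢ (univ : Set PS), dd τ f (1, 0) p
    + ∑ j, vv j p.2.2 * dd τ f (0, (e3 j, 0)) p + ∑ l, Lf E B l p * dd τ f (0, (0, e3 l)) p = 0
  hA : 1 ≤ A
  hR : 0 ≤ R0
  s0 : ∀ x ξ, R0 < ‖x‖ ∨ R0 < ‖ξ‖ → f (0, (x, ξ)) = 0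
  b0 : ∀ q, |f (0, q)| ≤ A
  l0 : ∀ z z', f (0, z) - f (0, z') ≤ A * ‖z - z'‖

lemma cptm (hE : ∀ i, ContDiffOn ℝ 1 (E i) (Sl E3 τ)) (t : ℝ) (ht : t < τ) (x : E3) (r : ℝ) :
    ∃ m, ∀ i, ∀ s ∈ Icc 0 t, ∀ y, ‖y - x‖ ≤ r → |E i (s, y)| ≤ m := by
  have : ∀ i, ∃ m, ∀ s ∈ Icc 0 t, ∀ y, ‖y - x‖ ≤ r → |E i (s, y)| ≤ m := fun i => by
    obtain ⟨m, hm⟩ := ((isCompact_Icc (a := (0:ℝ)) (b := t)).prod (isCompact_closedBall x r)).exists_bound_of_continuousOn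
      ((hE i).continuousOn.mono fun p hp => ⟨⟨hp.1.1, hp.1.2.trans_lt ht⟩, mem_univ _⟩)
    exact ⟨m, fun s hs y hy => hm (s, y) ⟨hs, by rwa [mem_closedBall, dist_eq_norm]⟩⟩
  choose m hm using this
  refine ⟨∑ i, |m i|, fun i s hs y hy => (hm i s hs y hy).trans ((le_abs_self _).trans ?_)⟩
  exact Finset.single_le_sum (f := fun i => |m i|) (fun i _ => abs_nonneg _) (Finset.mem_univ i)

lemma cptm2 (hE : ∀ i, ContDiffOn ℝ 1 (E i) (Sl E3 τ)) (hB : ∀ i, ContDiffOn ℝ 1 (B i) (Sl E3 τ)) (t : ℝ) (ht : t < τ)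
    (x : E3) (r : ℝ) : ∃ m, 0 ≤ m ∧ (∀ i, ∀ s ∈ Icc 0 t, ∀ y, ‖y - x‖ ≤ r → |E i (s, y)| ≤ m) ∧
      ∀ i, ∀ s ∈ Icc 0 t, ∀ y, ‖y - x‖ ≤ r → |B i (s, y)| ≤ m := by
  obtain ⟨m, h⟩ := cptm hE t ht x r
  obtain ⟨m', h'⟩ := cptm hB t ht x r
  exact ⟨max 0 (max m m'), le_max_left _ _,
    fun i s hs y hy => (h i s hs y hy).trans ((le_max_left _ _).trans (le_max_right _ _)),
    fun i s hs y hy => (h' i s hs y hy).trans ((le_max_right _ _).trans (le_max_right _ _))⟩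

variable {R0 A : ℝ}

lemma Vd.fb (h : Vd τ R0 A f E B) {t : ℝ} (ht : t ∈ Ico 0 τ) (q : PS) : |f (t, q)| ≤ A := by
  obtain ⟨m, -, h1, h2⟩ := cptm2 h.hE h.hB t ht.2 q.1 t
  exact U1 h.hf h.vl ht q.1 q.2 h1 h2 fun y η _ _ => h.b0 _

lemma Vd.fx (h : Vd τ R0 A f E B) {t : ℝ} (ht : t ∈ Ico 0 τ) (q : PS) (hq : R0 + t < ‖q.1‖) : f (t, q) = 0 := by
  obtain ⟨m, -, h1, h2⟩ := cptm2 h.hE h.hB t ht.2 q.1 t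
  refine abs_nonpos_iff.1 (U1 h.hf h.vl ht q.1 q.2 h1 h2 fun y η hy _ => ?_)
  rw [h.s0 y η (Or.inl _), abs_zero]
  have := norm_sub_norm_le q.1 y
  rw [norm_sub_rev] at hy
  linarith

lemma Vd.fxi (h : Vd τ R0 A f E B) {t : ℝ} (ht : t ∈ Ico 0 τ) :
    ∃ ρ, ∀ s ∈ Icc 0 t, ∀ x ξ, ρ < ‖ξ‖ → f (s, (x, ξ)) = 0 := by
  obtain ⟨m, hm, h1, h2⟩ := cptm2 h.hE h.hB t ht.2 0 (R0 + 2 * t)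
  refine ⟨R0 + 9 * m * t, fun s hs x ξ hξ => ?_⟩
  have hs' : s ∈ Ico 0 τ := ⟨hs.1, hs.2.trans_lt ht.2⟩
  by_cases hx : R0 + s < ‖x‖
  · exact h.fx hs' (x, ξ) hx
  have k : ∀ y, ‖y - x‖ ≤ s → ‖y - 0‖ ≤ R0 + 2 * t := fun y hy => by
    rw [sub_zero]; linarith [norm_sub_norm_le y x, hs.2]
  refine abs_nonpos_iff.1 (U1 h.hf h.vl hs' x ξ (fun i u hu y hy => h1 i u ⟨hu.1, hu.2.trans hs.2⟩ y (k y hy))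
    (fun i u hu y hy => h2 i u ⟨hu.1, hu.2.trans hs.2⟩ y (k y hy)) fun y η _ hη => ?_)
  rw [h.s0 y η (Or.inr _), abs_zero]
  have := norm_sub_norm_le ξ η
  rw [norm_sub_rev] at hη
  nlinarith [hs.2, hs.1]

lemma Vd.fd (h : Vd τ R0 A f E B) {N : ℝ} (hN : ∀ s ∈ Ico 0 τ, ∀ i x, |E i (s, x)| ≤ N ∧ |B i (s, x)| ≤ N)
    {T : ℝ} (hT : T ∈ Ico 0 τ) {M lam : ℝ} (hM : 0 ≤ M) (hl : 0 < lam)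
    (hD : ∀ s ∈ Icc 0 T, ∀ x, ‖x‖ ≤ R0 + 2 * τ + 1 → ∀ i j, |dd τ (E i) (0, e3 j) (s, x)| ≤ M * Real.exp (lam * s) ∧
      |dd τ (B i) (0, e3 j) (s, x)| ≤ M * Real.exp (lam * s)) (q : PS) :
    ‖fderiv ℝ (fun q => f (T, q)) q‖ ≤ 2 * Gf A N M lam T := by
  have hA := h.hA
  have N0 : 0 ≤ N := (abs_nonneg _).trans (hN T hT 0 0).1
  have Gn : ∀ s, 0 ≤ Gf A N M lam s := fun s => by unfold Gf; positivity
  by_cases hq : R0 + T < ‖q.1‖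
  · have : (fun q => f (T, q)) =ᶠ[𝓝 q] fun _ => 0 := by
      have ho : IsOpen {q : PS | R0 + T < ‖q.1‖} := isOpen_lt continuous_const (by fun_prop)
      filter_upwards [ho.mem_nhds hq] with y hy
      exact h.fx hT y hy
    rw [this.fderiv_eq]
    simpa using Gn T
  have hG : ∀ s, HasDerivAt (Gf A N M lam) (2 * (18 + 36 * N + 27 * (M * Real.exp (lam * s))) * Gf A N M lam s) s := fun s => by
    have e1 : HasDerivAt (fun s : ℝ => Real.exp (lam * s)) (Real.exp (lam * s) * (lam * 1)) s :=
      ((hasDerivAt_id s).const_mul lam).exp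
    have := (((((hasDerivAt_id s).const_mul (18 + 36 * N)).add
      (((e1.sub_const 1).div_const lam).const_mul (27 * M))).const_mul 2).exp).const_mul A
    refine this.congr_deriv ?_
    simp only [Gf, Pi.add_apply, id]
    field_simp
  have lip := U2 (r := R0 + τ + 1) (m := 9 * N) h.hf h.vl hT (fun s hs z => by
      have hs' : s ∈ Ico 0 τ := ⟨hs.1, hs.2.trans_lt hT.2⟩
      have := nsum' (x := Lv E B (s, z)) (lf_abs (fun i => (hN s hs' i z.1).1) (fun i => (hN s hs' i z.1).2))
      linarith) hG Gn (A := fun s => 18 + 36 * N + 27 * (M * Real.exp (lam * s)))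
    (fun s hs z z' hz hz' => by
      have hs' : s ∈ Ico 0 τ := ⟨hs.1.le, hs.2.trans_lt hT.2⟩
      refine ALip (r := R0 + 2 * τ + 1) (hN s hs') (fun i x y hx hy => ?_) (by positivity) z z'
        (hz.trans (by linarith [hT.2])) (hz'.trans (by linarith [hT.2]))
      have hx' : x ∈ closedBall (0 : E3) (R0 + 2 * τ + 1) := by simpa using hx
      have hy' : y ∈ closedBall (0 : E3) (R0 + 2 * τ + 1) := by simpa using hy
      constructor
      · refine lip3 (u := fun x => E i (s, x)) ((slice_contDiff (h.hE i) hs').differentiable one_ne_zero)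
          (convex_closedBall _ _) (fun x hx j => ?_) hx' hy'
        rw [← dd_z (h.hE i) hs']
        exact (hD s ⟨hs.1.le, hs.2⟩ x (by simpa using hx) i j).1
      · refine lip3 (u := fun x => B i (s, x)) ((slice_contDiff (h.hB i) hs').differentiable one_ne_zero)
          (convex_closedBall _ _) (fun x hx j => ?_) hx' hy'
        rw [← dd_z (h.hB i) hs']
        exact (hD s ⟨hs.1.le, hs.2⟩ x (by simpa using hx) i j).2)
    (fun s _ => le_rfl) (fun s _ => mul_nonneg (by positivity) (Gn s))
    (by
      have e : Gf A N M lam 0 = A := by simp [Gf]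
      rw [e]; exact h.l0)
  refine ((slice_contDiff h.hf hT).differentiable one_ne_zero q).hasFDerivAt.le_of_lip' (mul_nonneg zero_le_two (Gn T)) ?_
  have ho : IsOpen {q : PS | ‖q.1‖ < R0 + τ + 1} := isOpen_lt (by fun_prop) continuous_const
  have hq1 : ‖q.1‖ < R0 + τ + 1 := by linarith [hT.2]
  filter_upwards [ho.mem_nhds hq1] with y hy
  rw [Real.norm_eq_abs, abs_le']
  refine ⟨lip y q (le_of_lt hy) hq1.le, ?_⟩
  have := lip q y hq1.le (le_of_lt hy)
  rw [norm_sub_rev] at this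
  linarith

lemma Ini.mono {A A' : ℝ} {u : ℝ × E3 → ℝ} (h : Ini τ A u) (hA : A ≤ A') : Ini τ A' u :=
  ⟨fun z => (h.b0 z).trans hA, fun j z => (h.b1 j z).trans hA, h.c1, fun i j z => (h.b2 i j z).trans hA⟩

end

section
variable {τ R R0 A : ℝ} {f : ℝ × PS → ℝ} {E B : Fin 3 → ℝ × E3 → ℝ}

lemma S1 (hτ : 0 < τ) (h : Vd τ R0 A f E B) (hs : Sol τ R f E B) (hE : ∀ i, Ini τ A (E i)) (hB : ∀ i, Ini τ A (B i)) :
    ∃ N, 0 ≤ N ∧ ∀ s ∈ Ico 0 τ, ∀ i x, |E i (s, x)| ≤ N ∧ |B i (s, x)| ≤ N := by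
  obtain ⟨C, hC, H⟩ := B0all hτ R
  have hA := h.hA
  let φ : ℝ × E3 → ℝ := fun p => ∑ i, (|E i p| + |B i p|)
  have hφ : ContinuousOn φ (Sl E3 τ) :=
    continuousOn_finsetSum _ fun i _ => (h.hE i).continuousOn.abs.add (h.hB i).continuousOn.abs
  have le : ∀ p i, |E i p| ≤ φ p ∧ |B i p| ≤ φ p := fun p i => by
    have := Finset.single_le_sum (f := fun i => |E i p| + |B i p|) (fun i _ => by positivity) (Finset.mem_univ i)
    constructor <;> linarith [abs_nonneg (E i p), abs_nonneg (B i p)]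
  have ge : ∀ p c, (∀ i, |E i p| ≤ c ∧ |B i p| ≤ c) → φ p ≤ 6 * c := fun p c hc => by
    simp only [φ, Fin.sum_univ_three]
    linarith [(hc 0).1, (hc 0).2, (hc 1).1, (hc 1).2, (hc 2).1, (hc 2).2]
  set lam := 36 * C * A + 1 with hlam
  have hl : 0 < lam := by positivity
  set a := 12 * C * A + 6 * A with ha
  have key := clo hφ (isCompact_closedBall (0 : E3) (R0 + τ)) (lam := lam) (a := a) hl (by positivity)
    (by
      intro T hT M hM hb t ht x
      have e1 : 1 ≤ Real.exp (lam * t) := Real.one_le_exp (mul_nonneg hl.le ht.1)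
      rcases ht.1.eq_or_lt with h0 | h0
      · subst h0
        refine (ge _ A fun i => ⟨(hE i).b0 x, (hB i).b0 x⟩).trans ?_
        have : (6 * A) * 1 ≤ (a + M / 2) * Real.exp (lam * 0) :=
          mul_le_mul (by rw [ha]; nlinarith [mul_nonneg hC (zero_le_one.trans hA)]) e1 zero_le_one (by positivity)
        linarith
      · have htτ : t ∈ Ioo 0 τ := ⟨h0, ht.2.trans_lt hT.2⟩
        have H1 := H f E B hs A (by linarith) hE hB (fun s hs q => h.fb hs q) t htτ lam hl (3 * A * M) (by positivity)
          (fun l s hs q => by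
            have hs' : s ∈ Ico 0 τ := ⟨hs.1.le, hs.2.trans htτ.2⟩
            by_cases hq : R0 + s < ‖q.1‖
            · rw [h.fx hs' q hq]; simp; positivity
            · have hk := hb s ⟨hs.1.le, hs.2.le.trans ht.2⟩ q.1 (by simp; linarith [hs'.2])
              have k1 := lf_abs (E := E) (B := B) (p := (s, q)) (fun i => ((le _ i).1.trans hk)) (fun i => ((le _ i).2.trans hk)) l
              rw [abs_mul]
              have := mul_le_mul k1 (h.fb hs' q) (abs_nonneg _) (by positivity)
              linarith) x
        refine (ge _ _ H1).trans ?_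
        have k2 : 18 * C * A / lam ≤ 1 / 2 := by
          rw [div_le_iff₀ hl]; linarith
        have k3 := mul_le_mul_of_nonneg_right k2 (show 0 ≤ M * Real.exp (lam * t) by positivity)
        have k4 : a * 1 ≤ a * Real.exp (lam * t) := mul_le_mul_of_nonneg_left e1 (by positivity)
        have k5 : 6 * (C * (2 * A + 3 * A * M * (Real.exp (lam * t) / lam))) = 12 * C * A
          + 18 * C * A / lam * (M * Real.exp (lam * t)) := by field_simp; ring
        rw [k5]
        linarith)
  exact ⟨2 * a * Real.exp (lam * τ), by positivity, fun s hs i x => ⟨(le _ i).1.trans (key s hs x), (le _ i).2.trans (key s hs x)⟩⟩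

lemma Gf_mono {A N M lam s t : ℝ} (hA : 0 ≤ A) (hN : 0 ≤ N) (hM : 0 ≤ M) (hl : 0 < lam) (h : s ≤ t) :
    Gf A N M lam s ≤ Gf A N M lam t := by
  unfold Gf
  gcongr

lemma Jb (hs : Sol τ R f E B) (h : Vd τ R0 A f E B) : ∃ J, 0 ≤ J ∧ ∀ s ∈ Ico 0 τ, ∀ x i, |∫ ξ, vv i ξ * f (s, (x, ξ))| ≤ J := by
  refine ⟨A * volume.real (closedBall (0 : E3) R), mul_nonneg (by linarith [h.hA]) measureReal_nonneg, fun s hs' x i => ?_⟩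
  have e : ∫ ξ, vv i ξ * f (s, (x, ξ)) = ∫ ξ in closedBall (0 : E3) R, vv i ξ * f (s, (x, ξ)) := by
    refine (setIntegral_eq_integral_of_forall_compl_eq_zero fun ξ hξ => ?_).symm
    rw [hs.fR s hs' x ξ (by simpa using hξ), mul_zero]
  rw [e, ← Real.norm_eq_abs]
  have hv : volume (closedBall (0 : E3) R) < ⊤ := measure_closedBall_lt_top
  refine norm_setIntegral_le_of_norm_le_const hv fun ξ _ => ?_
  rw [norm_mul, ← one_mul A]
  exact mul_le_mul (vv_abs i ξ) (h.fb hs' _) (norm_nonneg _) zero_le_one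

lemma TrL (hs : Sol τ R f E B) {J D s : ℝ} (hsτ : s ∈ Ioo 0 τ) (q : PS) (hJ : ∀ i, |∫ ξ, vv i ξ * f (s, (q.1, ξ))| ≤ J)
    (hE : ∀ i j, |dd τ (E i) (0, e3 j) (s, q.1)| ≤ D ∧ |dd τ (B i) (0, e3 j) (s, q.1)| ≤ D) (l : Fin 3) :
    |Tr τ (Lf E B l) (s, q)| ≤ 15 * D + J := by
  have hp : (s, q) ∈ Sl PS τ := ⟨⟨hsτ.1.le, hsτ.2⟩, mem_univ _⟩
  have hp2 : (s, q.1) ∈ Ioo 0 τ ×ˢ (univ : Set E3) := ⟨hsτ, mem_univ _⟩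
  have z0 : ∀ i, pdd (0 : E3) (vv i) q.2 = 0 := fun i => by simp [pdd]
  have tE : |dd τ (E l) (1, 0) (s, q.1)| ≤ 2 * D + J := by
    rw [hs.am l _ hp2]
    refine (abs_sub _ _).trans (add_le_add ((abs_sub _ _).trans ?_) (hJ l))
    linarith [(hE (l + 2) (l + 1)).2, (hE (l + 1) (l + 2)).2]
  have tB : ∀ i, |dd τ (B i) (1, 0) (s, q.1)| ≤ 2 * D := fun i => by
    rw [hs.fa i _ hp2, abs_neg]
    refine (abs_sub _ _).trans ?_
    linarith [(hE (i + 2) (i + 1)).1, (hE (i + 1) (i + 2)).1]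
  have vm : ∀ i (u c : ℝ), |u| ≤ c → |vv i q.2 * u| ≤ c := fun i u c hu => by
    rw [abs_mul]; nlinarith [vv_abs i q.2, abs_nonneg (vv i q.2), abs_nonneg u]
  have g : ∀ (a : ℝ) (w : E3) (c d : ℝ), |dd τ (E l) (a, w) (s, q.1)| ≤ c → (∀ i, |dd τ (B i) (a, w) (s, q.1)| ≤ d) →
      |dd τ (Lf E B l) (a, (w, 0)) (s, q)| ≤ c + 2 * d := fun a w c d h1 h2 => by
    rw [dd_Lf hs.hE hs.hB l hp]
    simp only [z0, zero_mul, zero_add, pz]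
    refine (abs_add_le _ _).trans ?_
    linarith [abs_sub (vv (l + 1) q.2 * dd τ (B (l + 2)) (a, w) (s, q.1)) (vv (l + 2) q.2 * dd τ (B (l + 1)) (a, w) (s, q.1)),
      vm (l + 1) _ _ (h2 (l + 2)), vm (l + 2) _ _ (h2 (l + 1))]
  have g1 := g 1 0 _ _ tE tB
  have g2 : ∀ j, |vv j q.2 * dd τ (Lf E B l) (0, (e3 j, 0)) (s, q)| ≤ D + 2 * D := fun j =>
    vm j _ _ (g 0 (e3 j) _ _ (hE l j).1 fun i => (hE i j).2)
  unfold Tr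
  refine (abs_add_le _ _).trans ?_
  rw [Fin.sum_univ_three]
  have g3 := abs_add_three (vv 0 q.2 * dd τ (Lf E B l) (0, (e3 0, 0)) (s, q)) (vv 1 q.2 * dd τ (Lf E B l) (0, (e3 1, 0)) (s, q))
    (vv 2 q.2 * dd τ (Lf E B l) (0, (e3 2, 0)) (s, q))
  have g1' : |dd τ (Lf E B l) (1, 0) (s, q)| ≤ 2 * D + J + 2 * (2 * D) := g1
  linarith [g2 0, g2 1, g2 2]

lemma S2 (hτ : 0 < τ) (h : Vd τ R0 A f E B) (hs : Sol τ R f E B) (hE : ∀ i, Ini τ A (E i)) (hB : ∀ i, Ini τ A (B i))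
    {N0 : ℝ} (hN0 : 0 ≤ N0) (hN : ∀ s ∈ Ico 0 τ, ∀ i x, |E i (s, x)| ≤ N0 ∧ |B i (s, x)| ≤ N0) :
    ∃ N, 0 ≤ N ∧ ∀ s ∈ Ico 0 τ, ∀ x i j, |dd τ (E i) (0, e3 j) (s, x)| ≤ N ∧ |dd τ (B i) (0, e3 j) (s, x)| ≤ N := by
  obtain ⟨C, hC, H⟩ := B1all hτ R
  obtain ⟨J, hJ0, hJ⟩ := Jb hs h
  have hA := h.hA
  have z0 : (0 : ℝ) ∈ Ico 0 τ := ⟨le_rfl, hτ⟩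
  let φ : ℝ × E3 → ℝ := fun p => ∑ i, ∑ j, (|dd τ (E i) (0, e3 j) p| + |dd τ (B i) (0, e3 j) p|)
  have hφ : ContinuousOn φ (Sl E3 τ) := continuousOn_finsetSum _ fun i _ => continuousOn_finsetSum _ fun j _ =>
    (dd_cont (h.hE i) _).abs.add (dd_cont (h.hB i) _).abs
  have le : ∀ p i j, |dd τ (E i) (0, e3 j) p| ≤ φ p ∧ |dd τ (B i) (0, e3 j) p| ≤ φ p := fun p i j => by
    have a := Finset.single_le_sum (f := fun j => |dd τ (E i) (0, e3 j) p| + |dd τ (B i) (0, e3 j) p|)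
      (fun i _ => by positivity) (Finset.mem_univ j)
    have b := Finset.single_le_sum (f := fun i => ∑ j, (|dd τ (E i) (0, e3 j) p| + |dd τ (B i) (0, e3 j) p|))
      (fun i _ => by positivity) (Finset.mem_univ i)
    have c := a.trans b
    constructor <;> linarith [abs_nonneg (dd τ (E i) (0, e3 j) p), abs_nonneg (dd τ (B i) (0, e3 j) p)]
  have ge : ∀ p c, (∀ i j, |dd τ (E i) (0, e3 j) p| ≤ c ∧ |dd τ (B i) (0, e3 j) p| ≤ c) → φ p ≤ 18 * c := fun p c hc => by
    have : φ p ≤ ∑ i : Fin 3, ∑ j : Fin 3, (c + c) := Finset.sum_le_sum fun i _ => Finset.sum_le_sum fun j _ =>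
      add_le_add (hc i j).1 (hc i j).2
    simp at this
    linarith
  set N := A + 3 * N0 * A + 12 * N0 ^ 2 * A with hNd
  have q1 : 0 ≤ N0 * A := by positivity
  have q2 : 0 ≤ N0 ^ 2 * A := by positivity
  have hAN : A ≤ N := by linarith
  have hN1 : 1 ≤ N := hA.trans hAN
  have L1 : ∀ l, ∀ s ∈ Ico 0 τ, ∀ q, |Lf E B l (s, q)| ≤ 3 * N0 := fun l s hs q =>
    lf_abs (fun i => (hN s hs i q.1).1) (fun i => (hN s hs i q.1).2) l
  have L2 : ∀ l m, ∀ s ∈ Ico 0 τ, ∀ q, |dd τ (Lf E B l) (0, (0, e3 m)) (s, q)| ≤ 4 * N0 := fun l m s hs' q => by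
    rw [dd_Lf h.hE h.hB l ⟨hs', mem_univ _⟩]
    simp only [dd_zero, mul_zero, add_zero, zero_add]
    refine (abs_sub _ _).trans ?_
    rw [abs_mul, abs_mul]
    have a := mul_le_mul (vv_pdd (l + 1) m q.2) (hN s hs' (l + 2) q.1).2 (abs_nonneg _) zero_le_two
    have b := mul_le_mul (vv_pdd (l + 2) m q.2) (hN s hs' (l + 1) q.1).2 (abs_nonneg _) zero_le_two
    exact (add_le_add a b).trans (by linarith)
  set c := 2 * A + 2 * ((18 + 36 * N0) * τ) with hc
  set lam := 36 * C * (15 * A + 108 * N) + 1 with hlam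
  have hNp : 0 < N := by linarith
  have hl : 0 < lam := by positivity
  have hl1 : 1 ≤ lam := by rw [hlam]; linarith [show 0 ≤ 36 * C * (15 * A + 108 * N) by positivity]
  set a := 18 * C * (2 * N + A * J + 2 * N * c) + 18 * N with ha
  have hcp : 0 ≤ c := by positivity
  have hap : 0 ≤ a := by positivity
  have key := clo hφ (isCompact_closedBall (0 : E3) (R0 + 2 * τ + 1)) (lam := lam) (a := a) hl hap
    (by
      intro T hT M hM hb t ht x
      have e1 : 1 ≤ Real.exp (lam * t) := Real.one_le_exp (mul_nonneg hl.le ht.1)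
      rcases ht.1.eq_or_lt with h0 | h0
      · subst h0
        refine (ge _ N fun i j => ⟨((hE i).b1 j x).trans hAN, ((hB i).b1 j x).trans hAN⟩).trans ?_
        have : (18 * N) * 1 ≤ (a + M / 2) * Real.exp (lam * 0) :=
          mul_le_mul (by rw [ha]; linarith [show 0 ≤ 18 * C * (2 * N + A * J + 2 * N * c) by positivity]) e1 zero_le_one (by positivity)
        linarith
      · have htτ : t ∈ Ioo 0 τ := ⟨h0, ht.2.trans_lt hT.2⟩
        have hD : ∀ s ∈ Icc 0 T, ∀ x, ‖x‖ ≤ R0 + 2 * τ + 1 → ∀ i j, |dd τ (E i) (0, e3 j) (s, x)| ≤ M * Real.exp (lam * s) ∧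
            |dd τ (B i) (0, e3 j) (s, x)| ≤ M * Real.exp (lam * s) := fun s hs x hx i j =>
          have hk := hb s hs x (by simpa using hx)
          ⟨(le _ i j).1.trans hk, (le _ i j).2.trans hk⟩
        have Gl : 2 * Gf A N0 M lam t = Real.exp (Real.log (2 * A) + 2 * ((18 + 36 * N0) * t + 27 * M * ((Real.exp (lam * t) - 1) / lam))) := by
          rw [Real.exp_add, Real.exp_log (by positivity)]; unfold Gf; ring
        have nn : 0 ≤ (Real.exp (lam * t) - 1) / lam := div_nonneg (by linarith) hl.le
        have H1 := H f E B hs N hN1 (fun i => (hE i).mono hAN) (fun i => (hB i).mono hAN) (fun s hs q => (h.fb hs q).trans hAN)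
          (fun j q => by
            rw [dd_z h.hf z0]
            have k := h.fd hN z0 (M := M) hM hl (fun s hs => hD s ⟨hs.1, hs.2.trans hT.1.le⟩) q
            have k2 : ‖fderiv ℝ (fun q => f (0, q)) q‖ ≤ A := by
              refine ((slice_contDiff h.hf z0).differentiable one_ne_zero q).hasFDerivAt.le_of_lip' (by linarith) ?_
              filter_upwards with y
              rw [Real.norm_eq_abs, abs_le']
              refine ⟨h.l0 y q, ?_⟩
              have := h.l0 q y
              rw [norm_sub_rev] at this
              linarith
            rw [← Real.norm_eq_abs]
            refine ((ContinuousLinearMap.le_opNorm _ _).trans ?_).trans (k2.trans hAN)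
            have : ‖((e3 j, 0) : PS)‖ ≤ 1 := by simp [Prod.norm_def, e3]
            exact mul_le_of_le_one_right (norm_nonneg _) this)
          (fun l s hs q => by
            rw [abs_mul]
            have := mul_le_mul (L1 l s hs q) (h.fb hs q) (abs_nonneg _) (by positivity)
            linarith)
          (fun l m s hs q => by
            rw [abs_mul, abs_mul]
            have := mul_le_mul (mul_le_mul (L1 m s hs q) (L1 l s hs q) (abs_nonneg _) (by positivity)) (h.fb hs q) (abs_nonneg _) (by positivity)
            linarith)
          (fun l m s hs q _ => by
            rw [abs_mul, abs_mul]
            have := mul_le_mul (mul_le_mul (L1 m s hs q) (L2 l m s hs q) (abs_nonneg _) (by positivity)) (h.fb hs q) (abs_nonneg _) (by positivity)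
            linarith)
          t htτ lam hl (A * (15 * M + J)) (by positivity)
          (fun l s hs' q _ => by
            have hs2 : s ∈ Ico 0 τ := ⟨hs'.1.le, hs'.2.trans htτ.2⟩
            have es : 1 ≤ Real.exp (lam * s) := Real.one_le_exp (mul_nonneg hl.le hs'.1.le)
            by_cases hq : R0 + s < ‖q.1‖
            · rw [h.fx hs2 q hq]; simp; positivity
            · have k := TrL hs ⟨hs'.1, hs2.2⟩ q (hJ s hs2 q.1) (hD s ⟨hs'.1.le, hs'.2.le.trans ht.2⟩ q.1 (by linarith [hs2.2])) l
              have k2 := h.fb hs2 q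
              rw [abs_mul]
              have := mul_le_mul k k2 (abs_nonneg _) (by positivity)
              have k3 := mul_le_mul_of_nonneg_left es (show 0 ≤ A * J by positivity)
              linarith)
          (2 * Gf A N0 M lam t) (by
            rw [Gl]; apply Real.one_le_exp
            have : 0 ≤ Real.log (2 * A) := Real.log_nonneg (by linarith)
            have := ht.1
            positivity)
          (fun j s hs' q => by
            have hs2 : s ∈ Ico 0 τ := ⟨hs'.1.le, hs'.2.trans htτ.2⟩
            rw [dd_z h.hf hs2]
            have k := h.fd hN hs2 (M := M) hM hl (fun u hu => hD u ⟨hu.1, hu.2.trans (hs'.2.le.trans ht.2)⟩) q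
            rw [← Real.norm_eq_abs]
            refine ((ContinuousLinearMap.le_opNorm _ _).trans ?_).trans
              (k.trans (mul_le_mul_of_nonneg_left (Gf_mono (by linarith) hN0 hM hl hs'.2.le) zero_le_two))
            have : ‖((e3 j, 0) : PS)‖ ≤ 1 := by simp [Prod.norm_def, e3]
            exact mul_le_of_le_one_right (norm_nonneg _) this) x
        refine (ge _ _ H1).trans ?_
        rw [Gl, Real.log_exp]
        set e := Real.exp (lam * t) with he
        have lg : Real.log (2 * A) ≤ 2 * A := (Real.log_le_sub_one_of_pos (by positivity)).trans (by linarith)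
        have m1 : (e - 1) / lam ≤ e / lam := by gcongr; linarith
        have m2 : (18 + 36 * N0) * t ≤ (18 + 36 * N0) * τ := by gcongr; exact htτ.2.le
        have m3 : Real.log (2 * A) + 2 * ((18 + 36 * N0) * t + 27 * M * ((e - 1) / lam)) ≤ c + 54 * M * (e / lam) := by
          have := mul_le_mul_of_nonneg_left m1 (show 0 ≤ 54 * M by positivity)
          rw [hc]; linarith
        have m4 := mul_le_mul_of_nonneg_left m3 (show 0 ≤ 18 * C * (2 * N) by positivity)
        have k2 : 18 * C * (15 * A + 108 * N) / lam ≤ 1 / 2 := by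
          rw [div_le_iff₀ hl]; linarith
        have k3 := mul_le_mul_of_nonneg_right k2 (show 0 ≤ M * e by positivity)
        have k4 : (18 * C * (2 * N + 2 * N * c) + 18 * N) * 1 ≤ (18 * C * (2 * N + 2 * N * c) + 18 * N) * e :=
          mul_le_mul_of_nonneg_left e1 (by positivity)
        have k6 : e / lam ≤ e := div_le_self (by positivity) hl1
        have k7 := mul_le_mul_of_nonneg_left k6 (show 0 ≤ 18 * C * (A * J) by positivity)
        have k5 : 18 * C * (15 * A + 108 * N) / lam * (M * e) = 18 * C * ((15 * A * M + 108 * N * M) * (e / lam)) := by field_simp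
        rw [k5] at k3
        rw [ha]
        linarith)
  exact ⟨2 * a * Real.exp (lam * τ), by positivity, fun s hs x i j => ⟨(le _ i j).1.trans (key s hs x), (le _ i j).2.trans (key s hs x)⟩⟩

lemma S3 (hτ : 0 < τ) (h : Vd τ R0 A f E B) (hs : Sol τ R f E B) (hE : ∀ i, Ini τ A (E i)) (hB : ∀ i, Ini τ A (B i)) :
    ∃ N, ∀ s ∈ Ico 0 τ, (∀ q, |f (s, q)| ≤ N ∧ ‖fderiv ℝ (fun q => f (s, q)) q‖ ≤ N) ∧
      ∀ x i, |E i (s, x)| ≤ N ∧ |B i (s, x)| ≤ N ∧ ∀ j, |dd τ (E i) (0, e3 j) (s, x)| ≤ N ∧ |dd τ (B i) (0, e3 j) (s, x)| ≤ N := by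
  obtain ⟨N0, p0, h0⟩ := S1 hτ h hs hE hB
  obtain ⟨N1, p1, h1⟩ := S2 hτ h hs hE hB p0 h0
  have hA := h.hA
  have g : 0 ≤ Gf A N0 N1 1 τ := by unfold Gf; positivity
  refine ⟨A + N0 + N1 + 2 * Gf A N0 N1 1 τ, fun s hs' => ⟨fun q => ⟨(h.fb hs' q).trans (by linarith), ?_⟩, fun x i =>
    ⟨(h0 s hs' i x).1.trans (by linarith), (h0 s hs' i x).2.trans (by linarith), fun j =>
    ⟨(h1 s hs' x i j).1.trans (by linarith), (h1 s hs' x i j).2.trans (by linarith)⟩⟩⟩⟩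
  have k := h.fd h0 hs' p1 one_pos (fun u hu x _ i j => by
    have e : N1 ≤ N1 * Real.exp (1 * u) := le_mul_of_one_le_right p1 (Real.one_le_exp (by simpa using hu.1))
    have := h1 u ⟨hu.1, hu.2.trans_lt hs'.2⟩ x i j
    exact ⟨this.1.trans e, this.2.trans e⟩) q
  have := Gf_mono (A := A) (lam := 1) (by linarith) p0 p1 one_pos hs'.2.le
  linarith

end

section
variable {τ : ℝ}

lemma pzx {g : ℝ × PS → ℝ} (hg : ContDiffOn ℝ 1 g (Sl PS τ)) {s : ℝ} (hs : s ∈ Ico 0 τ) (x ξ w : E3) :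
    fderiv ℝ (fun y => g (s, (y, ξ))) x w = dd τ g (0, (w, 0)) (s, (x, ξ)) := by
  rw [dd_z hg hs]
  have h1 := ((slice_contDiff hg hs).differentiable one_ne_zero (x, ξ)).hasFDerivAt
  have h2 := h1.comp x (hasFDerivAt_prodMk_left (𝕜 := ℝ) x ξ)
  exact DFunLike.congr_fun h2.fderiv w

lemma pzxi {g : ℝ × PS → ℝ} (hg : ContDiffOn ℝ 1 g (Sl PS τ)) {s : ℝ} (hs : s ∈ Ico 0 τ) (x ξ w : E3) :
    fderiv ℝ (fun y => g (s, (x, y))) ξ w = dd τ g (0, (0, w)) (s, (x, ξ)) := by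
  rw [dd_z hg hs]
  have h1 := ((slice_contDiff hg hs).differentiable one_ne_zero (x, ξ)).hasFDerivAt
  have h2 := h1.comp ξ (hasFDerivAt_prodMk_right (𝕜 := ℝ) x ξ)
  exact DFunLike.congr_fun h2.fderiv w

lemma cross_c (a b : E3) (i : Fin 3) : cross3 a b i = a (i + 1) * b (i + 2) - a (i + 2) * b (i + 1) := by
  fin_cases i <;> rfl

lemma curl_c (F : E3 → E3) (x : E3) (i : Fin 3) : curl3 F x i =
    fderiv ℝ (fun y => F y (i + 2)) x (e3 (i + 1)) - fderiv ℝ (fun y => F y (i + 1)) x (e3 (i + 2)) := by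
  fin_cases i <;> rfl

lemma comp_cd {F : ℝ → E3 → E3} (h : ContDiffOn ℝ 1 (fun p : ℝ × E3 => F p.1 p.2) (Sl E3 τ)) (i : Fin 3) :
    ContDiffOn ℝ 1 (fun p : ℝ × E3 => F p.1 p.2 i) (Sl E3 τ) :=
  (EuclideanSpace.proj (𝕜 := ℝ) i : E3 →L[ℝ] ℝ).contDiff.comp_contDiffOn h

lemma e3_c (i j : Fin 3) : e3 i j = if j = i then 1 else 0 := by simp [e3]

lemma dt_c {F : ℝ → E3 → E3} (h : ContDiffOn ℝ 1 (fun p : ℝ × E3 => F p.1 p.2) (Sl E3 τ)) {t : ℝ} (ht : t ∈ Ioo 0 τ)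
    (x : E3) (i : Fin 3) : deriv (fun s => F s x) t i = dd τ (fun p : ℝ × E3 => F p.1 p.2 i) (1, 0) (t, x) := by
  have h1 : HasDerivAt (fun s => F s x) (∑ j, dd τ (fun p : ℝ × E3 => F p.1 p.2 j) (1, 0) (t, x) • e3 j) t := by
    have : (fun s => F s x) = fun s => ∑ j, F s x j • e3 j := funext fun s => dec _
    rw [this]
    exact HasDerivAt.fun_sum fun j _ => (dd_hasD_s (comp_cd h j) ht x).smul_const (e3 j)
  rw [h1.deriv]
  simp [e3_c]

lemma fd_le {F : ℝ → E3 → E3} (h : ContDiffOn ℝ 1 (fun p : ℝ × E3 => F p.1 p.2) (Sl E3 τ)) {t : ℝ} (ht : t ∈ Ico 0 τ)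
    (x : E3) {N : ℝ} (hN : ∀ i j, |dd τ (fun p : ℝ × E3 => F p.1 p.2 i) (0, e3 j) (t, x)| ≤ N) :
    ‖fderiv ℝ (F t) x‖ ≤ 9 * N := by
  have h1 : HasFDerivAt (F t) (∑ j, (fderiv ℝ (fun y => F t y j) x).smulRight (e3 j)) x := by
    have : F t = fun y => ∑ j, F t y j • e3 j := funext fun s => dec _
    have h2 : HasFDerivAt (fun y => ∑ j, F t y j • e3 j) (∑ j, (fderiv ℝ (fun y => F t y j) x).smulRight (e3 j)) x :=
      HasFDerivAt.fun_sum fun j _ => (((slice_contDiff (comp_cd h j) ht).differentiable one_ne_zero x).hasFDerivAt).smul_const (e3 j)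
    rwa [← this] at h2
  rw [h1.fderiv]
  have k : ∀ j, ‖(fderiv ℝ (fun y => F t y j) x).smulRight (e3 j)‖ ≤ 3 * N := fun j => by
    rw [ContinuousLinearMap.norm_smulRight_apply]
    have : ‖e3 j‖ = 1 := by simp [e3]
    rw [this, mul_one]
    refine op3 fun i => ?_
    have := hN j i
    rwa [dd_z (comp_cd h j) ht] at this
  refine (norm_sum_le _ _).trans ?_
  rw [Fin.sum_univ_three]
  linarith [k 0, k 1, k 2]

lemma ini_of (hτ : 0 < τ) {F : ℝ → E3 → E3} {G : E3 → E3} (h : ContDiffOn ℝ 1 (fun p : ℝ × E3 => F p.1 p.2) (Sl E3 τ))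
    (hG : ContDiff ℝ 2 G) (hc : HasCompactSupport G) (h0 : ∀ x, F 0 x = G x) :
    ∃ A, ∀ i, Ini τ A (fun p : ℝ × E3 => F p.1 p.2 i) := by
  have key : ∀ i, ∃ A, Ini τ A (fun p : ℝ × E3 => F p.1 p.2 i) := fun i => by
    have hg : ContDiff ℝ 2 (fun y => G y i) := (EuclideanSpace.proj (𝕜 := ℝ) i : E3 →L[ℝ] ℝ).contDiff.comp hG
    have hgc : HasCompactSupport (fun y => G y i) :=
      hc.comp_left (g := fun v : E3 => v i) rfl
    have e : ∀ j z, dd τ (fun p : ℝ × E3 => F p.1 p.2 i) (0, e3 j) (0, z) = fderiv ℝ (fun y => G y i) z (e3 j) := fun j z => by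
      rw [dd_z (comp_cd h i) ⟨le_rfl, hτ⟩]; simp only [h0]
    have c1 : ∀ j, ContDiff ℝ 1 (fun z => fderiv ℝ (fun y => G y i) z (e3 j)) := fun j =>
      (hg.fderiv_right (m := 1) le_rfl).clm_apply contDiff_const
    have s1 : ∀ j, HasCompactSupport (fun z => fderiv ℝ (fun y => G y i) z (e3 j)) := fun j => hgc.fderiv_apply ℝ (e3 j)
    obtain ⟨a, ha⟩ := hg.continuous.bounded_above_of_compact_support hgc
    choose b hb using fun j => (c1 j).continuous.bounded_above_of_compact_support (s1 j)
    choose c hc' using fun j m => (((c1 j).continuous_fderiv one_ne_zero).clm_apply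
      (continuous_const (y := e3 m))).bounded_above_of_compact_support ((s1 j).fderiv_apply ℝ (e3 m))
    obtain ⟨M, hM⟩ := (Set.finite_range (Sum.elim (fun _ : Unit => a) (Sum.elim b fun p : Fin 3 × Fin 3 => c p.1 p.2))).bddAbove
    refine ⟨M, ⟨fun z => ?_, fun j z => ?_, fun j => ?_, fun m j z => ?_⟩⟩
    · simp only [h0]
      exact (ha z).trans (hM ⟨Sum.inl (), rfl⟩)
    · rw [e]; exact (hb j z).trans (hM ⟨Sum.inr (Sum.inl j), rfl⟩)
    · simp only [e]; exact c1 j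
    · simp only [e]; exact (hc' j m z).trans (hM ⟨Sum.inr (Sum.inr (j, m)), rfl⟩)
  choose A hA using key
  obtain ⟨M, hM⟩ := (Set.finite_range A).bddAbove
  exact ⟨M, fun i => (hA i).mono (hM ⟨i, rfl⟩)⟩

lemma nn_le {V : Type*} [NormedAddCommGroup V] {x : V} {c : ℝ} (h : ‖x‖ ≤ c) : (‖x‖₊ : ℝ≥0∞) ≤ ENNReal.ofReal c := by
  rw [← enorm_eq_nnnorm, ← ofReal_norm]
  exact ENNReal.ofReal_le_ofReal h

lemma WF_le {F : ℝ → E3 → E3} (h : ContDiffOn ℝ 1 (fun p : ℝ × E3 => F p.1 p.2) (Sl E3 τ)) {t : ℝ} (ht : t ∈ Ico 0 τ)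
    {N : ℝ} (h0 : ∀ x i, |F t x i| ≤ N) (hN : ∀ x i j, |dd τ (fun p : ℝ × E3 => F p.1 p.2 i) (0, e3 j) (t, x)| ≤ N) :
    WFieldNorm F t ≤ ENNReal.ofReal (3 * N) + ENNReal.ofReal (9 * N) := by
  refine iSup_le fun x => add_le_add ?_ ?_
  · exact nn_le (nsum' (h0 x))
  · exact nn_le (fd_le h ht x (hN x))

end

/-- **Glassey–Strauss theorem.** If a `C¹` solution `(f,E,B)` of the relativistic
Vlasov–Maxwell system on `[0,τ)` with compactly supported `C¹` (resp. `C²`) compatible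
initial data blows up in `W^{1,∞}` as `t → τ⁻`, then the momentum support radius
`R_f(t)` is unbounded as `t → τ⁻`. -/
theorem glassey_strauss
    (τ : ℝ) (hτ : 0 < τ)
    (f : ℝ → E3 → E3 → ℝ) (Efld Bfld : ℝ → E3 → E3)
    (fin : E3 → E3 → ℝ) (Ein Bin : E3 → E3)
    -- regularity of the solution on `[0,τ)`
    (hfreg : ContDiffOn ℝ 1 (fun p : ℝ × E3 × E3 => f p.1 p.2.1 p.2.2)
      (Set.Ico 0 τ ×ˢ (Set.univ : Set (E3 × E3))))
    (hEreg : ContDiffOn ℝ 1 (fun p : ℝ × E3 => Efld p.1 p.2)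
      (Set.Ico 0 τ ×ˢ (Set.univ : Set E3)))
    (hBreg : ContDiffOn ℝ 1 (fun p : ℝ × E3 => Bfld p.1 p.2)
      (Set.Ico 0 τ ×ˢ (Set.univ : Set E3)))
    -- regularity, positivity and support of the initial data
    (hfinreg : ContDiff ℝ 1 (fun p : E3 × E3 => fin p.1 p.2))
    (hfinpos : ∀ x ξ : E3, 0 ≤ fin x ξ)
    (hfinsupp : HasCompactSupport (fun p : E3 × E3 => fin p.1 p.2))
    (hEinreg : ContDiff ℝ 2 Ein) (hBinreg : ContDiff ℝ 2 Bin)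
    (hEinsupp : HasCompactSupport Ein) (hBinsupp : HasCompactSupport Bin)
    -- initial conditions
    (hf0 : ∀ x ξ : E3, f 0 x ξ = fin x ξ)
    (hE0 : ∀ x : E3, Efld 0 x = Ein x) (hB0 : ∀ x : E3, Bfld 0 x = Bin x)
    -- integrability in the momentum variable
    (hintf : ∀ t ∈ Set.Ico 0 τ, ∀ x : E3, Integrable fun ξ : E3 => f t x ξ)
    -- compatibility conditions on the initial data
    (hcompatE : ∀ x : E3, divg Ein x = ∫ ξ : E3, fin x ξ)
    (hcompatB : ∀ x : E3, divg Bin x = 0)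
    -- the Vlasov equation
    (hVlasov : ∀ t ∈ Set.Ioo 0 τ, ∀ x ξ : E3,
      deriv (fun s => f s x ξ) t + ⟪vrel ξ, gradient (fun y => f t y ξ) x⟫
        = -∑ i : Fin 3,
            fderiv ℝ (fun η => (Efld t x + cross3 (vrel η) (Bfld t x)) i * f t x η) ξ (e3 i))
    -- the Maxwell equations
    (hAmpere : ∀ t ∈ Set.Ioo 0 τ, ∀ x : E3,
      deriv (fun s => Efld s x) t - curl3 (Bfld t) x = -∫ ξ : E3, f t x ξ • vrel ξ)
    (hGaussE : ∀ t ∈ Set.Ioo 0 τ, ∀ x : E3, divg (Efld t) x = ∫ ξ : E3, f t x ξ)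
    (hFaraday : ∀ t ∈ Set.Ioo 0 τ, ∀ x : E3,
      deriv (fun s => Bfld s x) t + curl3 (Efld t) x = 0)
    (hGaussB : ∀ t ∈ Set.Ioo 0 τ, ∀ x : E3, divg (Bfld t) x = 0)
    -- blow-up of the `W^{1,∞}` norms as `t → τ⁻`
    (hblow : Filter.limsup
      (fun t => WfNorm f t + WFieldNorm Efld t + WFieldNorm Bfld t) (𝓝[<] τ) = ⊤) :
    Filter.limsup (Rsupp f) (𝓝[<] τ) = ⊤ := by
  have zI : (0 : ℝ) ∈ Ico 0 τ := ⟨le_rfl, hτ⟩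
  have hE1 := fun i => comp_cd (τ := τ) hEreg i
  have hB1 := fun i => comp_cd (τ := τ) hBreg i
  have hf1 : ContDiffOn ℝ 1 (fun p : ℝ × PS => f p.1 p.2.1 p.2.2) (Sl PS τ) := hfreg
  have vl : ∀ p ∈ Ioo 0 τ ×ˢ (univ : Set PS), dd τ (fun p : ℝ × PS => f p.1 p.2.1 p.2.2) (1, 0) p
      + ∑ j, vv j p.2.2 * dd τ (fun p : ℝ × PS => f p.1 p.2.1 p.2.2) (0, (e3 j, 0)) p
      + ∑ l, Lf (fun i p => Efld p.1 p.2 i) (fun i p => Bfld p.1 p.2 i) l p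
        * dd τ (fun p : ℝ × PS => f p.1 p.2.1 p.2.2) (0, (0, e3 l)) p = 0 := by
    rintro ⟨t, x, ξ⟩ ⟨ht, -⟩
    have ht' : t ∈ Ico 0 τ := ⟨ht.1.le, ht.2⟩
    have hp : (t, (x, ξ)) ∈ Sl PS τ := ⟨ht', mem_univ _⟩
    have h := hVlasov t ht x ξ
    have e1 := (dd_hasD_s hf1 ht (x, ξ)).deriv
    have e2 : ⟪vrel ξ, gradient (fun y => f t y ξ) x⟫
        = ∑ j, vv j ξ * dd τ (fun p : ℝ × PS => f p.1 p.2.1 p.2.2) (0, (e3 j, 0)) (t, (x, ξ)) := by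
      rw [real_inner_comm, inner_gradient_left]
      conv_lhs => rw [dec (vrel ξ)]
      rw [map_sum]
      refine Finset.sum_congr rfl fun j _ => ?_
      rw [map_smul, ← pzx hf1 ht' x ξ (e3 j)]
      rfl
    have e3' : ∀ l, fderiv ℝ (fun η => (Efld t x + cross3 (vrel η) (Bfld t x)) l * f t x η) ξ (e3 l)
        = dd τ (Lf (fun i p => Efld p.1 p.2 i) (fun i p => Bfld p.1 p.2 i) l) (0, (0, e3 l)) (t, (x, ξ)) * f t x ξ
          + Lf (fun i p => Efld p.1 p.2 i) (fun i p => Bfld p.1 p.2 i) l (t, (x, ξ))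
            * dd τ (fun p : ℝ × PS => f p.1 p.2.1 p.2.2) (0, (0, e3 l)) (t, (x, ξ)) := fun l => by
      have hL := Lf_cd (τ := τ) hE1 hB1 l
      rw [← dd_mul hL hf1 hp, ← pzxi (hL.mul hf1) ht' x ξ (e3 l)]
      congr 2
      funext η
      rw [PiLp.add_apply, cross_c]
      rfl
    rw [Finset.sum_congr rfl fun l _ => e3' l, Finset.sum_add_distrib, ← Finset.sum_mul,
      dvL (τ := τ) hE1 hB1 hp, zero_mul, zero_add, e2, e1] at h
    simp only
    linarith
  have am : ∀ i, ∀ p ∈ Ioo 0 τ ×ˢ (univ : Set E3), dd τ (fun p : ℝ × E3 => Efld p.1 p.2 i) (1, 0) p =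
      dd τ (fun p : ℝ × E3 => Bfld p.1 p.2 (i + 2)) (0, e3 (i + 1)) p
        - dd τ (fun p : ℝ × E3 => Bfld p.1 p.2 (i + 1)) (0, e3 (i + 2)) p - ∫ ξ, vv i ξ * f p.1 p.2 ξ := by
    rintro i ⟨t, x⟩ ⟨ht, -⟩
    have ht' : t ∈ Ico 0 τ := ⟨ht.1.le, ht.2⟩
    have h := congrArg (fun v : E3 => v i) (hAmpere t ht x)
    simp only [PiLp.sub_apply, PiLp.neg_apply] at h
    rw [dt_c (τ := τ) hEreg ht, curl_c] at h
    rw [dd_z (hB1 _) ht', dd_z (hB1 _) ht']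
    have hi : Integrable fun ξ : E3 => f t x ξ • vrel ξ := by
      refine (hintf t ht' x).mono ((hintf t ht' x).aestronglyMeasurable.smul
        vrel_smooth.continuous.aestronglyMeasurable) (Eventually.of_forall fun ξ => ?_)
      rw [norm_smul]
      exact mul_le_of_le_one_right (norm_nonneg _) (vrel_norm ξ).le
    have e := (EuclideanSpace.proj (𝕜 := ℝ) i : E3 →L[ℝ] ℝ).integral_comp_comm hi
    have e' : ∫ ξ, vv i ξ * f t x ξ = (∫ ξ, f t x ξ • vrel ξ) i :=
      Eq.trans (integral_congr_ae (Eventually.of_forall fun ξ => mul_comm _ _)) e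
    simp only at h ⊢
    rw [e']
    linarith
  have fa : ∀ i, ∀ p ∈ Ioo 0 τ ×ˢ (univ : Set E3), dd τ (fun p : ℝ × E3 => Bfld p.1 p.2 i) (1, 0) p =
      -(dd τ (fun p : ℝ × E3 => Efld p.1 p.2 (i + 2)) (0, e3 (i + 1)) p
        - dd τ (fun p : ℝ × E3 => Efld p.1 p.2 (i + 1)) (0, e3 (i + 2)) p) := by
    rintro i ⟨t, x⟩ ⟨ht, -⟩
    have ht' : t ∈ Ico 0 τ := ⟨ht.1.le, ht.2⟩
    have h := congrArg (fun v : E3 => v i) (hFaraday t ht x)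
    simp only [PiLp.add_apply, PiLp.zero_apply] at h
    rw [dt_c (τ := τ) hBreg ht, curl_c] at h
    rw [dd_z (hE1 _) ht', dd_z (hE1 _) ht']
    linarith
  have gE : ∀ p ∈ Ioo 0 τ ×ˢ (univ : Set E3), ∑ i, dd τ (fun p : ℝ × E3 => Efld p.1 p.2 i) (0, e3 i) p
      = ∫ ξ, f p.1 p.2 ξ := by
    rintro ⟨t, x⟩ ⟨ht, -⟩
    rw [← hGaussE t ht x]
    exact Finset.sum_congr rfl fun i _ => dd_z (hE1 i) ⟨ht.1.le, ht.2⟩ _ _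
  have gB : ∀ p ∈ Ioo 0 τ ×ˢ (univ : Set E3), ∑ i, dd τ (fun p : ℝ × E3 => Bfld p.1 p.2 i) (0, e3 i) p = 0 := by
    rintro ⟨t, x⟩ ⟨ht, -⟩
    refine Eq.trans ?_ (hGaussB t ht x)
    exact Finset.sum_congr rfl fun i _ => dd_z (hB1 i) ⟨ht.1.le, ht.2⟩ _ _
  obtain ⟨A1, hA1⟩ := ini_of hτ hEreg hEinreg hEinsupp hE0
  obtain ⟨A2, hA2⟩ := ini_of hτ hBreg hBinreg hBinsupp hB0
  obtain ⟨A3, hA3⟩ := hfinreg.continuous.bounded_above_of_compact_support hfinsupp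
  obtain ⟨A4, hA4⟩ := (hfinreg.continuous_fderiv one_ne_zero).bounded_above_of_compact_support (hfinsupp.fderiv ℝ)
  obtain ⟨A, a0, a1, a2, a3, a4⟩ : ∃ A, 1 ≤ A ∧ A1 ≤ A ∧ A2 ≤ A ∧ A3 ≤ A ∧ A4 ≤ A :=
    ⟨1 ⊔ (A1 ⊔ (A2 ⊔ (A3 ⊔ A4))), by simp, by simp, by simp, by simp, by simp⟩
  obtain ⟨R0, r0, hR0⟩ := hfinsupp.isCompact.isBounded.exists_pos_norm_le
  have V : Vd τ R0 A (fun p : ℝ × PS => f p.1 p.2.1 p.2.2) (fun i p => Efld p.1 p.2 i) (fun i p => Bfld p.1 p.2 i) := by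
    refine ⟨hf1, hE1, hB1, vl, a0, r0.le, fun x ξ h => ?_, fun q => ?_, fun z z' => ?_⟩
    · simp only [hf0]
      by_contra hne
      have := hR0 (x, ξ) (subset_tsupport _ hne)
      rw [Prod.norm_def] at this
      rcases h with h | h
      · exact absurd (le_sup_left.trans this) h.not_ge
      · exact absurd (le_sup_right.trans this) h.not_ge
    · simp only [hf0]; exact (hA3 q).trans a3
    · simp only [hf0]
      have := convex_univ.norm_image_sub_le_of_norm_fderiv_le (𝕜 := ℝ)
        (fun x _ => hfinreg.differentiable one_ne_zero x) (fun x _ => (hA4 x).trans a4) (mem_univ z') (mem_univ z)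
      exact (le_abs_self _).trans this
  by_contra hlim
  obtain ⟨r, hr1, hr2⟩ := exists_between (lt_top_iff_ne_top.2 hlim)
  obtain ⟨l, hl, hl2⟩ := mem_nhdsLT_iff_exists_Ioo_subset.1 (eventually_lt_of_limsup_lt hr1)
  have hl' : max l 0 < τ := max_lt hl hτ
  obtain ⟨t2, ht2, ht3⟩ := exists_between hl'
  obtain ⟨ρ, hρ⟩ := V.fxi ⟨(le_max_right l 0).trans ht2.le, ht3⟩
  have S : Sol τ (max ρ r.toReal) (fun p : ℝ × PS => f p.1 p.2.1 p.2.2) (fun i p => Efld p.1 p.2 i)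
      (fun i p => Bfld p.1 p.2 i) := by
    refine ⟨hf1, hE1, hB1, fun s hs z ξ hξ => ?_, vl, am, fa, gE, gB⟩
    rcases le_or_gt s t2 with h | h
    · exact hρ s ⟨hs.1, h⟩ z ξ ((le_max_left _ _).trans_lt hξ)
    · have hs' : Rsupp f s < r := hl2 ⟨(le_max_left l 0).trans_lt (ht2.trans h), hs.2⟩
      obtain ⟨a, ⟨-, ha⟩, har⟩ := sInf_lt_iff.1 hs'
      refine ha z ξ (har.trans ?_)
      rw [← enorm_eq_nnnorm, ← ofReal_norm, ← ENNReal.ofReal_toReal hr2.ne]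
      exact (ENNReal.ofReal_lt_ofReal_iff_of_nonneg ENNReal.toReal_nonneg).2 ((le_max_right _ _).trans_lt hξ)
  obtain ⟨N, hN⟩ := S3 hτ V S (fun i => (hA1 i).mono a1) (fun i => (hA2 i).mono a2)
  have hb : ∀ᶠ t in 𝓝[<] τ, WfNorm f t + WFieldNorm Efld t + WFieldNorm Bfld t ≤
      (ENNReal.ofReal N + ENNReal.ofReal N) + (ENNReal.ofReal (3 * N) + ENNReal.ofReal (9 * N))
        + (ENNReal.ofReal (3 * N) + ENNReal.ofReal (9 * N)) := by
    filter_upwards [Ioo_mem_nhdsLT hτ] with t ht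
    have ht' : t ∈ Ico 0 τ := ⟨ht.1.le, ht.2⟩
    obtain ⟨h1, h2⟩ := hN t ht'
    refine add_le_add (add_le_add ?_ ?_) ?_
    · exact iSup_le fun q => add_le_add (nn_le (h1 q).1) (nn_le (h1 q).2)
    · exact WF_le hEreg ht' (fun x i => (h2 x i).1) fun x i j => ((h2 x i).2.2 j).1
    · exact WF_le hBreg ht' (fun x i => (h2 x i).2.1) fun x i j => ((h2 x i).2.2 j).2
  have hle := limsup_le_of_le (by isBoundedDefault) hb
  rw [hblow] at hle
  exact absurd hle (by
    rw [top_le_iff]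
    simp only [ENNReal.add_eq_top, ENNReal.ofReal_ne_top, or_self, not_false_iff])
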